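/- Let n > 6 and let m = n + p(n−4) for some integer p ≥ 1. Then there exists a quasiisometric embedding Φ : A_{C_m} → A_{C_n} (word metrics) such that for every quasiisometric embedding ψ : A_{C_m} → A_{C_m}, every quasiisometric embedding ψ' : A_{C_n} → A_{C_n}, and every group homomorphism h : A_{C_m} → A_{C_n}, the map Φ is not at finite distance from the composition ψ' ∘ h ∘ ψ. -/

import Mathlib

open scoped symmDiff

/-- The commutation relations defining the right-angled Artin group of a simple graph. -/
def raagRels {V : Type*} (Γ : SimpleGraph V) : Set (FreeGroup V) :=
  {r | ∃ v w, Γ.Adj v w ∧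
    r = FreeGroup.of v * FreeGroup.of w * (FreeGroup.of v)⁻¹ * (FreeGroup.of w)⁻¹}

/-- The right-angled Artin group of a simple graph. -/
abbrev RAAG {V : Type*} (Γ : SimpleGraph V) : Type _ :=
  PresentedGroup (raagRels Γ)

/-- The standard generating set of a right-angled Artin group. -/
def raagGen {V : Type*} (Γ : SimpleGraph V) : Set (RAAG Γ) :=
  Set.range (fun v : V => (PresentedGroup.of v : RAAG Γ))

/-- The word length of a group element with respect to a set `S`: the least length of a
word in elements of `S` and their inverses representing the element. -/
noncomputable def wordLength {G : Type*} [Group G] (S : Set G) (g : G) : ℕ :=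
  sInf {k | ∃ w : List G, w.length = k ∧ (∀ x ∈ w, x ∈ S ∨ x⁻¹ ∈ S) ∧ w.prod = g}

/-- The word metric associated with a generating set `S`. -/
noncomputable def wordDist {G : Type*} [Group G] (S : Set G) (g h : G) : ℝ :=
  (wordLength S (g⁻¹ * h) : ℝ)

/-- `f` is a quasiisometric embedding with respect to distance functions `dX`, `dY`. -/
def IsQIEWith {X Y : Type*} (dX : X → X → ℝ) (dY : Y → Y → ℝ) (f : X → Y) : Prop :=
  ∃ K A : ℝ, 1 ≤ K ∧ 0 ≤ A ∧ ∀ x x' : X,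
    (1 / K) * dX x x' - A ≤ dY (f x) (f x') ∧ dY (f x) (f x') ≤ K * dX x x' + A

/-- The cycle graph on `n` vertices, with vertex set `ZMod n`. -/
def cycleGraph (n : ℕ) : SimpleGraph (ZMod n) :=
  SimpleGraph.fromRel (fun v w => w = v + 1)

/-- Two maps into a group with the word metric of `S` are at finite distance. -/
def AtFiniteDist {Z G : Type*} [Group G] (S : Set G) (f f' : Z → G) : Prop :=
  ∃ C : ℝ, ∀ z : Z, wordDist S (f z) (f' z) ≤ C

namespace RaagProof

section Piles

variable {V : Type*} (Γ : SimpleGraph V)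

/-- The formal inverse of a signed vertex. -/
def flip (s : V × Bool) : V × Bool := (s.1, !s.2)

@[simp] theorem flip_fst (s : V × Bool) : (flip s).1 = s.1 := rfl

@[simp] theorem flip_snd (s : V × Bool) : (flip s).2 = !s.2 := rfl

@[simp] theorem flip_flip (s : V × Bool) : flip (flip s) = s := by
  simp [flip]

/-- A pile assigns to every vertex a stack of signs and blanks. -/
abbrev Pile (V : Type*) := V → List (Option Bool)

open Classical in
/-- Drop a signed vertex on a pile. -/
noncomputable def push (s : V × Bool) (p : Pile V) : Pile V := fun w =>
  if w = s.1 then some s.2 :: p w else if Γ.Adj s.1 w then p w else none :: p w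

open Classical in
/-- Remove the top layer dropped by a signed vertex. -/
noncomputable def pop (v : V) (p : Pile V) : Pile V := fun w =>
  if w = v then (p w).tail else if Γ.Adj v w then p w else (p w).tail

theorem pop_push (s : V × Bool) (p : Pile V) : pop Γ s.1 (push Γ s p) = p := by
  funext w
  simp only [pop, push]
  split_ifs <;> simp

theorem push_comm {s t : V × Bool} (h : Γ.Adj s.1 t.1) (p : Pile V) :
    push Γ s (push Γ t p) = push Γ t (push Γ s p) := by
  funext w
  simp only [push]
  have h1 := h.ne
  have h2 := h.symm
  by_cases hs : w = s.1
  · subst hs; simp [h1, h2]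
  · by_cases ht : w = t.1
    · subst ht; simp [hs, h]
    · by_cases a : Γ.Adj s.1 w <;> by_cases b : Γ.Adj t.1 w <;> simp [hs, ht, a, b]

theorem push_self (s : V × Bool) (p : Pile V) : push Γ s p s.1 = some s.2 :: p s.1 := by
  simp [push]

theorem push_adj {s : V × Bool} {w : V} (h : Γ.Adj s.1 w) (p : Pile V) :
    push Γ s p w = p w := by
  simp [push, h, h.ne']

theorem push_nonadj {s : V × Bool} {w : V} (h : ¬ Γ.Adj s.1 w) (hw : w ≠ s.1) (p : Pile V) :
    push Γ s p w = none :: p w := by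
  simp [push, h, hw]

/-- The top of the stack at `v` shows the sign `e`. -/
def Top (v : V) (e : Bool) (p : Pile V) : Prop := (p v).head? = some (some e)

/-- Piles obtained by dropping signed vertices without cancellation. -/
inductive Valid : Pile V → Prop
  | empty : Valid (fun _ => [])
  | drop (s : V × Bool) (p : Pile V) : Valid p → ¬ Top s.1 (!s.2) p → Valid (push Γ s p)

theorem Valid.exists_push {p : Pile V} (hp : Valid Γ p) {s : V × Bool} (h : Top s.1 s.2 p) :
    ∃ q, Valid Γ q ∧ p = push Γ s q ∧ ¬ Top s.1 (!s.2) q := by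
  induction hp with
  | empty => simp [Top] at h
  | drop t q hq hqt ih =>
    by_cases hst : s.1 = t.1
    · have : s = t := by
        refine Prod.ext hst ?_
        simp only [Top, hst, push_self, List.head?_cons, Option.some.injEq] at h
        exact h.symm
      subst this
      exact ⟨q, hq, rfl, hqt⟩
    · by_cases ha : Γ.Adj t.1 s.1
      · rw [Top, push_adj Γ ha] at h
        obtain ⟨r, hr, rfl, hrs⟩ := ih h
        refine ⟨push Γ t r, ?_, ?_, ?_⟩
        · refine Valid.drop t r hr ?_
          rwa [Top, push_adj Γ ha.symm] at hqt
        · exact push_comm Γ ha r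
        · rwa [Top, push_adj Γ ha]
      · rw [Top, push_nonadj Γ ha hst] at h
        simp at h

open Classical in
/-- The action of a signed vertex on piles. -/
noncomputable def act (s : V × Bool) (p : Pile V) : Pile V :=
  if Top s.1 (!s.2) p then pop Γ s.1 p else push Γ s p

theorem act_push_flip (s : V × Bool) (p : Pile V) : act Γ s (push Γ (flip s) p) = p := by
  rw [act, if_pos]
  · exact pop_push Γ (flip s) p
  · have := push_self Γ (flip s) p
    simp only [flip_fst, flip_snd] at this
    simp [Top, this]

theorem act_of_not_top {s : V × Bool} {p : Pile V} (h : ¬ Top s.1 (!s.2) p) :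
    act Γ s p = push Γ s p := by
  rw [act, if_neg h]

theorem Valid.top_flip_cases {p : Pile V} (hp : Valid Γ p) (s : V × Bool) :
    (∃ q, Valid Γ q ∧ p = push Γ (flip s) q ∧ act Γ s p = q ∧ ¬ Top s.1 s.2 q ∧
      Top s.1 (!s.2) p) ∨
    (¬ Top s.1 (!s.2) p ∧ act Γ s p = push Γ s p) := by
  by_cases h : Top s.1 (!s.2) p
  · left
    obtain ⟨q, hq, rfl, hqs⟩ := hp.exists_push Γ (s := flip s) h
    exact ⟨q, hq, rfl, act_push_flip Γ s q, by simpa using hqs, h⟩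
  · exact Or.inr ⟨h, act_of_not_top Γ h⟩

theorem Valid.act {p : Pile V} (hp : Valid Γ p) (s : V × Bool) : Valid Γ (act Γ s p) := by
  rcases hp.top_flip_cases Γ s with ⟨q, hq, -, h, -⟩ | ⟨h, h'⟩
  · rwa [h]
  · rw [h']
    exact Valid.drop s p hp h

theorem act_flip_act {p : Pile V} (hp : Valid Γ p) (s : V × Bool) :
    act Γ (flip s) (act Γ s p) = p := by
  rcases hp.top_flip_cases Γ s with ⟨q, hq, h1, h, h2, -⟩ | ⟨h, h'⟩
  · rw [h, act_of_not_top, h1]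
    simpa using h2
  · rw [h']
    simpa using act_push_flip Γ (flip s) p

theorem top_act_adj {s : V × Bool} {w : V} (h : Γ.Adj s.1 w) (e : Bool) {p : Pile V}
    (hp : Valid Γ p) : Top w e (act Γ s p) ↔ Top w e p := by
  rcases hp.top_flip_cases Γ s with ⟨q, hq, h1, h2, -⟩ | ⟨-, h2⟩
  · rw [h2, h1, Top, Top, push_adj Γ (s := flip s) h]
  · rw [h2, Top, Top, push_adj Γ h]

theorem act_comm {s t : V × Bool} (h : Γ.Adj s.1 t.1) {p : Pile V} (hp : Valid Γ p) :
    act Γ s (act Γ t p) = act Γ t (act Γ s p) := by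
  have key : ∀ (s t : V × Bool) (q : Pile V), Γ.Adj s.1 t.1 → Valid Γ q →
      act Γ s (push Γ t q) = push Γ t (act Γ s q) := by
    intro s t q h hq
    rcases hq.top_flip_cases Γ s with ⟨r, hr, h1, h2, -⟩ | ⟨h1, h2⟩
    · rw [h2, h1, push_comm Γ (s := t) (t := flip s) h.symm, act_push_flip]
    · rw [h2, act_of_not_top, push_comm Γ h]
      rwa [Top, push_adj Γ h.symm]
  rcases hp.top_flip_cases Γ t with ⟨q, hq, h1, h2, h3, -⟩ | ⟨h1, h2⟩
  · rw [h2, h1, key s (flip t) q h hq, act_push_flip]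
  · rw [h2, key s t p h hp, act_of_not_top (s := t)]
    rwa [top_act_adj Γ h _ hp]

/-- The action of a signed vertex as a permutation of the valid piles. -/
noncomputable def actPerm (s : V × Bool) : Equiv.Perm {p : Pile V // Valid Γ p} where
  toFun p := ⟨act Γ s p.1, p.2.act Γ s⟩
  invFun p := ⟨act Γ (flip s) p.1, p.2.act Γ (flip s)⟩
  left_inv p := Subtype.ext (act_flip_act Γ p.2 s)
  right_inv p := Subtype.ext (by simpa using act_flip_act Γ p.2 (flip s))

/-- The action of the group on valid piles. -/
noncomputable def pileAct : RAAG Γ →* Equiv.Perm {p : Pile V // Valid Γ p} :=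
  PresentedGroup.toGroup (f := fun v => actPerm Γ (v, true)) (by
    rintro r ⟨v, w, hvw, rfl⟩
    have : actPerm Γ (v, true) * actPerm Γ (w, true) =
        actPerm Γ (w, true) * actPerm Γ (v, true) := by
      ext1 p
      exact Subtype.ext (act_comm Γ (s := (v, true)) (t := (w, true)) hvw p.2)
    simp only [map_mul, map_inv, FreeGroup.lift_apply_of, this]
    group)

end Piles

section Basic

variable {V : Type*} {Γ : SimpleGraph V}

variable (Γ) in
/-- The group element of a signed vertex. -/
def lt (s : V × Bool) : RAAG Γ :=
  if s.2 then PresentedGroup.of s.1 else (PresentedGroup.of s.1)⁻¹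

@[simp] theorem lt_flip (s : V × Bool) : lt Γ (flip s) = (lt Γ s)⁻¹ := by
  rcases s with ⟨v, _ | _⟩ <;> simp [lt, flip]

theorem lt_true (v : V) : lt Γ (v, true) = PresentedGroup.of v := rfl

theorem lt_false (v : V) : lt Γ (v, false) = (PresentedGroup.of v)⁻¹ := rfl

theorem of_comm {v w : V} (h : Γ.Adj v w) :
    (PresentedGroup.of v : RAAG Γ) * PresentedGroup.of w =
      PresentedGroup.of w * PresentedGroup.of v := by
  have : (PresentedGroup.mk (raagRels Γ)) (FreeGroup.of v * FreeGroup.of w *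
      (FreeGroup.of v)⁻¹ * (FreeGroup.of w)⁻¹) = 1 :=
    PresentedGroup.one_of_mem ⟨v, w, h, rfl⟩
  simp only [map_mul, map_inv] at this
  rw [mul_inv_eq_one, mul_inv_eq_iff_eq_mul] at this
  exact this

theorem lt_comm {s t : V × Bool} (h : Γ.Adj s.1 t.1) : Commute (lt Γ s) (lt Γ t) := by
  have h0 : Commute (PresentedGroup.of s.1 : RAAG Γ) (PresentedGroup.of t.1) := of_comm h
  rcases s with ⟨v, _ | _⟩ <;> rcases t with ⟨w, _ | _⟩ <;> simp only [lt] <;> simpa using h0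

theorem pileAct_lt (s : V × Bool) : pileAct Γ (lt Γ s) = actPerm Γ s := by
  have h1 : ∀ v, pileAct Γ (lt Γ (v, true)) = actPerm Γ (v, true) := by
    intro v
    rw [lt_true, pileAct, PresentedGroup.toGroup.of]
  rcases s with ⟨v, _ | _⟩
  · have : lt Γ (v, false) = (lt Γ (v, true))⁻¹ := by rw [← lt_flip]; rfl
    rw [this, map_inv, h1]
    rfl
  · exact h1 v

/-- The half-space of elements admitting a reduced word that begins with `s`. -/
def InH (s : V × Bool) (g : RAAG Γ) : Prop :=
  Top s.1 s.2 (pileAct Γ g ⟨fun _ => [], Valid.empty⟩).1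

theorem one_not_inH (s : V × Bool) : ¬ InH s (1 : RAAG Γ) := by
  simp [InH, Top]

theorem inH_lt_mul (s : V × Bool) (g : RAAG Γ) : InH s (lt Γ s * g) ↔ ¬ InH (flip s) g := by
  simp only [InH, map_mul, pileAct_lt, Equiv.Perm.mul_apply]
  set p := pileAct Γ g ⟨fun _ => [], Valid.empty⟩
  change Top s.1 s.2 (act Γ s p.1) ↔ ¬ Top s.1 (!s.2) p.1
  rcases p.2.top_flip_cases Γ s with ⟨q, hq, h1, h2, h3, h4⟩ | ⟨h1, h2⟩
  · simp [h2, h3, h4]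
  · rw [h2, Top, push_self]
    simpa using h1

theorem inH_lt_mul_adj {s t : V × Bool} (h : Γ.Adj t.1 s.1) (g : RAAG Γ) :
    InH s (lt Γ t * g) ↔ InH s g := by
  simp only [InH, map_mul, pileAct_lt, Equiv.Perm.mul_apply]
  exact top_act_adj Γ h _ (Subtype.property _)

theorem InH.adj_or_eq {s t : V × Bool} {g : RAAG Γ} (hs : InH s g) (ht : InH t g) :
    s = t ∨ Γ.Adj s.1 t.1 := by
  simp only [InH] at hs ht
  set p := pileAct Γ g ⟨fun _ => [], Valid.empty⟩
  obtain ⟨q, -, h, -⟩ := p.2.exists_push Γ hs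
  rw [h] at ht
  by_cases h1 : t.1 = s.1
  · left
    rw [Top, h1, push_self] at ht
    simp only [List.head?_cons, Option.some.injEq] at ht
    exact Prod.ext h1.symm ht
  · by_cases h2 : Γ.Adj s.1 t.1
    · exact Or.inr h2
    · rw [Top, push_nonadj Γ h2 h1] at ht
      simp at ht

/-- Word length in the standard generators. -/
noncomputable def len (g : RAAG Γ) : ℕ := wordLength (raagGen Γ) g

variable (Γ) in
/-- Evaluation of a word in signed vertices. -/
def ev (w : List (V × Bool)) : RAAG Γ := (w.map (lt Γ)).prod

@[simp] theorem ev_nil : ev Γ [] = 1 := rfl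

@[simp] theorem ev_cons (s : V × Bool) (w : List (V × Bool)) :
    ev Γ (s :: w) = lt Γ s * ev Γ w := by simp [ev]

@[simp] theorem ev_append (u w : List (V × Bool)) : ev Γ (u ++ w) = ev Γ u * ev Γ w := by
  simp [ev]

theorem exists_ev (g : RAAG Γ) : ∃ w, ev Γ w = g := by
  have h : g ∈ Subgroup.closure (Set.range (PresentedGroup.of (rels := raagRels Γ))) := by
    rw [PresentedGroup.closure_range_of]; trivial
  induction h using Subgroup.closure_induction_left with
  | one => exact ⟨[], rfl⟩
  | mul_left x hx y hy ih =>
    obtain ⟨v, rfl⟩ := hx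
    obtain ⟨w, rfl⟩ := ih
    exact ⟨(v, true) :: w, by simp [lt]⟩
  | inv_mul_cancel x hx y hy ih =>
    obtain ⟨v, rfl⟩ := hx
    obtain ⟨w, rfl⟩ := ih
    exact ⟨(v, false) :: w, by simp [lt]⟩

theorem exists_signed_word (u : List (RAAG Γ))
    (h : ∀ x ∈ u, x ∈ raagGen Γ ∨ x⁻¹ ∈ raagGen Γ) :
    ∃ w, w.length = u.length ∧ ev Γ w = u.prod := by
  induction u with
  | nil => exact ⟨[], rfl, rfl⟩
  | cons x u ih =>
    obtain ⟨w, hw, hw'⟩ := ih fun y hy => h y (List.mem_cons_of_mem _ hy)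
    rcases h x List.mem_cons_self with ⟨v, hv⟩ | ⟨v, hv⟩
    · refine ⟨(v, true) :: w, by simp [hw], ?_⟩
      rw [ev_cons, hw', List.prod_cons, ← hv]
      rfl
    · refine ⟨(v, false) :: w, by simp [hw], ?_⟩
      rw [ev_cons, hw', List.prod_cons, ← inv_inv x, ← hv]
      rfl

theorem len_ev_le (w : List (V × Bool)) : len (ev Γ w) ≤ w.length := by
  refine Nat.sInf_le ⟨w.map (lt Γ), by simp, ?_, rfl⟩
  intro x hx
  obtain ⟨⟨v, e⟩, -, rfl⟩ := List.mem_map.1 hx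
  cases e
  · exact Or.inr ⟨v, by simp [lt]⟩
  · exact Or.inl ⟨v, by simp [lt]⟩

theorem exists_geodesic (g : RAAG Γ) : ∃ w, w.length = len g ∧ ev Γ w = g := by
  obtain ⟨w, rfl⟩ := exists_ev g
  have hne : {k | ∃ u : List (RAAG Γ), u.length = k ∧
      (∀ x ∈ u, x ∈ raagGen Γ ∨ x⁻¹ ∈ raagGen Γ) ∧ u.prod = ev Γ w}.Nonempty := by
    refine ⟨_, w.map (lt Γ), rfl, ?_, rfl⟩
    intro x hx
    obtain ⟨⟨v, e⟩, -, rfl⟩ := List.mem_map.1 hx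
    cases e
    · exact Or.inr ⟨v, by simp [lt]⟩
    · exact Or.inl ⟨v, by simp [lt]⟩
  obtain ⟨u, hu, hu', hu₂⟩ := Nat.sInf_mem hne
  obtain ⟨w', h1, h2⟩ := exists_signed_word u hu'
  exact ⟨w', h1.trans hu, h2.trans hu₂⟩

/-- Words without cancellation. -/
def Good (Γ : SimpleGraph V) : List (V × Bool) → Prop
  | [] => True
  | x :: w => Good Γ w ∧ ¬ InH (flip x) (ev Γ w)

theorem Good.exists_cancel {s : V × Bool} : ∀ {w : List (V × Bool)}, Good Γ w →
    InH s (ev Γ w) → ∃ u, Good Γ u ∧ w.Perm (s :: u) ∧ ev Γ w = lt Γ s * ev Γ u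
  | [], _, h => (one_not_inH s h).elim
  | x :: w, hw, h => by
    rw [ev_cons] at h
    have hx : InH x (lt Γ x * ev Γ w) := (inH_lt_mul x _).2 hw.2
    rcases hx.adj_or_eq h with rfl | ha
    · exact ⟨w, hw.1, List.Perm.refl _, rfl⟩
    · obtain ⟨u, h1, h2, h3⟩ := Good.exists_cancel hw.1 ((inH_lt_mul_adj ha _).1 h)
      refine ⟨x :: u, ⟨h1, ?_⟩, (h2.cons x).trans (List.Perm.swap s x u), ?_⟩
      · have := hw.2
        rwa [h3, inH_lt_mul_adj (s := flip x) ha.symm] at this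
      · rw [ev_cons, h3, ev_cons, ← mul_assoc, (lt_comm ha).eq, mul_assoc]

theorem exists_good : ∀ w : List (V × Bool), ∃ u, Good Γ u ∧ u.Subperm w ∧
    ev Γ u = ev Γ w
  | [] => ⟨[], trivial, List.Subperm.refl _, rfl⟩
  | x :: w => by
    obtain ⟨u, h1, h2, h3⟩ := exists_good w
    by_cases h : InH (flip x) (ev Γ u)
    · obtain ⟨v, h4, h5, h6⟩ := h1.exists_cancel h
      refine ⟨v, h4, ?_, ?_⟩
      · exact (((List.subperm_cons_self).trans h5.symm.subperm).trans h2).trans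
          List.subperm_cons_self
      rw [ev_cons, ← h3, h6, lt_flip, mul_inv_cancel_left]
    · exact ⟨x :: u, ⟨h1, h⟩, (List.subperm_cons x).2 h2, by rw [ev_cons, ev_cons, h3]⟩

theorem Good.perm : ∀ {u w : List (V × Bool)}, Good Γ u → Good Γ w → ev Γ u = ev Γ w →
    u.Perm w
  | [], [], _, _, _ => List.Perm.refl _
  | [], y :: w, _, hw, h => by
    have : InH y (ev Γ (y :: w)) := by rw [ev_cons]; exact (inH_lt_mul y _).2 hw.2
    rw [← h] at this
    exact (one_not_inH y this).elim
  | x :: u, w, hu, hw, h => by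
    have : InH x (ev Γ (x :: u)) := by rw [ev_cons]; exact (inH_lt_mul x _).2 hu.2
    rw [h] at this
    obtain ⟨v, h1, h2, h3⟩ := hw.exists_cancel this
    rw [h3, ev_cons, mul_right_inj] at h
    exact ((Good.perm hu.1 h1 h).cons x).trans h2.symm

theorem Good.length_eq_len {w : List (V × Bool)} (hw : Good Γ w) : w.length = len (ev Γ w) := by
  obtain ⟨u, h1, h2⟩ := exists_geodesic (ev Γ w)
  obtain ⟨v, h3, h4, h5⟩ := exists_good (Γ := Γ) u
  have h6 := len_ev_le (Γ := Γ) v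
  rw [h5, h2] at h6
  have h7 := (hw.perm h3 (by rw [h5, h2])).length_eq
  have h8 := h4.length_le
  omega

theorem exists_good_perm (w : List (V × Bool)) (h : w.length = len (ev Γ w)) :
    ∃ u, Good Γ u ∧ u.Perm w ∧ ev Γ u = ev Γ w := by
  obtain ⟨u, h1, h2, h3⟩ := exists_good (Γ := Γ) w
  have h4 := h1.length_eq_len
  rw [h3] at h4
  exact ⟨u, h1, h2.perm_of_length_le (by omega), h3⟩

theorem exists_good_word (g : RAAG Γ) : ∃ w, Good Γ w ∧ ev Γ w = g := by
  obtain ⟨w, rfl⟩ := exists_ev g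
  obtain ⟨u, h, -, h'⟩ := exists_good (Γ := Γ) w
  exact ⟨u, h, h'⟩

open Classical in
/-- The number of letters of type `v` in a reduced word. -/
noncomputable def vcount (v : V) (g : RAAG Γ) : ℕ :=
  (exists_good_word g).choose.countP fun s => s.1 = v

open Classical in
theorem Good.vcount_eq {w : List (V × Bool)} (hw : Good Γ w) (v : V) :
    vcount v (ev Γ w) = w.countP fun s => s.1 = v := by
  obtain ⟨h1, h2⟩ := (exists_good_word (ev Γ w)).choose_spec
  exact (h1.perm hw h2).countP_eq _

open Classical in
theorem vcount_ev {w : List (V × Bool)} (hw : w.length = len (ev Γ w)) (v : V) :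
    vcount v (ev Γ w) = w.countP fun s => s.1 = v := by
  obtain ⟨u, h1, h2, h3⟩ := exists_good_perm w hw
  rw [← h3, h1.vcount_eq, h2.countP_eq]

open Classical in
theorem vcount_ev_le (w : List (V × Bool)) (v : V) :
    vcount v (ev Γ w) ≤ w.countP fun s => s.1 = v := by
  obtain ⟨u, h1, h2, h3⟩ := exists_good (Γ := Γ) w
  rw [← h3, h1.vcount_eq]
  exact h2.countP_le _

theorem vcount_le_len (v : V) (g : RAAG Γ) : vcount v g ≤ len g := by
  obtain ⟨w, hw, rfl⟩ := exists_good_word g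
  rw [hw.vcount_eq, ← hw.length_eq_len]
  exact List.countP_le_length

theorem vcount_mul_le (v : V) (g h : RAAG Γ) : vcount v (g * h) ≤ vcount v g + vcount v h := by
  obtain ⟨u, hu, rfl⟩ := exists_good_word g
  obtain ⟨w, hw, rfl⟩ := exists_good_word h
  rw [hu.vcount_eq, hw.vcount_eq, ← ev_append, ← List.countP_append]
  exact vcount_ev_le _ _

theorem len_lt_mul {s : V × Bool} {g : RAAG Γ} (h : ¬ InH (flip s) g) :
    len (lt Γ s * g) = len g + 1 := by
  obtain ⟨w, hw, rfl⟩ := exists_good_word g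
  have : Good Γ (s :: w) := ⟨hw, h⟩
  have h2 := this.length_eq_len
  rw [ev_cons] at h2
  rw [← h2, ← hw.length_eq_len, List.length_cons]

theorem len_inv_lt_mul {s : V × Bool} {g : RAAG Γ} (h : InH s g) :
    len ((lt Γ s)⁻¹ * g) + 1 = len g := by
  obtain ⟨w, hw, rfl⟩ := exists_good_word g
  obtain ⟨u, hu, h1, h2⟩ := hw.exists_cancel h
  rw [h2, inv_mul_cancel_left, ← h2, ← hu.length_eq_len, ← hw.length_eq_len, h1.length_eq,
    List.length_cons]

theorem len_inv_lt_mul' {s : V × Bool} {g : RAAG Γ} (h : ¬ InH s g) :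
    len ((lt Γ s)⁻¹ * g) = len g + 1 := by
  rw [← lt_flip]
  exact len_lt_mul (by simpa using h)

theorem inH_iff {s : V × Bool} {g : RAAG Γ} : InH s g ↔ len ((lt Γ s)⁻¹ * g) < len g := by
  by_cases h : InH s g
  · have := len_inv_lt_mul h
    exact iff_of_true h (by omega)
  · have := len_inv_lt_mul' h
    exact iff_of_false h (by omega)

@[simp] theorem len_one : len (1 : RAAG Γ) = 0 := by
  have := len_ev_le (Γ := Γ) []
  simpa using this

theorem len_mul (g h : RAAG Γ) : len (g * h) ≤ len g + len h := by
  obtain ⟨u, h1, rfl⟩ := exists_geodesic g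
  obtain ⟨w, h2, rfl⟩ := exists_geodesic h
  rw [← ev_append, ← h1, ← h2, ← List.length_append]
  exact len_ev_le _

theorem len_inv_le (g : RAAG Γ) : len g⁻¹ ≤ len g := by
  obtain ⟨u, h1, rfl⟩ := exists_geodesic g
  have : (ev Γ u)⁻¹ = ev Γ (u.map flip).reverse := by
    clear h1
    induction u with
    | nil => simp
    | cons x u ih => simp [ih]
  rw [this, ← h1]
  exact (len_ev_le _).trans (by simp)

@[simp] theorem len_inv (g : RAAG Γ) : len g⁻¹ = len g :=
  le_antisymm (len_inv_le g) (by simpa using len_inv_le g⁻¹)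

theorem len_eq_zero {g : RAAG Γ} : len g = 0 ↔ g = 1 := by
  constructor
  · intro h
    obtain ⟨u, h1, rfl⟩ := exists_geodesic g
    rw [h, List.length_eq_zero_iff] at h1
    simp [h1]
  · rintro rfl
    exact len_one

@[simp] theorem len_lt (s : V × Bool) : len (lt Γ s) = 1 := by
  simpa using len_lt_mul (one_not_inH (flip s) : ¬ InH (flip s) (1 : RAAG Γ))

theorem lt_inH (s : V × Bool) : InH s (lt Γ s) := by
  simpa using (inH_lt_mul s (1 : RAAG Γ)).2 (one_not_inH _)

/-- Every nontrivial element has a first letter. -/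
theorem exists_first {g : RAAG Γ} (hg : g ≠ 1) :
    ∃ s k, g = lt Γ s * k ∧ len g = len k + 1 ∧ InH s g := by
  obtain ⟨w, hw, rfl⟩ := exists_good_word g
  cases w with
  | nil => exact (hg rfl).elim
  | cons x w =>
    refine ⟨x, ev Γ w, rfl, ?_, ?_⟩
    · rw [← hw.length_eq_len, ← hw.1.length_eq_len, List.length_cons]
    · rw [ev_cons]
      exact (inH_lt_mul x _).2 hw.2

end Basic

section Retract

variable {V : Type*} {Γ : SimpleGraph V}

open Classical in
variable (Γ) in
/-- The retraction onto the subgroup spanned by a set of vertices. -/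
noncomputable def ret (L : Set V) : RAAG Γ →* RAAG Γ :=
  PresentedGroup.toGroup (f := fun v => if v ∈ L then PresentedGroup.of v else 1) (by
    rintro r ⟨v, w, hvw, rfl⟩
    simp only [map_mul, map_inv, FreeGroup.lift_apply_of]
    split_ifs
    · rw [of_comm hvw]; group
    all_goals simp)

open Classical in
theorem ret_lt (L : Set V) (s : V × Bool) :
    ret Γ L (lt Γ s) = if s.1 ∈ L then lt Γ s else 1 := by
  rcases s with ⟨v, _ | _⟩ <;> simp only [lt, ret] <;> simp <;> split_ifs <;> simp

theorem ret_lt_mem {L : Set V} {s : V × Bool} (h : s.1 ∈ L) : ret Γ L (lt Γ s) = lt Γ s := by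
  rw [ret_lt, if_pos h]

theorem ret_lt_not_mem {L : Set V} {s : V × Bool} (h : s.1 ∉ L) : ret Γ L (lt Γ s) = 1 := by
  rw [ret_lt, if_neg h]

/-- Two homomorphisms that agree on letters are equal. -/
theorem hom_ext {G : Type*} [Group G] {f f' : RAAG Γ →* G}
    (h : ∀ v, f (lt Γ (v, true)) = f' (lt Γ (v, true))) (g : RAAG Γ) : f g = f' g := by
  have : f = f' := PresentedGroup.ext fun v => h v
  rw [this]

theorem ret_ret (L M : Set V) (g : RAAG Γ) : ret Γ L (ret Γ M g) = ret Γ (L ∩ M) g := by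
  refine hom_ext (f := (ret Γ L).comp (ret Γ M)) (fun v => ?_) g
  rw [MonoidHom.comp_apply]
  by_cases h1 : v ∈ M
  · rw [ret_lt_mem (s := (v, true)) h1]
    by_cases h2 : v ∈ L
    · rw [ret_lt_mem (s := (v, true)) h2, ret_lt_mem (s := (v, true)) (show v ∈ L ∩ M from ⟨h2, h1⟩)]
    · rw [ret_lt_not_mem (s := (v, true)) h2, 
        ret_lt_not_mem (s := (v, true)) fun h : v ∈ L ∩ M => h2 h.1]
  · rw [ret_lt_not_mem (s := (v, true)) h1, map_one,
      ret_lt_not_mem (s := (v, true)) fun h : v ∈ L ∩ M => h1 h.2]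

open Classical in
theorem ret_ev (L : Set V) (w : List (V × Bool)) :
    ret Γ L (ev Γ w) = ev Γ (w.filter fun s => s.1 ∈ L) := by
  induction w with
  | nil => simp
  | cons x w ih =>
    rw [ev_cons, map_mul, ih, List.filter_cons]
    by_cases h : x.1 ∈ L
    · simp [h, ret_lt_mem h]
    · simp [h, ret_lt_not_mem h]

theorem len_ret_le (L : Set V) (g : RAAG Γ) : len (ret Γ L g) ≤ len g := by
  obtain ⟨w, h, rfl⟩ := exists_geodesic g
  rw [ret_ev, ← h]
  exact (len_ev_le _).trans (List.length_filter_le _ _)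

theorem ret_eq_of_len {L : Set V} {g : RAAG Γ} (h : len g ≤ len (ret Γ L g)) :
    ret Γ L g = g := by
  classical
  obtain ⟨w, h1, rfl⟩ := exists_geodesic g
  rw [ret_ev] at h ⊢
  have h2 := len_ev_le (Γ := Γ) (w.filter fun s => s.1 ∈ L)
  rw [List.filter_sublist.eq_of_length_le (h1 ▸ h.trans h2)]

variable (Γ) in
/-- The subgroup spanned by a set of vertices. -/
noncomputable def sp (L : Set V) : Subgroup (RAAG Γ) := (ret Γ L).range

theorem mem_sp {L : Set V} {g : RAAG Γ} : g ∈ sp Γ L ↔ ret Γ L g = g := by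
  constructor
  · rintro ⟨k, rfl⟩
    rw [ret_ret, Set.inter_self]
  · intro h
    exact ⟨g, h⟩

theorem ret_mem_sp (L : Set V) (g : RAAG Γ) : ret Γ L g ∈ sp Γ L := ⟨g, rfl⟩

theorem lt_mem_sp {L : Set V} {s : V × Bool} (h : s.1 ∈ L) : lt Γ s ∈ sp Γ L :=
  mem_sp.2 (ret_lt_mem h)

theorem sp_inter {L M : Set V} {g : RAAG Γ} (h : g ∈ sp Γ L) (h' : g ∈ sp Γ M) :
    g ∈ sp Γ (L ∩ M) := by
  rw [mem_sp] at *
  rw [← ret_ret, h', h]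

theorem sp_mono {L M : Set V} (hLM : L ⊆ M) {g : RAAG Γ} (h : g ∈ sp Γ L) : g ∈ sp Γ M := by
  rw [mem_sp] at *
  rw [← h, ret_ret, Set.inter_eq_right.2 hLM]

/-- Retracting an element of a special subgroup lands in the intersection. -/
theorem ret_mem_sp_inter {M : Set V} {g : RAAG Γ} (h : g ∈ sp Γ M) (L : Set V) :
    ret Γ L g ∈ sp Γ (L ∩ M) := by
  rw [mem_sp] at h
  rw [← h, ret_ret]
  exact ret_mem_sp _ _

theorem sp_empty {g : RAAG Γ} (h : g ∈ sp Γ (∅ : Set V)) : g = 1 := by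
  rw [mem_sp] at h
  rw [← h]
  exact hom_ext (f' := 1) (fun v => by rw [ret_lt_not_mem (by simp)]; rfl) g

theorem ev_mem_sp {L : Set V} {w : List (V × Bool)} (h : ∀ x ∈ w, x.1 ∈ L) :
    ev Γ w ∈ sp Γ L := by
  induction w with
  | nil => exact one_mem _
  | cons x w ih =>
    rw [ev_cons]
    exact mul_mem (lt_mem_sp (h x (by simp))) (ih fun y hy => h y (by simp [hy]))

theorem exists_word_sp {L : Set V} {g : RAAG Γ} (h : g ∈ sp Γ L) :
    ∃ w, ev Γ w = g ∧ w.length = len g ∧ ∀ x ∈ w, x.1 ∈ L := by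
  classical
  obtain ⟨w, h1, rfl⟩ := exists_geodesic g
  have h2 : ev Γ (w.filter fun s => s.1 ∈ L) = ev Γ w := by rw [← ret_ev, mem_sp.1 h]
  refine ⟨w.filter fun s => s.1 ∈ L, h2, ?_, by simp⟩
  apply le_antisymm
  · rw [← h1]
    exact List.length_filter_le _ _
  · rw [← h2]
    exact len_ev_le _

/-- A special subgroup does not meet half-spaces of foreign letters. -/
theorem not_inH_of_mem_sp {L : Set V} {s : V × Bool} {u : RAAG Γ} (hu : u ∈ sp Γ L)
    (hs : s.1 ∉ L) : ¬ InH s u := by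
  intro h
  have h1 := len_inv_lt_mul h
  have h2 := len_ret_le L ((lt Γ s)⁻¹ * u)
  rw [map_mul, map_inv, ret_lt_not_mem hs, mem_sp.1 hu, inv_one, one_mul] at h2
  omega

theorem mem_sp_of_prefix {L : Set V} {a b : RAAG Γ} (h : len (a * b) = len a + len b)
    (hab : a * b ∈ sp Γ L) : a ∈ sp Γ L ∧ b ∈ sp Γ L := by
  rw [mem_sp] at hab
  have h1 := len_ret_le L a
  have h2 := len_ret_le L b
  have h3 := len_mul (ret Γ L a) (ret Γ L b)
  rw [← map_mul, hab] at h3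
  exact ⟨mem_sp.2 (ret_eq_of_len (by omega)), mem_sp.2 (ret_eq_of_len (by omega))⟩

variable (Γ) in
/-- The link of a vertex. -/
def lk (v : V) : Set V := {w | Γ.Adj v w}

variable (Γ) in
/-- The star of a vertex. -/
def st (v : V) : Set V := insert v (lk Γ v)

theorem not_mem_lk (v : V) : v ∉ lk Γ v := fun h => h.ne rfl

theorem inH_sp_mul {s : V × Bool} {u : RAAG Γ} (hu : u ∈ sp Γ (lk Γ s.1)) (g : RAAG Γ) :
    InH s (u * g) ↔ InH s g := by
  obtain ⟨w, rfl, -, hw⟩ := exists_word_sp hu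
  clear hu
  induction w with
  | nil => simp
  | cons x w ih =>
    rw [ev_cons, mul_assoc, inH_lt_mul_adj (hw x (by simp)).symm]
    exact ih fun y hy => hw y (by simp [hy])

theorem sp_lk_commute {s : V × Bool} {u : RAAG Γ} (hu : u ∈ sp Γ (lk Γ s.1)) :
    Commute (lt Γ s) u := by
  obtain ⟨w, rfl, -, hw⟩ := exists_word_sp hu
  clear hu
  induction w with
  | nil => simp
  | cons x w ih =>
    rw [ev_cons]
    exact (lt_comm (hw x (by simp))).mul_right (ih fun y hy => hw y (by simp [hy]))

/-- An edge entering a half-space is labelled by its letter and lies along its wall. -/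
theorem enter_half {s x : V × Bool} {p : RAAG Γ} (h1 : ¬ InH s p) (h2 : InH s (p * lt Γ x)) :
    x = s ∧ p ∈ sp Γ (lk Γ s.1) := by
  induction hn : len p using Nat.strong_induction_on generalizing p s with
  | _ n ih =>
    by_cases hp : p = 1
    · subst hp
      rw [one_mul] at h2
      refine ⟨?_, one_mem _⟩
      rcases h2.adj_or_eq (lt_inH x) with h | h
      · exact h.symm
      · have h3 := not_inH_of_mem_sp (lt_mem_sp (Γ := Γ) (L := {x.1}) (s := x) rfl)
          (s := s) (by simpa using h.ne)
        exact (h3 h2).elim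
    · obtain ⟨t, k, rfl, hk, ht⟩ := exists_first hp
      rw [mul_assoc] at h2
      by_cases h3 : InH t (lt Γ t * (k * lt Γ x))
      · rcases h3.adj_or_eq h2 with h4 | h4
        · subst h4
          exact (h1 ht).elim
        · rw [inH_lt_mul_adj h4] at h1 h2
          obtain ⟨h5, h6⟩ := ih (len k) (by omega) h1 h2 rfl
          exact ⟨h5, mul_mem (lt_mem_sp h4.symm) h6⟩
      · have h4 : InH (flip t) (k * lt Γ x) := by
          rw [inH_lt_mul] at h3
          exact not_not.1 h3
        have h5 : ¬ InH (flip t) k := (inH_lt_mul t k).1 ht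
        obtain ⟨rfl, h7⟩ := ih (len k) (by omega) h5 h4 rfl
        rw [lt_flip, ← mul_assoc, (sp_lk_commute (s := t) h7).eq, mul_inv_cancel_right] at h2
        by_cases h8 : s.1 ∈ lk Γ t.1
        · exact (h1 ((inH_lt_mul_adj h8 k).2 h2)).elim
        · exact (not_inH_of_mem_sp h7 h8 h2).elim

/-- The word metric with values in `ℕ`. -/
noncomputable def dd (g h : RAAG Γ) : ℕ := len (g⁻¹ * h)

theorem dd_self (g : RAAG Γ) : dd g g = 0 := by simp [dd]

theorem dd_comm (g h : RAAG Γ) : dd g h = dd h g := by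
  rw [dd, dd, ← len_inv]
  simp

theorem dd_triangle (a b c : RAAG Γ) : dd a c ≤ dd a b + dd b c := by
  have := len_mul (a⁻¹ * b) (b⁻¹ * c)
  simpa [dd, mul_assoc] using this

@[simp] theorem dd_mul_left (g a b : RAAG Γ) : dd (g * a) (g * b) = dd a b := by
  simp [dd, mul_assoc]

theorem dd_mul_right_self (g a : RAAG Γ) : dd g (g * a) = len a := by simp [dd]

theorem dd_one_left (g : RAAG Γ) : dd 1 g = len g := by simp [dd]

theorem crossing_one {s : V × Bool} {a b : RAAG Γ} (ha : ¬ InH s a) (hb : InH s b) :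
    ∃ e, e ∈ sp Γ (lk Γ s.1) ∧ dd a e + 1 + dd (e * lt Γ s) b = dd a b := by
  induction hn : dd a b using Nat.strong_induction_on generalizing a with
  | _ n ih =>
    have hab : a⁻¹ * b ≠ 1 := by
      intro h
      rw [inv_mul_eq_one] at h
      exact ha (h ▸ hb)
    obtain ⟨x, k, hx, hk, -⟩ := exists_first hab
    have hb' : b = a * lt Γ x * k := by rw [mul_assoc, ← hx, mul_inv_cancel_left]
    have hd : dd (a * lt Γ x) b = len k := by rw [hb', dd_mul_right_self]
    have hd' : dd a b = len k + 1 := hk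
    by_cases h : InH s (a * lt Γ x)
    · obtain ⟨rfl, h2⟩ := enter_half ha h
      refine ⟨a, h2, ?_⟩
      rw [dd_self, hd]
      omega
    · obtain ⟨e, h1, h2⟩ := ih (len k) (by omega) h hd
      refine ⟨e, h1, ?_⟩
      have h3 := dd_triangle a (a * lt Γ x) e
      have h4 := dd_triangle a e b
      have h5 := dd_triangle e (e * lt Γ s) b
      rw [dd_mul_right_self, len_lt] at h3 h5
      omega

/-- A geodesic from outside a half-space to its inside crosses the wall. -/
theorem crossing {s : V × Bool} {g a b : RAAG Γ} (ha : ¬ InH s (g⁻¹ * a))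
    (hb : InH s (g⁻¹ * b)) : ∃ e, g⁻¹ * e ∈ sp Γ (lk Γ s.1) ∧
      dd a e + 1 + dd (e * lt Γ s) b = dd a b := by
  obtain ⟨e, h1, h2⟩ := crossing_one ha hb
  refine ⟨g * e, by simpa using h1, ?_⟩
  have h3 := dd_mul_left g⁻¹ a (g * e)
  have h4 := dd_mul_left g⁻¹ (g * e * lt Γ s) b
  rw [dd_mul_left] at h2
  rw [inv_mul_cancel_left] at h3
  rw [mul_assoc, inv_mul_cancel_left, ← mul_assoc] at h4
  rw [← h2, h3, h4]

theorem crossing_le {s : V × Bool} {g a b : RAAG Γ} (ha : ¬ InH s (g⁻¹ * a))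
    (hb : InH s (g⁻¹ * b)) : ∃ e, g⁻¹ * e ∈ sp Γ (lk Γ s.1) ∧
      dd a e + dd e b = dd a b := by
  obtain ⟨e, h1, h2⟩ := crossing ha hb
  refine ⟨e, h1, ?_⟩
  have h3 := dd_triangle a e b
  have h4 := dd_triangle e (e * lt Γ s) b
  rw [dd_mul_right_self, len_lt] at h4
  omega

theorem inH_of_reduced_mul {s : V × Bool} {g h : RAAG Γ} (hl : len (g * h) = len g + len h)
    (h1 : InH s (g * h)) (h2 : ¬ InH s g) : g ∈ sp Γ (lk Γ s.1) ∧ InH s h := by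
  obtain ⟨e, h3, h4⟩ := crossing_le (g := 1) (a := g) (b := g * h) (s := s)
    (by simpa using h2) (by simpa using h1)
  rw [dd_mul_right_self] at h4
  have h5 := dd_triangle 1 e (g * h)
  have h6 := dd_triangle 1 g e
  rw [dd_one_left, dd_one_left] at h5 h6
  have h7 : e = g * (g⁻¹ * e) := by group
  simp only [inv_one, one_mul] at h3
  have h8 := (mem_sp_of_prefix (a := g) (b := g⁻¹ * e) (L := lk Γ s.1) (by
    rw [← h7]
    change _ = len g + dd g e
    omega) (by rwa [← h7])).1
  exact ⟨h8, (inH_sp_mul h8 h).1 h1⟩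

/-- If `x` has no first letter in `L` then multiplication by `sp L` is reduced. -/
theorem len_sp_mul {L : Set V} {a x : RAAG Γ} (ha : a ∈ sp Γ L)
    (hx : ∀ s : V × Bool, s.1 ∈ L → ¬ InH s x) : len (a * x) = len a + len x := by
  induction hn : len a using Nat.strong_induction_on generalizing a with
  | _ n ih =>
    by_cases h : a = 1
    · subst h
      simp at hn ⊢
      omega
    · obtain ⟨t, k, rfl, hk, ht⟩ := exists_first h
      obtain ⟨h1, h2⟩ := mem_sp_of_prefix (by rw [hk, len_lt, add_comm]) ha
      have h3 := ih (len k) (by omega) h2 rfl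
      have htL : (flip t).1 ∈ L := by
        by_contra hc
        exact not_inH_of_mem_sp (s := t) ha hc ht
      have h4 : ¬ InH (flip t) (k * x) := by
        intro h5
        exact hx _ htL (inH_of_reduced_mul h3 h5 ((inH_lt_mul t k).1 ht)).2
      rw [mul_assoc, len_lt_mul h4]
      omega

/-- The form of `len_sp_mul` with the special factor on the right. -/
theorem len_mul_sp {L : Set V} {a x : RAAG Γ} (ha : a ∈ sp Γ L)
    (hx : ∀ s : V × Bool, s.1 ∈ L → ¬ InH s x⁻¹) : len (x * a) = len x + len a := by
  have := len_sp_mul (inv_mem ha) hx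
  rw [← len_inv, mul_inv_rev, this]
  simp [add_comm]

end Retract

section Abelian

variable {V : Type*} {Γ : SimpleGraph V}

open Classical in
variable (Γ) in
/-- The exponent-sum homomorphism of a vertex, written multiplicatively. -/
noncomputable def abHom (v : V) : RAAG Γ →* Multiplicative ℤ :=
  PresentedGroup.toGroup (f := fun w => Multiplicative.ofAdd (if w = v then 1 else 0)) (by
    rintro r ⟨x, w, hvw, rfl⟩
    simp only [map_mul, map_inv, FreeGroup.lift_apply_of]
    rw [mul_comm (Multiplicative.ofAdd _) (Multiplicative.ofAdd _)]
    simp)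

/-- The exponent sum of a vertex. -/
noncomputable def ab (v : V) (g : RAAG Γ) : ℤ := Multiplicative.toAdd (abHom Γ v g)

@[simp] theorem ab_one (v : V) : ab v (1 : RAAG Γ) = 0 := by simp [ab]

@[simp] theorem ab_mul (v : V) (g h : RAAG Γ) : ab v (g * h) = ab v g + ab v h := by simp [ab]

@[simp] theorem ab_inv (v : V) (g : RAAG Γ) : ab v g⁻¹ = -ab v g := by simp [ab]

@[simp] theorem ab_zpow (v : V) (g : RAAG Γ) (k : ℤ) : ab v (g ^ k) = k * ab v g := by
  simp [ab]

open Classical in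
theorem ab_of (v w : V) :
    ab v (PresentedGroup.of w : RAAG Γ) = if w = v then 1 else 0 := by
  simp [ab, abHom]

@[simp] theorem ab_of_self (v : V) : ab v (PresentedGroup.of v : RAAG Γ) = 1 := by
  simp [ab_of]

theorem ab_of_ne {v w : V} (h : w ≠ v) : ab v (PresentedGroup.of w : RAAG Γ) = 0 := by
  simp [ab_of, h]

theorem abs_ab_lt_le (v : V) (s : V × Bool) : |ab v (lt Γ s)| ≤ 1 := by
  rcases s with ⟨w, _ | _⟩ <;> by_cases h : w = v <;> simp [lt, ab_of, h]

theorem abs_ab_le (v : V) (g : RAAG Γ) : |ab v g| ≤ len g := by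
  obtain ⟨w, h, rfl⟩ := exists_geodesic g
  rw [← h]
  clear h
  induction w with
  | nil => simp
  | cons x w ih =>
    rw [ev_cons, ab_mul]
    have := abs_add_le (ab v (lt Γ x)) (ab v (ev Γ w))
    have := abs_ab_lt_le (Γ := Γ) v x
    simp only [List.length_cons]
    push_cast
    linarith

theorem abs_ab_sub_le (v : V) (g h : RAAG Γ) : |ab v g - ab v h| ≤ dd g h := by
  have := abs_ab_le v (g⁻¹ * h)
  rw [ab_mul, ab_inv] at this
  rw [abs_sub_comm]
  rw [neg_add_eq_sub] at this
  exact this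

theorem len_zpow_le (g : RAAG Γ) (k : ℤ) : len (g ^ k) ≤ k.natAbs * len g := by
  have h : ∀ n : ℕ, len (g ^ n) ≤ n * len g := by
    intro n
    induction n with
    | zero => simp
    | succ n ih =>
      rw [pow_succ]
      have := len_mul (g ^ n) g
      linarith
  rcases k with n | n
  · simpa using h n
  · rw [zpow_negSucc, len_inv]
    exact h (n + 1)

theorem len_of_zpow (v : V) (k : ℤ) : len ((PresentedGroup.of v : RAAG Γ) ^ k) = k.natAbs := by
  apply le_antisymm
  · have := len_zpow_le (PresentedGroup.of v : RAAG Γ) k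
    rw [← lt_true, len_lt, lt_true] at this
    simpa using this
  · have := abs_ab_le v ((PresentedGroup.of v : RAAG Γ) ^ k)
    rw [ab_zpow, ab_of_self, mul_one, Int.abs_eq_natAbs] at this
    omega

theorem lt_eq_zpow (s : V × Bool) :
    lt Γ s = (PresentedGroup.of s.1) ^ (ab s.1 (lt Γ s)) := by
  rcases s with ⟨v, _ | _⟩ <;> simp [lt]

theorem eq_zpow_of_mem_sp {v : V} {g : RAAG Γ} (h : g ∈ sp Γ {v}) :
    g = (PresentedGroup.of v) ^ ab v g := by
  obtain ⟨w, rfl, -, hw⟩ := exists_word_sp h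
  clear h
  induction w with
  | nil => simp
  | cons x w ih =>
    have hx : x.1 = v := hw x (by simp)
    rw [ev_cons, ab_mul, zpow_add, ← ih fun y hy => hw y (by simp [hy]), ← hx, ← lt_eq_zpow]

theorem zpow_mem_sp {v : V} {L : Set V} (h : v ∈ L) (k : ℤ) :
    (PresentedGroup.of v : RAAG Γ) ^ k ∈ sp Γ L :=
  zpow_mem (lt_mem_sp (s := (v, true)) h) k

theorem ab_of_mem_sp {v : V} {L : Set V} (hv : v ∉ L) {g : RAAG Γ} (h : g ∈ sp Γ L) :
    ab v g = 0 := by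
  obtain ⟨w, rfl, -, hw⟩ := exists_word_sp h
  clear h
  induction w with
  | nil => simp
  | cons x w ih =>
    have hx : x.1 ≠ v := fun h => hv (h ▸ hw x (by simp))
    rw [ev_cons, ab_mul, ih fun y hy => hw y (by simp [hy]), lt_eq_zpow, ab_zpow, ab_of_ne hx]
    simp

/-- Elements of a star subgroup split off a power of the centre. -/
theorem eq_ret_mul_zpow {v : V} {g : RAAG Γ} (h : g ∈ sp Γ (st Γ v)) :
    g = ret Γ (lk Γ v) g * (PresentedGroup.of v) ^ ab v g := by
  obtain ⟨w, rfl, -, hw⟩ := exists_word_sp h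
  clear h
  induction w with
  | nil => simp
  | cons x w ih =>
    have ih' := ih fun y hy => hw y (by simp [hy])
    rw [ev_cons, ab_mul, map_mul, zpow_add]
    rcases hw x (by simp) with hx | hx
    · rw [ret_lt_not_mem (by rw [hx]; exact not_mem_lk v), one_mul, ← hx, ← lt_eq_zpow, hx,
        ← mul_assoc, ← (sp_lk_commute (s := x) (by rw [hx]; exact ret_mem_sp _ _)).eq, mul_assoc,
        ← ih']
    · have h0 : ab v (lt Γ x) = 0 := ab_of_mem_sp (not_mem_lk v) (lt_mem_sp hx)
      rw [ret_lt_mem hx, h0, zpow_zero, one_mul, mul_assoc, ← ih']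

end Abelian

section Walls

variable {V : Type*} {Γ : SimpleGraph V}

theorem vcount_of_mem_sp {v : V} {L : Set V} (hv : v ∉ L) {g : RAAG Γ} (h : g ∈ sp Γ L) :
    vcount v g = 0 := by
  obtain ⟨w, rfl, -, hw⟩ := exists_word_sp h
  have := vcount_ev_le (Γ := Γ) w v
  rw [List.countP_eq_zero.2] at this
  · omega
  · intro x hx
    simp only [decide_eq_true_eq]
    rintro rfl
    exact hv (hw x hx)

theorem exists_split_countP {α : Type*} (P : α → Bool) (N : ℕ) :
    ∀ w : List α, N < w.countP P → ∃ u s t, w = u ++ s :: t ∧ P s ∧ u.countP P = N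
  | [], h => by simp at h
  | x :: w, h => by
    by_cases hx : P x
    · cases N with
      | zero => exact ⟨[], x, w, rfl, hx, rfl⟩
      | succ N =>
        rw [List.countP_cons_of_pos hx] at h
        obtain ⟨u, s, t, rfl, h1, h2⟩ := exists_split_countP P N w (by omega)
        exact ⟨x :: u, s, t, rfl, h1, by rw [List.countP_cons_of_pos hx, h2]⟩
    · rw [List.countP_cons_of_neg hx] at h
      obtain ⟨u, s, t, rfl, h1, h2⟩ := exists_split_countP P N w h
      exact ⟨x :: u, s, t, rfl, h1, by rw [List.countP_cons_of_neg hx, h2]⟩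

/-- Many letters of one type on a geodesic give a wall separating two balls. -/
theorem exists_wall {v : V} {a b : RAAG Γ} {r : ℕ} (h : 2 * r + 2 ≤ vcount v (a⁻¹ * b)) :
    ∃ (g : RAAG Γ) (s : V × Bool), s.1 = v ∧ (∀ a', dd a a' ≤ r → ¬ InH s (g⁻¹ * a')) ∧
      ∀ b', dd b b' ≤ r → InH s (g⁻¹ * b') := by
  classical
  obtain ⟨w, hw, hw'⟩ := exists_geodesic (a⁻¹ * b)
  rw [← hw'] at hw
  rw [← hw', vcount_ev hw] at h
  obtain ⟨u, s, t, rfl, hs, hu⟩ := exists_split_countP (fun s => decide (s.1 = v)) (r + 1) w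
    (by omega)
  rw [List.countP_append, hu] at h
  simp only [decide_eq_true_eq] at hs
  have hlen := hw
  rw [ev_append] at hlen
  rw [List.length_append] at hlen
  have l1 := len_mul (ev Γ u) (ev Γ (s :: t))
  have l2 := len_ev_le (Γ := Γ) u
  have l3 := len_ev_le (Γ := Γ) (s :: t)
  have l4 := len_ev_le (Γ := Γ) t
  rw [List.length_cons] at hlen l3
  have cu := vcount_ev (Γ := Γ) (w := u) (by omega) v
  have ct := vcount_ev (Γ := Γ) (w := s :: t) (by rw [List.length_cons]; omega) v
  rw [hu] at cu
  have hb0 : InH s (ev Γ (s :: t)) := by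
    rw [inH_iff, ev_cons, inv_mul_cancel_left, ← ev_cons]
    omega
  have ha0 : ¬ InH s (ev Γ u)⁻¹ := by
    rw [inH_iff, ← mul_inv_rev, len_inv, len_inv, not_lt]
    have h1 := len_ev_le (Γ := Γ) t
    have h2 := len_mul (ev Γ u * lt Γ s) (ev Γ t)
    rw [mul_assoc, ← ev_cons] at h2
    omega
  have hb : b = a * ev Γ u * ev Γ (s :: t) := by
    rw [mul_assoc, ← ev_append, hw', mul_inv_cancel_left]
  have ha1 : ¬ InH s ((a * ev Γ u)⁻¹ * a) := by simpa using ha0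
  have hb1 : InH s ((a * ev Γ u)⁻¹ * b) := by rw [hb, inv_mul_cancel_left]; exact hb0
  have hv : v ∉ lk Γ s.1 := hs ▸ not_mem_lk _
  refine ⟨a * ev Γ u, s, hs, fun a' haa hH => ?_, fun b' hbb => ?_⟩
  · obtain ⟨e, h1, h2⟩ := crossing_le ha1 hH
    have h3 : vcount v (ev Γ u) ≤ vcount v (a⁻¹ * e) := by
      have := vcount_mul_le v (a⁻¹ * e) ((a * ev Γ u)⁻¹ * e)⁻¹
      rw [vcount_of_mem_sp hv (inv_mem h1)] at this
      simpa [mul_assoc] using this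
    have h4 := vcount_le_len v (a⁻¹ * e)
    change _ ≤ dd a e at h4
    omega
  · by_contra hH
    obtain ⟨e, h1, h2⟩ := crossing_le hH hb1
    have h3 : vcount v (ev Γ (s :: t)) ≤ vcount v (e⁻¹ * b) := by
      have := vcount_mul_le v ((a * ev Γ u)⁻¹ * e) (e⁻¹ * b)
      rw [vcount_of_mem_sp hv h1, hb] at this
      rw [hb]
      simpa [mul_assoc] using this
    have h4 := vcount_le_len v (e⁻¹ * b)
    change _ ≤ dd e b at h4
    rw [dd_comm b b'] at hbb
    omega

theorem exists_vcount_lt [Fintype V] {B : ℕ} {g : RAAG Γ} (h : Fintype.card V * B < len g) :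
    ∃ v, B < vcount v g := by
  classical
  obtain ⟨w, hw, rfl⟩ := exists_good_word g
  by_contra! hc
  have h1 : w.length = ∑ v : V, w.countP fun s => s.1 = v := by
    clear hw h hc
    induction w with
    | nil => simp
    | cons x w ih =>
      simp only [List.countP_cons, Finset.sum_add_distrib, List.length_cons, ih]
      simp
  have h2 : ∑ v : V, w.countP (fun s => s.1 = v) ≤ ∑ _v : V, B := by
    refine Finset.sum_le_sum fun v _ => ?_
    rw [← hw.vcount_eq]
    exact hc v
  rw [Finset.sum_const, Finset.card_univ, smul_eq_mul] at h2
  rw [← hw.length_eq_len] at h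
  omega

theorem len_ret_pair_le (u v : V) (g : RAAG Γ) :
    len (ret Γ {u, v} g) ≤ vcount u g + vcount v g := by
  classical
  obtain ⟨w, hw, rfl⟩ := exists_good_word g
  rw [ret_ev, hw.vcount_eq, hw.vcount_eq]
  refine (len_ev_le _).trans ?_
  clear hw
  induction w with
  | nil => simp
  | cons x w ih =>
    simp only [List.filter_cons, List.countP_cons, Set.mem_insert_iff, Set.mem_singleton_iff]
      at ih ⊢
    by_cases h1 : x.1 = u <;> by_cases h2 : x.1 = v <;> simp [h1, h2] at ih ⊢ <;> omega

theorem finite_letters_ball [Fintype V] (r : ℕ) :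
    ∃ S : Finset (RAAG Γ), S.card ≤ (2 * Fintype.card V + 1) ^ r ∧ ∀ g, len g ≤ r → g ∈ S := by
  classical
  let T : Finset (RAAG Γ) := insert 1 (Finset.univ.image (lt Γ))
  have hT : T.card ≤ 2 * Fintype.card V + 1 := by
    refine (Finset.card_insert_le _ _).trans ?_
    have := Finset.card_image_le (s := (Finset.univ : Finset (V × Bool))) (f := lt Γ)
    rw [Finset.card_univ, Fintype.card_prod, Fintype.card_bool] at this
    omega
  have h1T : (1 : RAAG Γ) ∈ T := Finset.mem_insert_self _ _
  refine ⟨(List.replicate r T).foldr (fun a b => Finset.image₂ (· * ·) a b) {1}, ?_, ?_⟩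
  · induction r with
    | zero => simp
    | succ r ih =>
      rw [List.replicate_succ, List.foldr_cons, pow_succ']
      exact (Finset.card_image₂_le _ _ _).trans (Nat.mul_le_mul hT ih)
  · intro g hg
    obtain ⟨w, hw, rfl⟩ := exists_geodesic g
    rw [← hw] at hg
    clear hw
    induction r generalizing w with
    | zero =>
      have : w = [] := List.length_eq_zero_iff.1 (by omega)
      subst this
      simp
    | succ r ih =>
      rw [List.replicate_succ, List.foldr_cons]
      cases w with
      | nil =>
        exact Finset.mem_image₂.2 ⟨1, h1T, 1, ih [] (by simp), by simp⟩
      | cons x w =>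
        refine Finset.mem_image₂.2 ⟨lt Γ x, ?_, ev Γ w, ih w (by simpa using hg), by simp⟩
        exact Finset.mem_insert_of_mem (Finset.mem_image_of_mem _ (Finset.mem_univ _))

end Walls

section Stars

variable {V : Type*} {Γ : SimpleGraph V}

theorem InH.not_flip {s : V × Bool} {g : RAAG Γ} (h : InH s g) : ¬ InH (flip s) g := by
  intro h'
  rcases h.adj_or_eq h' with h1 | h1
  · have := congrArg Prod.snd h1
    simp at this
  · exact h1.ne rfl

theorem InH.not_of_nonadj {s t : V × Bool} {g : RAAG Γ} (h : InH s g) (hne : s.1 ≠ t.1)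
    (ha : ¬ Γ.Adj s.1 t.1) : ¬ InH t g := by
  intro h'
  rcases h.adj_or_eq h' with h1 | h1
  · exact hne (congrArg Prod.fst h1)
  · exact ha h1

theorem inH_pow_mul {s : V × Bool} {t : RAAG Γ} (h : ¬ InH (flip s) t) {a : ℕ} (ha : 1 ≤ a) :
    InH s (lt Γ s ^ a * t) := by
  induction a, ha using Nat.le_induction with
  | base => rw [pow_one]; exact (inH_lt_mul s t).2 h
  | succ a _ ih =>
    rw [pow_succ', mul_assoc, inH_lt_mul]
    exact ih.not_flip

theorem inH_zpow_mul_iff {s : V × Bool} {v : V} (h : Γ.Adj s.1 v) (k : ℤ) (g : RAAG Γ) :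
    InH s ((PresentedGroup.of v) ^ k * g) ↔ InH s g :=
  inH_sp_mul (zpow_mem_sp h k) g

/-- A path with bounded steps moves at bounded speed. -/
theorem dd_path_le {z : ℕ → RAAG Γ} {J L : ℕ} (h : ∀ k < L, dd (z k) (z (k + 1)) ≤ J)
    {a : ℕ} : ∀ b, a ≤ b → b ≤ L → dd (z a) (z b) ≤ J * (b - a) := by
  intro b hab
  induction b, hab using Nat.le_induction with
  | base => intro; simp [dd_self]
  | succ b hb ih =>
    intro hL
    have h1 := dd_triangle (z a) (z b) (z (b + 1))
    have h2 := ih (by omega)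
    have h3 := h b (by omega)
    have h4 : b + 1 - a = (b - a) + 1 := by omega
    rw [h4, mul_add]
    omega

theorem dd_ret_le (L : Set V) (p a b : RAAG Γ) :
    dd (ret Γ L (p⁻¹ * a)) (ret Γ L (p⁻¹ * b)) ≤ dd a b := by
  have := len_ret_le L ((p⁻¹ * a)⁻¹ * (p⁻¹ * b))
  rw [map_mul, map_inv] at this
  refine this.trans (le_of_eq ?_)
  rw [dd]
  congr 1
  group

/-- A coset of a star subgroup, recorded by a representative and a vertex. -/
def OnStar (P : RAAG Γ × V) (e : RAAG Γ) : Prop := P.1⁻¹ * e ∈ sp Γ (st Γ P.2)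

/-- Being at distance at most `c` from a star coset. -/
def Near (c : ℕ) (P : RAAG Γ × V) (a : RAAG Γ) : Prop := ∃ e, OnStar P e ∧ dd a e ≤ c

/-- Two pairs represent the same star coset. -/
def SameStar (P Q : RAAG Γ × V) : Prop := P.2 = Q.2 ∧ P.1⁻¹ * Q.1 ∈ sp Γ (st Γ P.2)

theorem SameStar.refl (P : RAAG Γ × V) : SameStar P P :=
  ⟨rfl, by rw [inv_mul_cancel]; exact one_mem _⟩

theorem SameStar.symm {P Q : RAAG Γ × V} (h : SameStar P Q) : SameStar Q P := by
  refine ⟨h.1.symm, ?_⟩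
  rw [← h.1]
  simpa using inv_mem h.2

theorem SameStar.trans {P Q R : RAAG Γ × V} (h : SameStar P Q) (h' : SameStar Q R) :
    SameStar P R := by
  refine ⟨h.1.trans h'.1, ?_⟩
  have h2 := h'.2
  rw [← h.1] at h2
  have := mul_mem h.2 h2
  simpa [mul_assoc] using this

theorem SameStar.onStar {P Q : RAAG Γ × V} (h : SameStar P Q) {e : RAAG Γ} (he : OnStar P e) :
    OnStar Q e := by
  have h2 := h.symm.2
  rw [← h.1] at h2
  have := mul_mem h2 he
  rw [OnStar, ← h.1]
  simpa [mul_assoc] using this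

theorem SameStar.near {P Q : RAAG Γ × V} (h : SameStar P Q) {c : ℕ} {e : RAAG Γ}
    (he : Near c P e) : Near c Q e := by
  obtain ⟨e', h1, h2⟩ := he
  exact ⟨e', h.onStar h1, h2⟩

theorem Near.mono {P : RAAG Γ × V} {c c' : ℕ} {e : RAAG Γ} (he : Near c P e) (h : c ≤ c') :
    Near c' P e := by
  obtain ⟨e', h1, h2⟩ := he
  exact ⟨e', h1, h2.trans h⟩

theorem Near.of_dd {P : RAAG Γ × V} {c d : ℕ} {a b : RAAG Γ} (he : Near c P a)
    (h : dd b a ≤ d) : Near (d + c) P b := by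
  obtain ⟨e', h1, h2⟩ := he
  have := dd_triangle b a e'
  exact ⟨e', h1, by omega⟩

/-- A vertex whose link consists of two vertices without further interaction. -/
structure Corner (Γ : SimpleGraph V) (y u w : V) : Prop where
  lk_eq : lk Γ y = {u, w}
  ne : u ≠ w
  nadj : ¬ Γ.Adj u w
  inter : lk Γ u ∩ lk Γ w = {y}

namespace Corner

variable {y u w : V}

theorem adj (hc : Corner Γ y u w) {a : V} (ha : a = u ∨ a = w) : Γ.Adj a y := by
  have : a ∈ lk Γ y := by rw [hc.lk_eq]; exact ha
  exact this.symm

theorem nadj' (hc : Corner Γ y u w) {a b : V} (ha : a = u ∨ a = w) (hb : b = u ∨ b = w) : ¬ Γ.Adj a b := by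
  rcases ha with rfl | rfl <;> rcases hb with rfl | rfl
  · exact fun h => h.ne rfl
  · exact hc.nadj
  · exact fun h => hc.nadj h.symm
  · exact fun h => h.ne rfl

theorem inter' (hc : Corner Γ y u w) {a b : V} (ha : a = u ∨ a = w) (hb : b = u ∨ b = w) (h : a ≠ b) :
    lk Γ a ∩ lk Γ b = {y} := by
  rcases ha with rfl | rfl <;> rcases hb with rfl | rfl
  · exact (h rfl).elim
  · exact hc.inter
  · rw [Set.inter_comm]; exact hc.inter
  · exact (h rfl).elim

theorem eq_of_mem_st (hc : Corner Γ y u w) {a b v : V} (ha : a = u ∨ a = w) (hb : b = u ∨ b = w) (h : a ≠ b)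
    (h1 : a ∈ st Γ v) (h2 : b ∈ st Γ v) : v = y := by
  have hn := hc.nadj' ha hb
  rcases h1 with rfl | h1
  · rcases h2 with rfl | h2
    · exact (h rfl).elim
    · exact (hn h2).elim
  · rcases h2 with rfl | h2
    · exact (hn h1.symm).elim
    · have : v ∈ lk Γ a ∩ lk Γ b := ⟨h1.symm, h2.symm⟩
      rw [hc.inter' ha hb h] at this
      exact this

end Corner

theorem onStar_self (P : RAAG Γ × V) : OnStar P P.1 := by
  rw [OnStar, inv_mul_cancel]
  exact one_mem _

theorem exists_closest (P Q : RAAG Γ × V) : ∃ m g', OnStar P m ∧ OnStar Q g' ∧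
    ∀ m₁ e₁, OnStar P m₁ → OnStar Q e₁ → dd m g' ≤ dd m₁ e₁ := by
  classical
  have hex : ∃ d, ∃ m e, OnStar P m ∧ OnStar Q e ∧ dd m e = d :=
    ⟨_, P.1, Q.1, onStar_self P, onStar_self Q, rfl⟩
  obtain ⟨m, g', hm, hg', hd⟩ := Nat.find_spec hex
  refine ⟨m, g', hm, hg', fun m₁ e₁ h1 h2 => ?_⟩
  rw [hd]
  exact Nat.find_min' hex ⟨m₁, e₁, h1, h2, rfl⟩

/-- Distinct stars have a gate through which the second one is seen. -/
theorem exists_gate {y u w : V} (hc : Corner Γ y u w) {g : RAAG Γ} {P : RAAG Γ × V}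
    (hne : ¬ SameStar (g, y) P) : ∃ m, OnStar (g, y) m ∧
      ∀ s t : V × Bool, (s.1 = u ∨ s.1 = w) → (t.1 = u ∨ t.1 = w) → s.1 ≠ t.1 →
        ∀ a : ℕ, 1 ≤ a → ∀ e, OnStar P e → ¬ InH t ((m * lt Γ s ^ a)⁻¹ * e) := by
  obtain ⟨p, y'⟩ := P
  obtain ⟨m, g', hm, hg', hmin⟩ := exists_closest (g, y) (p, y')
  obtain ⟨d, hdd⟩ : ∃ d, d = m⁻¹ * g' := ⟨_, rfl⟩
  have hd1 : ∀ s : V × Bool, s.1 ∈ st Γ y → ¬ InH s d := by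
    intro s hs h
    rw [inH_iff] at h
    have := hmin (m * lt Γ s) g' (by
      rw [OnStar, ← mul_assoc]; exact mul_mem hm (lt_mem_sp hs)) hg'
    rw [dd, dd, mul_inv_rev, mul_assoc, ← hdd] at this
    omega
  have hd2 : ∀ s : V × Bool, s.1 ∈ st Γ y' → ¬ InH s d⁻¹ := by
    intro s hs h
    rw [inH_iff, ← mul_inv_rev, len_inv, len_inv] at h
    have := hmin m (g' * lt Γ s) hm (by
      rw [OnStar, ← mul_assoc]; exact mul_mem hg' (lt_mem_sp hs))
    rw [dd, dd, ← mul_assoc, ← hdd] at this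
    omega
  refine ⟨m, hm, fun s t hs ht hst a ha e he hH => hne ?_⟩
  obtain ⟨a', ha'⟩ : ∃ a', a' = g'⁻¹ * e := ⟨_, rfl⟩
  have ha'm : a' ∈ sp Γ (st Γ y') := by
    have := mul_mem (inv_mem hg') he
    have h0 : a' = (p⁻¹ * g')⁻¹ * (p⁻¹ * e) := by rw [ha']; group
    rw [h0]
    exact this
  have key : ∀ (r : V × Bool) (b : RAAG Γ), (r.1 = u ∨ r.1 = w) → b ∈ sp Γ (st Γ y') →
      InH r (d * b) → d ∈ sp Γ (lk Γ r.1) ∧ InH r b ∧ r.1 ∈ st Γ y' := by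
    intro r b hr hb h
    have h1 := inH_of_reduced_mul (len_mul_sp hb hd2) h
      (hd1 r (Or.inr (hc.adj hr).symm))
    refine ⟨h1.1, h1.2, ?_⟩
    by_contra h2
    exact not_inH_of_mem_sp hb h2 h1.2
  have hde : d * a' = m⁻¹ * e := by rw [hdd, ha']; group
  have hH1 : InH s (d * a') := by
    have h1 : ¬ InH (flip s) ((m * lt Γ s ^ a)⁻¹ * e) :=
      hH.not_of_nonadj (by simpa using hst.symm) (by simpa using hc.nadj' ht hs)
    have h2 := inH_pow_mul h1 ha
    rw [hde]
    rwa [mul_inv_rev, mul_assoc, mul_inv_cancel_left] at h2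
  obtain ⟨k1, k2, k3⟩ := key s a' hs ha'm hH1
  have hcom : Commute (lt Γ s ^ a) d := (sp_lk_commute k1).pow_left a
  have hH2 : InH t (d * ((lt Γ s ^ a)⁻¹ * a')) := by
    rw [← mul_assoc, ← hcom.inv_left.eq, mul_assoc, hde, ← mul_assoc,
      ← mul_inv_rev]
    exact hH
  obtain ⟨k4, k5, k6⟩ := key t _ ht (mul_mem (inv_mem (pow_mem (lt_mem_sp k3) a)) ha'm) hH2
  have hyy : y' = y := hc.eq_of_mem_st hs ht hst k3 k6
  subst hyy
  have hdy : d ∈ sp Γ {y'} := by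
    rw [← hc.inter' hs ht hst]
    exact sp_inter k1 k4
  have hd3 : d ∈ sp Γ (st Γ y') :=
    sp_mono (L := {y'}) (M := st Γ y')
      (by intro z hz; rw [Set.mem_singleton_iff] at hz; rw [hz]; exact Set.mem_insert _ _) hdy
  have hm' : g⁻¹ * m ∈ sp Γ (st Γ y') := hm
  have hg'' : p⁻¹ * g' ∈ sp Γ (st Γ y') := hg'
  have h2 : g⁻¹ * p = g⁻¹ * m * d * (p⁻¹ * g')⁻¹ := by rw [hdd]; group
  have h3 : g⁻¹ * p ∈ sp Γ (st Γ y') := by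
    rw [h2]
    exact mul_mem (mul_mem hm' hd3) (inv_mem hg'')
  exact ⟨rfl, h3⟩

/-- Products of `q` powers of generators with exponents at most `B`. -/
def PowProd (B : ℕ) : ℕ → RAAG Γ → Prop
  | 0, x => x = 1
  | q + 1, x => ∃ (v : V) (e : ℤ) (x' : RAAG Γ), |e| ≤ B ∧ PowProd B q x' ∧
      x = (PresentedGroup.of v) ^ e * x'

theorem PowProd.one [Nonempty V] (B q : ℕ) : PowProd B q (1 : RAAG Γ) := by
  induction q with
  | zero => rfl
  | succ q ih => exact ⟨Classical.arbitrary V, 0, 1, by simp, ih, by simp⟩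

theorem PowProd.mono [Nonempty V] {B B' : ℕ} (hB : B ≤ B') {q q' : ℕ} (hq : q ≤ q') {x : RAAG Γ}
    (h : PowProd B q x) : PowProd B' q' x := by
  induction q generalizing x q' with
  | zero =>
    rw [PowProd] at h
    rw [h]
    exact PowProd.one _ _
  | succ q ih =>
    obtain ⟨v, e, x', h1, h2, rfl⟩ := h
    obtain ⟨q', rfl⟩ := Nat.exists_eq_succ_of_ne_zero (by omega : q' ≠ 0)
    exact ⟨v, e, x', h1.trans (by exact_mod_cast hB), ih (by omega) h2, rfl⟩

theorem PowProd.mul {B q q' : ℕ} {x x' : RAAG Γ} (h : PowProd B q x) (h' : PowProd B q' x') :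
    PowProd B (q + q') (x * x') := by
  induction q generalizing x with
  | zero =>
    rw [PowProd] at h
    simpa [h] using h'
  | succ q ih =>
    obtain ⟨v, e, x₁, h1, h2, rfl⟩ := h
    rw [Nat.succ_add]
    exact ⟨v, e, x₁ * x', h1, ih h2, by rw [mul_assoc]⟩

theorem PowProd.zpow {B : ℕ} {e : ℤ} (v : V) (h : |e| ≤ B) :
    PowProd B 1 ((PresentedGroup.of v : RAAG Γ) ^ e) := ⟨v, e, 1, h, rfl, by simp⟩

/-- One step of the syllable decomposition. -/
theorem exists_syllable {u w : V} {g : RAAG Γ} (hg : g ∈ sp Γ {u, w}) :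
    ∃ (s : V × Bool) (a : ℕ) (r : RAAG Γ), g = lt Γ s ^ a * r ∧ len g = a + len r ∧
      r ∈ sp Γ {u, w} ∧ (s.1 = u ∨ s.1 = w) ∧ (g ≠ 1 → 1 ≤ a ∧ InH s g) ∧
      ¬ InH s r ∧ ¬ InH (flip s) r := by
  by_cases h1 : g = 1
  · subst h1
    exact ⟨(u, true), 0, 1, by simp, by simp, one_mem _, Or.inl rfl, fun h => (h rfl).elim,
      one_not_inH _, one_not_inH _⟩
  · obtain ⟨s, k, hk, hl, hs⟩ := exists_first h1
    have hsL : s.1 ∈ ({u, w} : Set V) := by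
      by_contra hc
      exact not_inH_of_mem_sp hg hc hs
    obtain ⟨a, ⟨r, hr, hlr⟩, hmax⟩ : ∃ a : ℕ, (∃ r, g = lt Γ s ^ a * r ∧ len g = a + len r) ∧
        ∀ b : ℕ, (∃ r, g = lt Γ s ^ b * r ∧ len g = b + len r) → b ≤ a := by
      have hfin : {a : ℕ | ∃ r, g = lt Γ s ^ a * r ∧ len g = a + len r}.Finite :=
        (Set.finite_Iic (len g)).subset (by rintro a ⟨r, -, h⟩; simp only [Set.mem_Iic]; omega)
      obtain ⟨a, ha, hm⟩ := hfin.exists_maximalFor id _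
        ⟨1, k, by rwa [pow_one], by rw [add_comm]; exact hl⟩
      exact ⟨a, ha, fun b hb => (le_total b a).elim id fun h => hm hb h⟩
    have ha1 : 1 ≤ a := hmax 1 ⟨k, by rwa [pow_one], by rw [add_comm]; exact hl⟩
    have hrL : r ∈ sp Γ {u, w} := by
      have := mul_mem (inv_mem (pow_mem (lt_mem_sp hsL) a)) hg
      rwa [hr, inv_mul_cancel_left] at this
    refine ⟨s, a, r, hr, hlr, hrL, hsL, fun _ => ⟨ha1, hs⟩, fun h => ?_, fun h => ?_⟩
    · have h2 := len_inv_lt_mul h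
      have := hmax (a + 1) ⟨(lt Γ s)⁻¹ * r, by
        rw [pow_succ, mul_assoc, mul_inv_cancel_left]; exact hr, by omega⟩
      omega
    · have h2 := len_inv_lt_mul h
      rw [lt_flip, inv_inv] at h2
      have h3 := len_mul (lt Γ s ^ (a - 1)) (lt Γ s * r)
      rw [← mul_assoc, ← pow_succ, Nat.sub_add_cancel ha1, ← hr] at h3
      have h4 := len_zpow_le (lt Γ s) ((a - 1 : ℕ) : ℤ)
      rw [zpow_natCast, len_lt] at h4
      simp only [Int.natAbs_natCast, mul_one] at h4
      omega

end Stars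

section Path

variable {V : Type*} {Γ : SimpleGraph V}

theorem exists_syllables {u w : V} {g : RAAG Γ} (hg : g ∈ sp Γ {u, w}) :
    ∃ (r : ℕ → RAAG Γ) (s : ℕ → V × Bool) (a : ℕ → ℕ), r 0 = g ∧ ∀ i,
      r i = lt Γ (s i) ^ a i * r (i + 1) ∧ len (r i) = a i + len (r (i + 1)) ∧
      r i ∈ sp Γ {u, w} ∧ ((s i).1 = u ∨ (s i).1 = w) ∧
      (r i ≠ 1 → 1 ≤ a i ∧ InH (s i) (r i)) ∧ ¬ InH (s i) (r (i + 1)) ∧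
      ¬ InH (flip (s i)) (r (i + 1)) := by
  have h := fun g : {g : RAAG Γ // g ∈ sp Γ {u, w}} => exists_syllable g.2
  choose s a r h1 h2 h3 h4 h5 h6 h7 using h
  let f : ℕ → {g : RAAG Γ // g ∈ sp Γ {u, w}} := fun i => (fun g => ⟨r g, h3 g⟩)^[i] ⟨g, hg⟩
  have hf : ∀ i, (f (i + 1)).1 = r (f i) := fun i => by
    simp only [f, Function.iterate_succ_apply']
  refine ⟨fun i => (f i).1, fun i => s (f i), fun i => a (f i), rfl, fun i => ?_⟩
  simp only [hf]
  exact ⟨h1 _, h2 _, (f i).2, h4 _, h5 _, h6 _, h7 _⟩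

theorem exists_first_exit {p : ℕ → Prop} {n : ℕ} (h0 : p 0) (hn : ¬ p n) :
    ∃ t, 1 ≤ t ∧ t ≤ n ∧ ¬ p t ∧ ∀ k < t, p k := by
  classical
  have hex : ∃ k, ¬ p k := ⟨n, hn⟩
  refine ⟨Nat.find hex, ?_, Nat.find_min' hex hn, Nat.find_spec hex, fun k hk => ?_⟩
  · by_contra hc
    have h1 : Nat.find hex = 0 := by omega
    have := Nat.find_spec hex
    rw [h1] at this
    exact this h0
  · by_contra hc
    exact Nat.find_min hex hk hc

theorem exists_small_gap {t : ℕ → ℕ} {q L : ℕ} (hq : 1 ≤ q) (h : t 0 ≤ L) :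
    ∃ i < q, t i ≤ t (i + 1) + L / q := by
  by_contra! hc
  have key : ∀ j ≤ q, t j + j * (L / q + 1) ≤ t 0 := by
    intro j
    induction j with
    | zero => simp
    | succ j ih =>
      intro hj
      have h1 := ih (by omega)
      have h2 := hc j (by omega)
      rw [Nat.succ_mul]
      omega
  have h1 := key q le_rfl
  have h2 : L < q * (L / q + 1) := by
    have := Nat.lt_mul_div_succ L hq
    simpa using this
  omega

theorem lt_pow_eq_zpow (s : V × Bool) (a : ℕ) :
    ∃ e : ℤ, |e| = a ∧ lt Γ s ^ a = (PresentedGroup.of s.1 : RAAG Γ) ^ e := by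
  obtain ⟨v, b⟩ := s
  cases b
  · exact ⟨-a, by simp, by simp [lt_false]⟩
  · exact ⟨a, by simp, by simp [lt_true]⟩

theorem exists_exit_point {s : V × Bool} {σ : RAAG Γ} {z : ℕ → RAAG Γ} {J t : ℕ}
    (hJ : dd (z (t - 1)) (z t) ≤ J) (h1 : InH s (σ⁻¹ * z (t - 1))) (h2 : ¬ InH s (σ⁻¹ * z t)) :
    ∃ e, σ⁻¹ * e ∈ sp Γ (lk Γ s.1) ∧ dd (z t) e ≤ J := by
  obtain ⟨e, he, h⟩ := crossing_le h2 h1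
  refine ⟨e, he, ?_⟩
  rw [dd_comm (z t) (z (t - 1))] at h
  omega

theorem path_near {y u w : V} (hc : Corner Γ y u w) {m : RAAG Γ} {z : ℕ → RAAG Γ} {J L q : ℕ}
    (hz : ∀ k < L, dd (z k) (z (k + 1)) ≤ J) (h0 : m⁻¹ * z 0 ∈ sp Γ (st Γ y))
    (hL : ∀ s t : V × Bool, (s.1 = u ∨ s.1 = w) → (t.1 = u ∨ t.1 = w) → s.1 ≠ t.1 →
        ∀ a : ℕ, 1 ≤ a → ¬ InH t ((m * lt Γ s ^ a)⁻¹ * z L)) (hq : 1 ≤ q) :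
    ∃ k ≤ L, ∃ v, (v = u ∨ v = w) ∧ ∃ (e j : ℤ) (x : RAAG Γ), PowProd (J * L) q x ∧
      x ∈ sp Γ {u, w} ∧ len x ≤ J * L ∧
      dd (z k) (m * (PresentedGroup.of v) ^ e * x * (PresentedGroup.of y) ^ j)
        ≤ J * (L / q) + 3 * J := by
  have : Nonempty V := ⟨y⟩
  obtain ⟨g, hgdef⟩ : ∃ g, g = ret Γ {u, w} (m⁻¹ * z 0) := ⟨_, rfl⟩
  obtain ⟨j₀, hj₀⟩ : ∃ j₀, j₀ = ab y (m⁻¹ * z 0) := ⟨_, rfl⟩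
  have hg0 : m⁻¹ * z 0 = g * (PresentedGroup.of y) ^ j₀ := by
    rw [hgdef, hj₀, ← hc.lk_eq]
    exact eq_ret_mul_zpow h0
  have hg : g ∈ sp Γ {u, w} := by rw [hgdef]; exact ret_mem_sp _ _
  obtain ⟨r, s, a, hr0, H⟩ := exists_syllables hg
  have hstep := fun i => (H i).1
  have hlen := fun i => (H i).2.1
  have hsp := fun i => (H i).2.2.1
  have hs := fun i => (H i).2.2.2.1
  have hpos := fun i => (H i).2.2.2.2.1
  have hns := fun i => (H i).2.2.2.2.2.1
  have hnf := fun i => (H i).2.2.2.2.2.2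
  have hmono : ∀ i j, i ≤ j → len (r j) ≤ len (r i) := by
    intro i j hij
    induction j, hij using Nat.le_induction with
    | base => exact le_rfl
    | succ j _ ih => have := hlen j; omega
  have hone : ∀ i j, i ≤ j → r j ≠ 1 → r i ≠ 1 := by
    intro i j hij hj hi
    have := hmono i j hij
    rw [hi, len_one] at this
    exact hj (len_eq_zero.1 (by omega))
  have hycom : ∀ x ∈ sp Γ {u, w}, ∀ k : ℤ,
      x * (PresentedGroup.of y) ^ k = (PresentedGroup.of y) ^ k * x := by
    intro x hx k
    have h1 : Commute (lt Γ (y, true)) x := sp_lk_commute (by rw [hc.lk_eq]; exact hx)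
    exact (h1.zpow_left k).eq.symm
  have hσ : ∀ i, ∀ b, (m * g * (r i)⁻¹)⁻¹ * b = r i * (g⁻¹ * (m⁻¹ * b)) := by
    intro i b; group
  have hσ' : ∀ i, m * g * (r (i + 1))⁻¹ = m * g * (r i)⁻¹ * lt Γ (s i) ^ a i := by
    intro i
    rw [hstep i]; group
  have hz0 : ∀ i, (m * g * (r i)⁻¹)⁻¹ * z 0 = (PresentedGroup.of y) ^ j₀ * r i := by
    intro i
    rw [hσ, hg0, inv_mul_cancel_left, hycom _ (hsp i)]
  have hsy : ∀ i, Γ.Adj (s i).1 y := fun i => hc.adj (hs i)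
  have hz0B : ∀ i, r i ≠ 1 → InH (s i) ((m * g * (r i)⁻¹)⁻¹ * z 0) := by
    intro i hi
    rw [hz0, inH_zpow_mul_iff (hsy i)]
    exact (hpos i hi).2
  have hne : ∀ i, r (i + 1) ≠ 1 → (s (i + 1)).1 ≠ (s i).1 := by
    intro i hi he
    have h1 := (hpos (i + 1) hi).2
    by_cases hb : (s (i + 1)).2 = (s i).2
    · rw [Prod.ext he hb] at h1
      exact hns i h1
    · have h2 : s (i + 1) = flip (s i) := by
        refine Prod.ext (by simpa using he) ?_
        simp only [flip_snd]
        revert hb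
        cases (s (i + 1)).2 <;> cases (s i).2 <;> simp
      rw [h2] at h1
      exact hnf i h1
  have hBC : ∀ i, r (i + 1) ≠ 1 → ∀ b, InH (s (i + 1)) ((m * g * (r (i + 1))⁻¹)⁻¹ * b) →
      ¬ InH (flip (s i)) ((m * g * (r (i + 1))⁻¹)⁻¹ * b) := by
    intro i hi b hb
    exact hb.not_of_nonadj (by simpa using hne i hi) (by simpa using hc.nadj' (hs (i + 1)) (hs i))
  have hCB : ∀ i, r (i + 1) ≠ 1 → ∀ b, ¬ InH (flip (s i)) ((m * g * (r (i + 1))⁻¹)⁻¹ * b) →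
      InH (s i) ((m * g * (r i)⁻¹)⁻¹ * b) := by
    intro i hi b hb
    have h1 := inH_pow_mul hb (hpos i (hone i (i + 1) (by omega) hi)).1
    rw [hσ' i, mul_inv_rev (m * g * (r i)⁻¹), mul_assoc (lt Γ (s i) ^ a i)⁻¹,
      mul_inv_cancel_left] at h1
    exact h1
  have hσ1 : m * g * (r 1)⁻¹ = m * lt Γ (s 0) ^ a 0 := by
    rw [hσ' 0, hr0]; group
  have hzL : r 1 ≠ 1 → ¬ InH (s 1) ((m * g * (r 1)⁻¹)⁻¹ * z L) := by
    intro h1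
    rw [hσ1]
    exact hL _ _ (hs 0) (hs 1) (hne 0 h1).symm _ (hpos 0 (hone 0 1 (by omega) h1)).1
  have hret : ∀ i, ret Γ {u, w} ((PresentedGroup.of y) ^ j₀ * r i) = r i := by
    intro i
    have h1 : ret Γ {u, w} (lt Γ (y, true)) = 1 := by
      apply ret_lt_not_mem
      rintro (h | h)
      · exact (hc.adj (Or.inl h)).ne rfl
      · exact (hc.adj (Or.inr h)).ne rfl
    rw [lt_true] at h1
    rw [map_mul, map_zpow, h1, one_zpow, one_mul]
    exact mem_sp.1 (hsp i)
  have hr1 : len (r 1) ≤ J * L := by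
    by_cases h1 : r 1 = 1
    · rw [h1, len_one]; exact Nat.zero_le _
    obtain ⟨e, he, hd⟩ := crossing_le (hzL h1) (hz0B 1 h1)
    have h2 : ret Γ {u, w} ((m * g * (r 1)⁻¹)⁻¹ * e) = 1 := by
      have h3 := ret_mem_sp_inter he {u, w}
      have h4 : ({u, w} : Set V) ∩ lk Γ (s 1).1 = ∅ := by
        ext b
        simp only [Set.mem_inter_iff, Set.mem_insert_iff, Set.mem_singleton_iff,
          Set.mem_empty_iff_false, iff_false, not_and]
        exact fun hb h5 => hc.nadj' (hs 1) hb h5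
      rw [h4] at h3
      exact sp_empty h3
    have h3 := dd_ret_le {u, w} (m * g * (r 1)⁻¹) e (z 0)
    rw [h2, hz0, hret, dd_one_left] at h3
    have h4 := dd_path_le hz (a := 0) L (by omega) le_rfl
    rw [dd_comm, Nat.sub_zero] at h4
    omega
  obtain ⟨e₀, -, he₀⟩ := lt_pow_eq_zpow (Γ := Γ) (s 0) (a 0)
  have hpp : ∀ d, PowProd (J * L) d (r 1 * (r (1 + d))⁻¹) := by
    intro d
    induction d with
    | zero => simp [PowProd]
    | succ d ih =>
      obtain ⟨e, he, he'⟩ := lt_pow_eq_zpow (Γ := Γ) (s (1 + d)) (a (1 + d))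
      have h1 : PowProd (J * L) 1 (lt Γ (s (1 + d)) ^ a (1 + d)) := by
        rw [he']
        refine PowProd.zpow _ ?_
        rw [he]
        have h2 := hlen (1 + d)
        have h3 := hmono 1 (1 + d) (by omega)
        exact_mod_cast (by omega : a (1 + d) ≤ J * L)
      have h2 := ih.mul h1
      have h3 := hstep (1 + d)
      convert h2 using 1
      rw [← add_assoc, h3]; group
  have hxlen : ∀ d, len (r 1 * (r (1 + d))⁻¹) + len (r (1 + d)) ≤ len (r 1) := by
    intro d
    induction d with
    | zero => simp
    | succ d ih =>
      have h1 := hlen (1 + d)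
      have h2 := hstep (1 + d)
      have h3 : r 1 * (r (1 + (d + 1)))⁻¹ = r 1 * (r (1 + d))⁻¹ * lt Γ (s (1 + d)) ^ a (1 + d) := by
        rw [← add_assoc, h2]; group
      have h4 := len_mul (r 1 * (r (1 + d))⁻¹) (lt Γ (s (1 + d)) ^ a (1 + d))
      have h5 := len_zpow_le (lt Γ (s (1 + d))) (a (1 + d) : ℤ)
      rw [zpow_natCast, len_lt] at h5
      simp only [Int.natAbs_natCast, mul_one] at h5
      rw [h3, ← add_assoc]
      omega
  have hσx : ∀ d, m * g * (r (1 + d))⁻¹ =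
      m * (PresentedGroup.of (s 0).1) ^ e₀ * (r 1 * (r (1 + d))⁻¹) := by
    intro d
    rw [← he₀, ← hσ1]; group
  by_cases hq1 : r (1 + q) = 1
  · refine ⟨0, Nat.zero_le _, (s 0).1, hs 0, e₀, j₀, r 1 * (r (1 + q))⁻¹, hpp q,
      mul_mem (hsp _) (inv_mem (hsp _)), by have := hxlen q; omega, ?_⟩
    rw [← hσx, hq1, inv_one, mul_one, mul_assoc, ← hg0, mul_inv_cancel_left, dd_self]
    exact Nat.zero_le _
  · have hn1 : ∀ i ≤ q, r (1 + i) ≠ 1 := fun i hi => hone _ (1 + q) (by omega) hq1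
    have hBB : ∀ i ≤ q, ¬ InH (s (1 + i)) ((m * g * (r (1 + i))⁻¹)⁻¹ * z L) := by
      intro i
      induction i with
      | zero => intro hi; exact hzL (hn1 0 hi)
      | succ i ih =>
        intro hi h1
        have h2 := hn1 (i + 1) hi
        exact ih (by omega) (hCB (1 + i) h2 _ (hBC (1 + i) h2 _ h1))
    have hex : ∀ i, ∃ t, i ≤ q → 1 ≤ t ∧ t ≤ L ∧
        ¬ InH (s (1 + i)) ((m * g * (r (1 + i))⁻¹)⁻¹ * z t) ∧
        ∀ k < t, InH (s (1 + i)) ((m * g * (r (1 + i))⁻¹)⁻¹ * z k) := by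
      intro i
      by_cases hi : i ≤ q
      · obtain ⟨t, ht⟩ := exists_first_exit
          (p := fun k => InH (s (1 + i)) ((m * g * (r (1 + i))⁻¹)⁻¹ * z k))
          (hz0B _ (hn1 i hi)) (hBB i hi)
        exact ⟨t, fun _ => ht⟩
      · exact ⟨0, fun h => (hi h).elim⟩
    choose t ht using hex
    obtain ⟨i, hi, hgap⟩ := exists_small_gap hq (ht 0 (by omega)).2.1
    obtain ⟨hi1, hi2, hi3, hi4⟩ := ht i (by omega)
    obtain ⟨hs1, hs2, hs3, hs4⟩ := ht (i + 1) (by omega)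
    rw [← add_assoc] at hs3 hs4
    have hnn := hn1 (i + 1) (by omega)
    rw [← add_assoc] at hnn
    obtain ⟨ea, hea, hda⟩ := exists_exit_point (J := J) (by
      have := hz (t (i + 1) - 1) (by omega)
      rwa [Nat.sub_add_cancel hs1] at this) (hs4 (t (i + 1) - 1) (by omega)) hs3
    obtain ⟨β, hβ1, hβ2, hβ3, hβ4⟩ := exists_first_exit
      (p := fun k => ¬ InH (flip (s (1 + i))) ((m * g * (r (1 + i + 1))⁻¹)⁻¹ * z k))
      (hBC (1 + i) hnn _ (hz0B _ hnn)) (fun h => hi3 (hCB (1 + i) hnn _ h))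
    have htβ : t (i + 1) ≤ β := by
      by_contra hc'
      exact hβ3 (hBC (1 + i) hnn _ (hs4 β (by omega)))
    obtain ⟨eb, heb, hdb⟩ := crossing_le (hβ4 (β - 1) (by omega)) (not_not.1 hβ3)
    have hdJ := hz (β - 1) (by omega)
    rw [Nat.sub_add_cancel hβ1] at hdJ
    have hpath := dd_path_le hz β htβ (by omega)
    have hJm : J * (β - t (i + 1)) ≤ J * (L / q) := Nat.mul_le_mul_left _ (by omega)
    have habs : dd ea eb ≤ J + J * (L / q) + J := by
      have h1 := dd_triangle ea (z (t (i + 1))) eb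
      have h2 := dd_triangle (z (t (i + 1))) (z β) eb
      rw [dd_comm ea (z _)] at h1
      rw [dd_comm (z β)] at h2
      omega
    obtain ⟨σ, hσd⟩ : ∃ σ, σ = m * g * (r (1 + i + 1))⁻¹ := ⟨_, rfl⟩
    rw [← hσd] at hea heb
    have hyb : ret Γ (lk Γ (s (1 + i + 1)).1) (σ⁻¹ * eb) ∈ sp Γ {y} := by
      have h1 := ret_mem_sp_inter heb (lk Γ (s (1 + i + 1)).1)
      rw [flip_fst] at h1
      rwa [hc.inter' (hs _) (hs _) (hne _ hnn)] at h1
    obtain ⟨j, hj⟩ : ∃ j : ℤ, ret Γ (lk Γ (s (1 + i + 1)).1) (σ⁻¹ * eb)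
        = (PresentedGroup.of y) ^ j := ⟨_, eq_zpow_of_mem_sp hyb⟩
    have hfin := dd_ret_le (lk Γ (s (1 + i + 1)).1) σ ea eb
    rw [hj, mem_sp.1 hea] at hfin
    refine ⟨t (i + 1), hs2, (s 0).1, hs 0, e₀, j, r 1 * (r (1 + (i + 1)))⁻¹,
      (hpp (i + 1)).mono le_rfl (by omega), mul_mem (hsp _) (inv_mem (hsp _)),
      by have := hxlen (i + 1); omega, ?_⟩
    rw [← hσx, ← add_assoc, ← hσd]
    have h5 : dd ea (σ * (PresentedGroup.of y) ^ j) ≤ J + J * (L / q) + J := by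
      have h6 : dd ea (σ * (PresentedGroup.of y) ^ j) =
          dd (σ⁻¹ * ea) ((PresentedGroup.of y) ^ j) := by
        rw [← dd_mul_left σ (σ⁻¹ * ea), mul_inv_cancel_left]
      omega
    have h7 := dd_triangle (z (t (i + 1))) ea (σ * (PresentedGroup.of y) ^ j)
    omega

end Path

section Count

variable {V : Type*} {Γ : SimpleGraph V} {W : Type*} {Δ : SimpleGraph W}

theorem finite_powProd [Fintype V] (B q : ℕ) : ∃ S : Finset (RAAG Γ),
    S.card ≤ (Fintype.card V * (2 * B + 1)) ^ q ∧ ∀ x : RAAG Γ, PowProd B q x → x ∈ S := by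
  classical
  induction q with
  | zero => exact ⟨{1}, by simp, fun x hx => by simpa [PowProd] using hx⟩
  | succ q ih =>
    obtain ⟨S, hS, hS'⟩ := ih
    refine ⟨((Finset.univ : Finset V) ×ˢ (Finset.Icc (-B : ℤ) B ×ˢ S)).image
      (fun t => (PresentedGroup.of t.1) ^ t.2.1 * t.2.2), ?_, ?_⟩
    · refine Finset.card_image_le.trans ?_
      rw [Finset.card_product, Finset.card_product, Finset.card_univ, Int.card_Icc, pow_succ',
        ← mul_assoc]
      have : ((B : ℤ) + 1 - -B).toNat = 2 * B + 1 := by omega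
      rw [this]
      exact Nat.mul_le_mul_left _ hS
    · rintro x ⟨v, e, x', h1, h2, rfl⟩
      refine Finset.mem_image.2 ⟨(v, e, x'), ?_, rfl⟩
      simp only [Finset.mem_product, Finset.mem_univ, true_and, Finset.mem_Icc]
      exact ⟨abs_le.1 h1, hS' _ h2⟩

/-- There are exponentially many elements in the link subgroup of a corner. -/
theorem exists_positive_words {y u w : V} (hc : Corner Γ y u w) (D : ℕ) :
    ∃ T : Finset (RAAG Γ), T.card = 2 ^ D ∧ ∀ t ∈ T, t ∈ sp Γ (lk Γ y) ∧ len t ≤ D ∧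
      ¬ InH (u, false) t ∧ ¬ InH (w, false) t := by
  classical
  induction D with
  | zero =>
    exact ⟨{1}, by simp, fun t ht => by
      rw [Finset.mem_singleton.1 ht]
      exact ⟨one_mem _, by simp [len_one], one_not_inH _, one_not_inH _⟩⟩
  | succ D ih =>
    obtain ⟨T, hT, h⟩ := ih
    have hu : ∀ t ∈ T, InH (u, true) (lt Γ (u, true) * t) := fun t ht =>
      (inH_lt_mul _ _).2 (h t ht).2.2.1
    have hw : ∀ t ∈ T, InH (w, true) (lt Γ (w, true) * t) := fun t ht =>
      (inH_lt_mul _ _).2 (h t ht).2.2.2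
    have hly : u ∈ lk Γ y ∧ w ∈ lk Γ y := by rw [hc.lk_eq]; simp
    have hlen : ∀ s (t : RAAG Γ), len (lt Γ s * t) ≤ 1 + len t := fun s t => by
      have := len_mul (lt Γ s) t
      rwa [len_lt] at this
    refine ⟨T.image (lt Γ (u, true) * ·) ∪ T.image (lt Γ (w, true) * ·), ?_, ?_⟩
    · rw [Finset.card_union_of_disjoint, Finset.card_image_of_injective _ (mul_right_injective _),
        Finset.card_image_of_injective _ (mul_right_injective _), hT]
      · ring
      · rw [Finset.disjoint_left]
        intro a ha hb
        obtain ⟨t, ht, rfl⟩ := Finset.mem_image.1 ha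
        obtain ⟨t', ht', he⟩ := Finset.mem_image.1 hb
        have h1 := hu t ht
        have h2 := hw t' ht'
        rw [he] at h2
        exact h1.not_of_nonadj hc.ne hc.nadj h2
    · intro a ha
      rcases Finset.mem_union.1 ha with ha | ha
      · obtain ⟨t, ht, rfl⟩ := Finset.mem_image.1 ha
        obtain ⟨h1, h2, h3, h4⟩ := h t ht
        exact ⟨mul_mem (lt_mem_sp hly.1) h1, by have := hlen (u, true) t; omega,
          (hu t ht).not_flip, (hu t ht).not_of_nonadj hc.ne hc.nadj⟩
      · obtain ⟨t, ht, rfl⟩ := Finset.mem_image.1 ha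
        obtain ⟨h1, h2, h3, h4⟩ := h t ht
        exact ⟨mul_mem (lt_mem_sp hly.2) h1, by have := hlen (w, true) t; omega,
          (hw t ht).not_of_nonadj hc.ne.symm (fun h => hc.nadj h.symm), (hw t ht).not_flip⟩

/-- Quasiisometric embedding with integral constants. -/
def QI (K : ℕ) (f : RAAG Γ → RAAG Δ) : Prop :=
  ∀ a b, dd (f a) (f b) ≤ K * dd a b + K ∧ dd a b ≤ K * dd (f a) (f b) + K

/-- Each of the lines through the ball of radius `D` of the link comes close to the star `P`. -/
def NearL (f : RAAG Γ → RAAG Δ) (x : V) (D R c : ℕ) (P : RAAG Δ × W) (p : RAAG Γ) : Prop :=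
  ∀ t ∈ sp Γ (lk Γ x), len t ≤ D → ∃ k : ℤ, k.natAbs ≤ R ∧
    Near c P (f (p * (PresentedGroup.of x) ^ k * t))

theorem of_zpow_comm {x : V} {t : RAAG Γ} (ht : t ∈ sp Γ (lk Γ x)) (k : ℤ) :
    (PresentedGroup.of x) ^ k * t = t * (PresentedGroup.of x) ^ k := by
  have h1 : Commute (lt Γ (x, true)) t := sp_lk_commute ht
  exact (h1.zpow_left k).eq

theorem ret_lk_of_zpow (x : V) (k : ℤ) :
    ret Γ (lk Γ x) ((PresentedGroup.of x) ^ k) = 1 := by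
  have h1 : ret Γ (lk Γ x) (lt Γ (x, true)) = 1 := ret_lt_not_mem (not_mem_lk x)
  rw [lt_true] at h1
  rw [map_zpow, h1, one_zpow]

/-- The path following a line of the source, extended to two nearby points. -/
theorem exists_line_path {K : ℕ} {f : RAAG Γ → RAAG Δ} (hf : QI K f) (x : V) (q t : RAAG Γ)
    (ht : t ∈ sp Γ (lk Γ x)) {R c : ℕ} {k₁ k₂ : ℤ} (h1 : k₁.natAbs ≤ R) (h2 : k₂.natAbs ≤ R)
    {e₁ e₂ : RAAG Δ} (he₁ : dd (f (q * (PresentedGroup.of x) ^ k₁ * t)) e₁ ≤ c)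
    (he₂ : dd (f (q * (PresentedGroup.of x) ^ k₂ * t)) e₂ ≤ c) :
    ∃ z : ℕ → RAAG Δ, z 0 = e₁ ∧ z (2 * R + 2) = e₂ ∧
      (∀ k < 2 * R + 2, dd (z k) (z (k + 1)) ≤ 2 * K + c) ∧
      ∀ i, ∃ k : ℤ, k.natAbs ≤ R ∧ dd (f (q * (PresentedGroup.of x) ^ k * t)) (z i) ≤ c := by
  obtain ⟨κ, d, hκ, hd⟩ : ∃ (κ : ℤ) (d : ℕ), (κ = 1 ∨ κ = -1) ∧ k₂ = k₁ + κ * d := by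
    rcases le_total k₁ k₂ with h | h
    · exact ⟨1, (k₂ - k₁).toNat, Or.inl rfl, by omega⟩
    · exact ⟨-1, (k₁ - k₂).toNat, Or.inr rfl, by omega⟩
  have hstep : ∀ k : ℤ, dd (f (q * (PresentedGroup.of x) ^ k * t))
      (f (q * (PresentedGroup.of x) ^ (k + κ) * t)) ≤ 2 * K := by
    intro k
    have h3 := (hf (q * (PresentedGroup.of x) ^ k * t)
      (q * (PresentedGroup.of x) ^ (k + κ) * t)).1
    have h4 : dd (q * (PresentedGroup.of x) ^ k * t) (q * (PresentedGroup.of x) ^ (k + κ) * t)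
        = 1 := by
      rw [mul_assoc q, mul_assoc q, of_zpow_comm ht, of_zpow_comm ht, zpow_add, dd_mul_left,
        dd_mul_left, dd_mul_right_self, len_of_zpow]
      rcases hκ with rfl | rfl <;> rfl
    rw [h4] at h3
    omega
  obtain ⟨F, hF⟩ : ∃ F : ℕ → RAAG Δ, ∀ i, F i =
      f (q * (PresentedGroup.of x) ^ (k₁ + κ * i) * t) := ⟨_, fun i => rfl⟩
  have hFs : ∀ i, dd (F i) (F (i + 1)) ≤ 2 * K := by
    intro i
    have := hstep (k₁ + κ * i)
    rw [hF, hF]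
    convert this using 6
    push_cast; ring
  have hF0 : F 0 = f (q * (PresentedGroup.of x) ^ k₁ * t) := by rw [hF]; simp
  have hFd : F d = f (q * (PresentedGroup.of x) ^ k₂ * t) := by rw [hF, hd]
  have hd2 : d ≤ 2 * R := by rcases hκ with rfl | rfl <;> omega
  obtain ⟨z, hz⟩ : ∃ z : ℕ → RAAG Δ, ∀ i, z i =
    if i = 0 then e₁ else if i ≤ d + 1 then F (i - 1) else e₂ := ⟨_, fun i => rfl⟩
  have hz0 : z 0 = e₁ := by rw [hz, if_pos rfl]
  have hzm : ∀ i ≤ d, z (i + 1) = F i := by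
    intro i hi
    rw [hz, if_neg (by omega), if_pos (by omega), Nat.add_sub_cancel]
  have hze : ∀ i, d + 1 < i → z i = e₂ := by
    intro i hi
    rw [hz, if_neg (by omega), if_neg (by omega)]
  refine ⟨z, hz0, hze _ (by omega), ?_, ?_⟩
  · rintro (_ | k) hk
    · rw [hz0, hzm 0 (by omega), hF0, dd_comm]
      omega
    · rcases lt_trichotomy k d with h | h | h
      · rw [hzm k (by omega), hzm (k + 1) (by omega)]
        have := hFs k
        omega
      · rw [hzm k (by omega), hze _ (by omega), h, hFd]
        omega
      · rw [hze _ (by omega), hze _ (by omega), dd_self]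
        omega
  · rintro (_ | i)
    · exact ⟨k₁, h1, by rwa [hz0]⟩
    · by_cases h : i ≤ d
      · refine ⟨k₁ + κ * i, ?_, ?_⟩
        · rcases hκ with rfl | rfl <;> omega
        · rw [hzm i h, hF, dd_self]; omega
      · exact ⟨k₂, h2, by rwa [hze _ (by omega)]⟩

theorem zpow_rearrange {y v : W} (hv : Δ.Adj v y) {b : RAAG Δ} (hb : b ∈ sp Δ (lk Δ y))
    (e j α β : ℤ) :
    (PresentedGroup.of v) ^ e * b * (PresentedGroup.of y) ^ j =
      (PresentedGroup.of v) ^ α * (PresentedGroup.of y : RAAG Δ) ^ β *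
        ((PresentedGroup.of v) ^ (e - α) * b * (PresentedGroup.of y) ^ (j - β)) := by
  have h1 : (PresentedGroup.of v) ^ (e - α) * b ∈ sp Δ (lk Δ y) :=
    mul_mem (zpow_mem_sp hv.symm _) hb
  have h2 := of_zpow_comm h1 β
  have h3 : (PresentedGroup.of v : RAAG Δ) ^ e = (PresentedGroup.of v) ^ α *
      (PresentedGroup.of v) ^ (e - α) := by rw [← zpow_add]; congr 1; ring
  have h4 : (PresentedGroup.of y : RAAG Δ) ^ j = (PresentedGroup.of y) ^ β *
      (PresentedGroup.of y) ^ (j - β) := by rw [← zpow_add]; congr 1; ring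
  calc _ = (PresentedGroup.of v) ^ α * ((PresentedGroup.of v) ^ (e - α) * b *
        (PresentedGroup.of y) ^ β) * (PresentedGroup.of y : RAAG Δ) ^ (j - β) := by
        rw [h3, h4]; simp only [mul_assoc]
    _ = _ := by rw [← h2]; simp only [mul_assoc]

theorem exists_line_point {x : V} {u w y : W} {g m : RAAG Δ} {P' : RAAG Δ × W}
    (hc : Corner Δ y u w) (hm : OnStar (g, y) m)
    (hgate : ∀ s t : W × Bool, (s.1 = u ∨ s.1 = w) → (t.1 = u ∨ t.1 = w) → s.1 ≠ t.1 →
        ∀ a : ℕ, 1 ≤ a → ∀ e, OnStar P' e → ¬ InH t ((m * lt Δ s ^ a)⁻¹ * e))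
    {K : ℕ} {f : RAAG Γ → RAAG Δ} (hf : QI K f) {D R c q : ℕ} (hq : 1 ≤ q) {p : RAAG Γ}
    (h1 : NearL f x D R c (g, y) p) (h2 : NearL f x D R c P' p) {J h B : ℕ}
    (hJ : J = 2 * K + c) (hh : h = J * ((2 * R + 2) / q) + 4 * J)
    (hB : B = K * (R + D) + K + h + J * (2 * R + 2)) {F : RAAG Δ} (hF : F = m⁻¹ * f p)
    {t : RAAG Γ} (htl : t ∈ sp Γ (lk Γ x)) (htD : len t ≤ D) :
    ∃ (k : ℤ) (v : W) (b a : RAAG Δ), PowProd B (q + 2) b ∧ len a ≤ h ∧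
      m⁻¹ * f (p * (PresentedGroup.of x) ^ k * t) =
        (PresentedGroup.of v) ^ (ab v F) * (PresentedGroup.of y) ^ (ab y F) * b * a := by
  have hyu : Δ.Adj u y := hc.adj (Or.inl rfl)
  have hyw : Δ.Adj w y := hc.adj (Or.inr rfl)
  obtain ⟨k₁, hk₁, e₁, he₁, hd₁⟩ := h1 t htl htD
  obtain ⟨k₂, hk₂, e₂, he₂, hd₂⟩ := h2 t htl htD
  obtain ⟨z, hz0, hzL, hzs, hzn⟩ := exists_line_path hf x p t htl hk₁ hk₂ hd₁ hd₂
  rw [← hJ] at hzs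
  have hstart : m⁻¹ * z 0 ∈ sp Δ (st Δ y) := by
    have h3 : (g⁻¹ * m)⁻¹ * (g⁻¹ * e₁) ∈ sp Δ (st Δ y) := mul_mem (inv_mem hm) he₁
    have h4 : m⁻¹ * e₁ = (g⁻¹ * m)⁻¹ * (g⁻¹ * e₁) := by group
    rw [hz0, h4]
    exact h3
  obtain ⟨i, -, v, hv, e, j, b, hb, hbs, hbl, hd⟩ := path_near hc hzs hstart
    (fun s t hs ht hst a ha => by rw [hzL]; exact hgate s t hs ht hst a ha e₂ he₂) hq
  obtain ⟨k, hk, hkd⟩ := hzn i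
  obtain ⟨A, hA⟩ : ∃ A, A = m⁻¹ * f (p * (PresentedGroup.of x) ^ k * t) := ⟨_, rfl⟩
  obtain ⟨M, hM⟩ : ∃ M, M = (PresentedGroup.of v) ^ e * b * (PresentedGroup.of y : RAAG Δ) ^ j :=
    ⟨_, rfl⟩
  have hAM : dd A M ≤ h := by
    have h3 := dd_triangle (f (p * (PresentedGroup.of x) ^ k * t)) (z i) (m * M)
    have h4 : m * M = m * (PresentedGroup.of v) ^ e * b * (PresentedGroup.of y) ^ j := by
      rw [hM]; simp only [mul_assoc]
    rw [← h4] at hd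
    have h5 := dd_mul_left m A M
    rw [hA, mul_inv_cancel_left, ← hA] at h5
    omega
  have hFA : dd F A ≤ K * (R + D) + K := by
    rw [hF, hA, dd_mul_left]
    refine (hf _ _).1.trans ?_
    rw [mul_assoc, dd_mul_right_self]
    have h3 := len_mul ((PresentedGroup.of x) ^ k) t
    rw [len_of_zpow] at h3
    have h4 : len ((PresentedGroup.of x) ^ k * t) ≤ R + D := by omega
    have := Nat.mul_le_mul_left K h4
    omega
  have hvy : Δ.Adj v y := by rcases hv with rfl | rfl <;> assumption
  have hy0 : y ∉ ({u, w} : Set W) := by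
    rintro (h | h)
    · exact hyu.ne h.symm
    · exact hyw.ne h.symm
  have hMy : ab y M = j := by
    rw [hM, ab_mul, ab_mul, ab_zpow, ab_zpow, ab_of_self, ab_of_ne hvy.ne, ab_of_mem_sp hy0 hbs]
    ring
  have hMv : ab v M = e + ab v b := by
    rw [hM, ab_mul, ab_mul, ab_zpow, ab_zpow, ab_of_self, ab_of_ne hvy.ne.symm]
    ring
  have a1 := abs_le.1 (abs_ab_sub_le y A M)
  have a2 := abs_le.1 (abs_ab_sub_le y F A)
  have a3 := abs_le.1 (abs_ab_sub_le v A M)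
  have a4 := abs_le.1 (abs_ab_sub_le v F A)
  have a5 := abs_le.1 (abs_ab_le v b)
  rw [hMy] at a1
  rw [hMv] at a3
  have hcj : |j - ab y F| ≤ B := by
    rw [abs_le]
    omega
  have hce : |e - ab v F| ≤ B := by
    rw [abs_le]
    omega
  have hB' : J * (2 * R + 2) ≤ B := by omega
  have : Nonempty W := ⟨y⟩
  refine ⟨k, v, (PresentedGroup.of v) ^ (e - ab v F) * b * (PresentedGroup.of y) ^ (j - ab y F),
    M⁻¹ * A, ?_, ?_, ?_⟩
  · have h3 := ((PowProd.zpow (Γ := Δ) v hce).mul (hb.mono hB' le_rfl)).mul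
      (PowProd.zpow (Γ := Δ) y hcj)
    exact h3.mono le_rfl (by omega)
  · rw [dd_comm] at hAM; exact hAM
  · rw [← zpow_rearrange hvy (by rw [hc.lk_eq]; exact hbs), ← hM, mul_inv_cancel_left, hA]

theorem exists_target [Fintype W] (α : W → RAAG Δ) (B q h : ℕ) :
    ∃ S : Finset (RAAG Δ), S.card ≤ Fintype.card W *
      ((Fintype.card W * (2 * B + 1)) ^ q * (2 * Fintype.card W + 1) ^ h) ∧
      ∀ v b a, PowProd B q b → len a ≤ h → α v * b * a ∈ S := by
  classical
  obtain ⟨S₁, hS₁, hS₁'⟩ := finite_powProd (Γ := Δ) B q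
  obtain ⟨S₂, hS₂, hS₂'⟩ := finite_letters_ball (Γ := Δ) h
  refine ⟨((Finset.univ : Finset W) ×ˢ (S₁ ×ˢ S₂)).image (fun r => α r.1 * r.2.1 * r.2.2),
    Finset.card_image_le.trans ?_, fun v b a hb ha => Finset.mem_image.2 ⟨(v, b, a), ?_, rfl⟩⟩
  · rw [Finset.card_product, Finset.card_product, Finset.card_univ]
    exact Nat.mul_le_mul_left _ (Nat.mul_le_mul hS₁ hS₂)
  · simp only [Finset.mem_product, Finset.mem_univ, true_and]
    exact ⟨hS₁' _ hb, hS₂' _ ha⟩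

theorem card_le_of_fibres [Fintype V] {x : V} {K : ℕ} {f : RAAG Γ → RAAG Δ} (hf : QI K f)
    (m : RAAG Δ) (p : RAAG Γ) {T : Finset (RAAG Γ)} (hT : ∀ t ∈ T, t ∈ sp Γ (lk Γ x))
    (k : RAAG Γ → ℤ) (S : Finset (RAAG Δ))
    (hS : ∀ t ∈ T, m * f (p * (PresentedGroup.of x) ^ (k t) * t) ∈ S) :
    T.card ≤ (2 * Fintype.card V + 1) ^ K * S.card := by
  classical
  obtain ⟨S₃, hS₃, hS₃'⟩ := finite_letters_ball (Γ := Γ) K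
  refine Finset.card_le_mul_card_image_of_maps_to hS _ fun r _ => ?_
  rcases (T.filter (fun t => m * f (p * (PresentedGroup.of x) ^ (k t) * t) = r)).eq_empty_or_nonempty
    with h3 | ⟨t₀, ht₀⟩
  · rw [h3]; simp
  · rw [Finset.mem_filter] at ht₀
    refine le_trans (Finset.card_le_card (t := S₃.image (t₀ * ·)) ?_)
      (Finset.card_image_le.trans hS₃)
    intro t ht
    rw [Finset.mem_filter] at ht
    refine Finset.mem_image.2 ⟨t₀⁻¹ * t, hS₃' _ ?_, by simp⟩
    have h3 := (hf (p * (PresentedGroup.of x) ^ (k t₀) * t₀)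
      (p * (PresentedGroup.of x) ^ (k t) * t)).2
    rw [mul_left_cancel (ht₀.2.trans ht.2.symm), dd_self, mul_zero, zero_add] at h3
    have h4 := dd_ret_le (lk Γ x) p (p * (PresentedGroup.of x) ^ (k t₀) * t₀)
      (p * (PresentedGroup.of x) ^ (k t) * t)
    have h5 : ∀ t ∈ T, ret Γ (lk Γ x) (p⁻¹ * (p * (PresentedGroup.of x) ^ (k t) * t)) = t := by
      intro t ht
      rw [mul_assoc p, inv_mul_cancel_left, map_mul, ret_lk_of_zpow, one_mul, mem_sp.1 (hT t ht)]
    rw [h5 t₀ ht₀.1, h5 t ht.1] at h4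
    exact h4.trans h3

theorem card_bound [Fintype V] [Fintype W] {x u' w' : V} (hx : Corner Γ x u' w') {u w : W}
    {P P' : RAAG Δ × W} (hc : Corner Δ P.2 u w) {K : ℕ} {f : RAAG Γ → RAAG Δ} (hf : QI K f)
    {D R c q : ℕ} (hq : 1 ≤ q) {p : RAAG Γ} (h1 : NearL f x D R c P p)
    (h2 : NearL f x D R c P' p) (hne : ¬ SameStar P P') {J h B : ℕ} (hJ : J = 2 * K + c)
    (hh : h = J * ((2 * R + 2) / q) + 4 * J)
    (hB : B = K * (R + D) + K + h + J * (2 * R + 2)) :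
    2 ^ D ≤ (2 * Fintype.card V + 1) ^ K * (Fintype.card W *
      ((Fintype.card W * (2 * B + 1)) ^ (q + 2) * (2 * Fintype.card W + 1) ^ h)) := by
  classical
  obtain ⟨g, y⟩ := P
  obtain ⟨m, hm, hgate⟩ := exists_gate hc hne
  obtain ⟨T, hT, hTp⟩ := exists_positive_words hx D
  obtain ⟨F, hF⟩ : ∃ F, F = m⁻¹ * f p := ⟨_, rfl⟩
  have hmain := fun t ht => exists_line_point hc hm hgate hf hq h1 h2 hJ hh hB hF
    (hTp t ht).1 (hTp t ht).2.1
  have : Nonempty W := ⟨y⟩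
  choose! k v b a hb ha he using hmain
  obtain ⟨S, hS, hS'⟩ := exists_target (fun v => (PresentedGroup.of v) ^ (ab v F) *
    (PresentedGroup.of y : RAAG Δ) ^ (ab y F)) B (q + 2) h
  have hcard := card_le_of_fibres hf m⁻¹ p (fun t ht => (hTp t ht).1) k S
    (fun t ht => by rw [he t ht]; exact hS' _ _ _ (hb t ht) (ha t ht))
  rw [hT] at hcard
  exact hcard.trans (Nat.mul_le_mul_left _ hS)

end Count

theorem exists_poly_lt_two_pow (C Q : ℕ) : ∃ D₀, ∀ D ≥ D₀, C * (D + 1) ^ Q < 2 ^ D := by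
  have h := tendsto_pow_const_div_const_pow_of_one_lt Q (one_lt_two (α := ℝ))
  have h1 : (0 : ℝ) < 1 / (2 * C + 1) := by positivity
  obtain ⟨D₀, hD⟩ := Filter.eventually_atTop.1 (h.eventually_lt_const h1)
  refine ⟨D₀, fun D hD' => ?_⟩
  have h2 := hD (D + 1) (by omega)
  rw [div_lt_div_iff₀ (by positivity) (by positivity), one_mul, pow_succ] at h2
  have h3 : (0 : ℝ) ≤ ((D + 1 : ℕ) : ℝ) ^ Q := by positivity
  have h4 : (C : ℝ) * ((D + 1 : ℕ) : ℝ) ^ Q < 2 ^ D := by nlinarith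
  exact_mod_cast h4

theorem exists_count_lt (a n K N c : ℕ) : ∃ D₀, ∀ D ≥ D₀, ∃ q h B, 1 ≤ q ∧
    h = (2 * K + c) * ((2 * (N * (D + 1)) + 2) / q) + 4 * (2 * K + c) ∧
    B = K * (N * (D + 1) + D) + K + h + (2 * K + c) * (2 * (N * (D + 1)) + 2) ∧
    a ^ K * (n * ((n * (2 * B + 1)) ^ (q + 2) * (2 * n + 1) ^ h)) < 2 ^ D := by
  obtain ⟨J, hJ⟩ : ∃ J, J = 2 * K + c := ⟨_, rfl⟩
  obtain ⟨q, hq⟩ : ∃ q, q = 4 * n * J * (2 * N + 2) + 1 := ⟨_, rfl⟩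
  obtain ⟨C₁, hC₁⟩ : ∃ C₁, C₁ = K * (N + 1) + K + 2 * J * (2 * N + 2) + 4 * J := ⟨_, rfl⟩
  obtain ⟨C₂, hC₂⟩ : ∃ C₂, C₂ = n * (2 * C₁ + 1) := ⟨_, rfl⟩
  obtain ⟨D₀, hD₀⟩ := exists_poly_lt_two_pow
    ((a ^ K * n) ^ 2 * C₂ ^ ((q + 2) * 2) * 2 ^ (1 + 16 * n * J)) ((q + 2) * 2)
  refine ⟨D₀, fun D hD => ⟨q, _, _, by omega, rfl, rfl, ?_⟩⟩
  rw [← hJ]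
  obtain ⟨L, hL⟩ : ∃ L, L = 2 * (N * (D + 1)) + 2 := ⟨_, rfl⟩
  rw [← hL]
  have hLD : L ≤ (2 * N + 2) * (D + 1) := by rw [hL]; nlinarith
  obtain ⟨h, hh⟩ : ∃ h, h = J * (L / q) + 4 * J := ⟨_, rfl⟩
  rw [← hh]
  obtain ⟨B, hB⟩ : ∃ B, B = K * (N * (D + 1) + D) + K + h + J * L := ⟨_, rfl⟩
  rw [← hB]
  have hLq : 4 * n * J * (L / q) ≤ D + 1 := by
    have h1 := Nat.mul_div_le L q
    have h2 : 4 * n * J * (2 * N + 2) * (L / q) ≤ q * (L / q) := Nat.mul_le_mul_right _ (by omega)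
    have h3 : (2 * N + 2) * (4 * n * J * (L / q)) ≤ (2 * N + 2) * (D + 1) := by
      calc _ = 4 * n * J * (2 * N + 2) * (L / q) := by ring
        _ ≤ _ := by omega
    exact Nat.le_of_mul_le_mul_left h3 (by omega)
  have hnh : 4 * n * h ≤ D + (1 + 16 * n * J) := by
    rw [hh]
    nlinarith
  have hBC : B ≤ C₁ * (D + 1) := by
    have h1 : J * (L / q) ≤ J * L := Nat.mul_le_mul_left _ (Nat.div_le_self _ _)
    have h2 : J * L ≤ J * ((2 * N + 2) * (D + 1)) := Nat.mul_le_mul_left _ hLD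
    have h3 : K * (N * (D + 1) + D) ≤ K * ((N + 1) * (D + 1)) :=
      Nat.mul_le_mul_left _ (by nlinarith)
    have h4 : K ≤ K * (D + 1) := Nat.le_mul_of_pos_right _ (by omega)
    have h5 : J ≤ J * (D + 1) := Nat.le_mul_of_pos_right _ (by omega)
    rw [hB, hh, hC₁]
    nlinarith
  have hBC' : n * (2 * B + 1) ≤ C₂ * (D + 1) := by
    rw [hC₂, mul_assoc]
    refine Nat.mul_le_mul_left _ ?_
    nlinarith
  have h2n : (2 * n + 1) ^ h ≤ 2 ^ (2 * n * h) := by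
    rw [pow_mul]
    exact Nat.pow_le_pow_left (Nat.succ_le_of_lt (Nat.lt_two_pow_self)) _
  refine lt_of_pow_lt_pow_left₀ 2 (Nat.zero_le _) ?_
  calc (a ^ K * (n * ((n * (2 * B + 1)) ^ (q + 2) * (2 * n + 1) ^ h))) ^ 2
      ≤ (a ^ K * (n * ((C₂ * (D + 1)) ^ (q + 2) * 2 ^ (2 * n * h)))) ^ 2 := by
        gcongr
    _ = (a ^ K * n) ^ 2 * C₂ ^ ((q + 2) * 2) * (D + 1) ^ ((q + 2) * 2) * 2 ^ (4 * n * h) := by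
        have : 2 ^ (4 * n * h) = (2 ^ (2 * n * h)) ^ 2 := by rw [← pow_mul]; congr 1; ring
        rw [this]
        generalize 2 ^ (2 * n * h) = Z
        rw [mul_pow C₂]
        ring
    _ ≤ (a ^ K * n) ^ 2 * C₂ ^ ((q + 2) * 2) * (D + 1) ^ ((q + 2) * 2) *
          2 ^ (D + (1 + 16 * n * J)) := by
        refine Nat.mul_le_mul_left _ (Nat.pow_le_pow_right (by norm_num) hnh)
    _ = ((a ^ K * n) ^ 2 * C₂ ^ ((q + 2) * 2) * 2 ^ (1 + 16 * n * J) *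
          (D + 1) ^ ((q + 2) * 2)) * 2 ^ D := by
        rw [pow_add]; ring
    _ < 2 ^ D * 2 ^ D := Nat.mul_lt_mul_of_pos_right (hD₀ D hD) (by positivity)
    _ = (2 ^ D) ^ 2 := by ring

section Rigidity

variable {V : Type*} {Γ : SimpleGraph V} {W : Type*} {Δ : SimpleGraph W}

/-- Every vertex is a corner. -/
def Corners (Γ : SimpleGraph V) : Prop := ∀ y, ∃ u w, Corner Γ y u w

theorem exists_sameStar [Fintype V] [Fintype W] (hX : Corners Γ) (hY : Corners Δ) (K N c : ℕ) :
    ∃ D, ∀ f : RAAG Γ → RAAG Δ, QI K f → ∀ p x P P', NearL f x D (N * (D + 1)) c P p →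
      NearL f x D (N * (D + 1)) c P' p → SameStar P P' := by
  obtain ⟨D, hD⟩ := exists_count_lt (2 * Fintype.card V + 1) (Fintype.card W) K N c
  refine ⟨D, fun f hf p x P P' h1 h2 => ?_⟩
  obtain ⟨q, h, B, hq, hh, hB, hlt⟩ := hD D le_rfl
  obtain ⟨u', w', hx⟩ := hX x
  obtain ⟨u, w, hc⟩ := hY P.2
  by_contra hne
  exact absurd (card_bound hx hc hf hq h1 h2 hne rfl hh hB) (not_le.2 hlt)

theorem NearL.mono {f : RAAG Γ → RAAG Δ} {x : V} {D R c D' R' c' : ℕ} {P : RAAG Δ × W}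
    {p : RAAG Γ} (h : NearL f x D R c P p) (hD : D' ≤ D) (hR : R ≤ R') (hc : c ≤ c') :
    NearL f x D' R' c' P p := by
  intro t ht htD
  obtain ⟨k, hk, h1⟩ := h t ht (htD.trans hD)
  exact ⟨k, hk.trans hR, h1.mono hc⟩

theorem NearL.sameStar {f : RAAG Γ → RAAG Δ} {x : V} {D R c : ℕ} {P P' : RAAG Δ × W}
    {p : RAAG Γ} (h : NearL f x D R c P p) (hP : SameStar P P') : NearL f x D R c P' p := by
  intro t ht htD
  obtain ⟨k, hk, h1⟩ := h t ht htD
  exact ⟨k, hk, hP.near h1⟩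

theorem NearL.step {f : RAAG Γ → RAAG Δ} {x : V} {D R c : ℕ} {P : RAAG Δ × W}
    {p : RAAG Γ} (h : NearL f x (D + 1) R c P p) {s : V × Bool} (hs : s.1 ∈ st Γ x) :
    NearL f x D (R + 1) c P (p * lt Γ s) := by
  intro t ht htD
  rcases hs with hs | hs
  · obtain ⟨k, hk, h1⟩ := h t ht (htD.trans (Nat.le_succ _))
    obtain ⟨ε, hε, he⟩ : ∃ ε : ℤ, ε.natAbs = 1 ∧
        lt Γ s = (PresentedGroup.of x) ^ ε := by
      obtain ⟨v, b⟩ := s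
      simp only at hs
      subst hs
      cases b
      · exact ⟨-1, rfl, by simp [lt_false]⟩
      · exact ⟨1, rfl, by simp [lt_true]⟩
    refine ⟨k - ε, by omega, ?_⟩
    have h2 : p * lt Γ s * (PresentedGroup.of x) ^ (k - ε) * t =
        p * (PresentedGroup.of x) ^ k * t := by
      rw [he, mul_assoc p, ← zpow_add]
      congr 3
      ring
    rwa [h2]
  · obtain ⟨k, hk, h1⟩ := h (lt Γ s * t) (mul_mem (lt_mem_sp hs) ht) (by
      have := len_mul (lt Γ s) t
      rw [len_lt] at this
      omega)
    refine ⟨k, by omega, ?_⟩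
    have h2 := of_zpow_comm (lt_mem_sp (Γ := Γ) hs) k
    rw [← mul_assoc, mul_assoc p, h2, ← mul_assoc] at h1
    exact h1

theorem nearL_of_vcount {K : ℕ} {f : RAAG Γ → RAAG Δ} (hf : QI K f) {p : RAAG Γ} {x : V}
    {D R : ℕ} {v : W} (h : 2 * (K * D + K) + 2 ≤
      vcount v ((f p)⁻¹ * f (p * (PresentedGroup.of x) ^ (R : ℤ)))) :
    ∃ g, NearL f x D R (2 * K) (g, v) p := by
  obtain ⟨g, s, rfl, h1, h2⟩ := exists_wall h
  refine ⟨g, fun t ht htD => ?_⟩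
  have hKD : K * len t ≤ K * D := Nat.mul_le_mul_left _ htD
  obtain ⟨F, hF⟩ : ∃ F : ℕ → RAAG Δ, ∀ i, F i =
      f (p * (PresentedGroup.of x) ^ (i : ℤ) * t) := ⟨_, fun i => rfl⟩
  have h3 : ¬ InH s (g⁻¹ * F 0) := by
    apply h1
    have := (hf p (p * t)).1
    rw [dd_mul_right_self] at this
    rw [hF]
    simp only [Nat.cast_zero, zpow_zero, mul_one]
    omega
  have h4 : ¬ ¬ InH s (g⁻¹ * F R) := by
    rw [not_not]
    apply h2
    have := (hf (p * (PresentedGroup.of x) ^ (R : ℤ)) (p * (PresentedGroup.of x) ^ (R : ℤ) * t)).1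
    rw [dd_mul_right_self] at this
    rw [hF]
    omega
  obtain ⟨i, hi1, hiR, hi, hlt⟩ := exists_first_exit (p := fun i => ¬ InH s (g⁻¹ * F i)) h3 h4
  have h5 := hlt (i - 1) (by omega)
  obtain ⟨e, he, hd⟩ := crossing_le h5 (not_not.1 hi)
  refine ⟨i, by omega, e, sp_mono (Set.subset_insert _ _) he, ?_⟩
  have h6 : dd (F (i - 1)) (F i) ≤ 2 * K := by
    rw [hF, hF]
    have h7 := (hf (p * (PresentedGroup.of x) ^ ((i - 1 : ℕ) : ℤ) * t)
      (p * (PresentedGroup.of x) ^ (i : ℤ) * t)).1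
    have h8 : dd (p * (PresentedGroup.of x) ^ ((i - 1 : ℕ) : ℤ) * t)
      (p * (PresentedGroup.of x) ^ (i : ℤ) * t) = 1 := by
      have h9 : (i : ℤ) = ((i - 1 : ℕ) : ℤ) + 1 := by omega
      rw [h9, mul_assoc p, mul_assoc p, of_zpow_comm ht, of_zpow_comm ht, zpow_add, dd_mul_left,
        dd_mul_left, dd_mul_right_self, len_of_zpow]
      rfl
    rw [h8] at h7
    omega
  have h7 := hF i
  rw [← h7, dd_comm]
  omega

theorem exists_nearL [Fintype W] {K : ℕ} {f : RAAG Γ → RAAG Δ} (hf : QI K f) (p : RAAG Γ) (x : V)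
    (D : ℕ) : ∃ P, NearL f x D ((K * Fintype.card W * (2 * K + 1) + K + 1) * (D + 1)) (2 * K) P p := by
  obtain ⟨R, hR⟩ : ∃ R, R = (K * Fintype.card W * (2 * K + 1) + K + 1) * (D + 1) := ⟨_, rfl⟩
  rw [← hR]
  have h1 := (hf p (p * (PresentedGroup.of x) ^ (R : ℤ))).2
  rw [dd_mul_right_self, len_of_zpow, Int.natAbs_natCast] at h1
  have h2 : Fintype.card W * (2 * (K * D + K) + 1) <
      len ((f p)⁻¹ * f (p * (PresentedGroup.of x) ^ (R : ℤ))) := by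
    by_contra! hc
    have h3 := Nat.mul_le_mul_left K hc
    rw [dd] at h1
    have h4 : K * (Fintype.card W * (2 * (K * D + K) + 1)) ≤
        K * Fintype.card W * ((2 * K + 1) * (D + 1)) := by
      rw [mul_assoc]
      exact Nat.mul_le_mul_left _ (Nat.mul_le_mul_left _ (by nlinarith))
    have h5 : R = K * Fintype.card W * ((2 * K + 1) * (D + 1)) + (K + 1) * (D + 1) := by
      rw [hR]; ring
    have h6 : K + 1 ≤ (K + 1) * (D + 1) := Nat.le_mul_of_pos_right _ (by omega)
    omega
  obtain ⟨v, hv⟩ := exists_vcount_lt h2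
  obtain ⟨g, hg⟩ := nearL_of_vcount hf (D := D) (show _ ≤ _ from hv)
  exact ⟨_, hg⟩

/-- Star cosets are mapped close to star cosets. -/
theorem exists_near_star [Fintype V] [Fintype W] (hX : Corners Γ) (hY : Corners Δ) {K : ℕ}
    {f : RAAG Γ → RAAG Δ} (hf : QI K f) (g : RAAG Γ) (x : V) :
    ∃ P C, ∀ q, g⁻¹ * q ∈ sp Γ (st Γ x) → Near C P (f q) := by
  obtain ⟨N, hN⟩ : ∃ N, N = K * Fintype.card W * (2 * K + 1) + K + 1 := ⟨_, rfl⟩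
  obtain ⟨D, hD⟩ := exists_sameStar hX hY K (2 * N + 1) (2 * K)
  have h := fun p => exists_nearL hf p x (D + 1)
  rw [← hN] at h
  have hND : N * (D + 1 + 1) + 1 ≤ (2 * N + 1) * (D + 1) := by nlinarith
  choose P hP using h
  have hstep : ∀ p s, s.1 ∈ st Γ x → SameStar (P p) (P (p * lt Γ s)) := by
    intro p s hs
    exact hD f hf (p * lt Γ s) x _ _ (((hP p).step hs).mono le_rfl hND le_rfl)
      ((hP _).mono (by omega) (by omega) le_rfl)
  have hall : ∀ w : List (V × Bool), (∀ s ∈ w, s.1 ∈ st Γ x) → ∀ p,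
      SameStar (P p) (P (p * ev Γ w)) := by
    intro w
    induction w with
    | nil => intro _ p; rw [ev_nil, mul_one]; exact SameStar.refl _
    | cons s w ih =>
      intro hw p
      rw [ev_cons, ← mul_assoc]
      exact (hstep p s (hw s (by simp))).trans (ih (fun s hs => hw s (by simp [hs])) _)
  refine ⟨P g, K * (N * (D + 1 + 1)) + K + 2 * K, fun q hq => ?_⟩
  obtain ⟨w, hw, -, hws⟩ := exists_word_sp hq
  have h1 := hall w hws g
  rw [hw, mul_inv_cancel_left] at h1
  obtain ⟨k, hk, hn⟩ := (hP q).sameStar h1.symm 1 (one_mem _) (by rw [len_one]; omega)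
  rw [mul_one] at hn
  refine hn.of_dd ?_
  have h2 := (hf q (q * (PresentedGroup.of x) ^ k)).1
  rw [dd_mul_right_self, len_of_zpow] at h2
  have := Nat.mul_le_mul_left K hk
  omega

/-- The line `φ` follows the standard line through `p` with label `y` up to sublinear error. -/
def Track (φ : ℤ → RAAG Δ) (p : RAAG Δ) (y : W) : Prop :=
  ∀ M : ℕ, ∃ C, ∀ k : ℤ,
    M * dd (φ k) (p * (PresentedGroup.of y) ^ (ab y (p⁻¹ * φ k))) ≤ k.natAbs + C

theorem dd_line_le {p : RAAG Δ} {y : W} {C : ℕ} {a : RAAG Δ} (h : Near C (p, y) a) :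
    dd a (p * (PresentedGroup.of y) ^ (ab y (p⁻¹ * a))) ≤
      3 * C + len (ret Δ (lk Δ y) (p⁻¹ * a)) := by
  obtain ⟨e, he, hd⟩ := h
  obtain ⟨A, hA⟩ : ∃ A, A = p⁻¹ * a := ⟨_, rfl⟩
  obtain ⟨E, hE⟩ : ∃ E, E = p⁻¹ * e := ⟨_, rfl⟩
  have he' : E ∈ sp Δ (st Δ y) := by rw [hE]; exact he
  have hAE : dd A E ≤ C := by rw [hA, hE, dd_mul_left]; exact hd
  have hret := len_ret_le (lk Δ y) (A⁻¹ * E)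
  rw [map_mul, map_inv] at hret
  have h1 : len (ret Δ (lk Δ y) E) ≤ len (ret Δ (lk Δ y) A) + C := by
    have h2 := len_mul (ret Δ (lk Δ y) A) ((ret Δ (lk Δ y) A)⁻¹ * ret Δ (lk Δ y) E)
    rw [mul_inv_cancel_left] at h2
    rw [dd] at hAE
    omega
  have h2 : dd E ((PresentedGroup.of y) ^ (ab y E)) = len (ret Δ (lk Δ y) E) := by
    have h3 := eq_ret_mul_zpow he'
    have h4 := of_zpow_comm (ret_mem_sp (Γ := Δ) (lk Δ y) E) (ab y E)
    rw [← h4] at h3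
    conv_lhs => rw [h3]
    rw [dd_comm, ab_mul, ab_zpow, ab_of_self, mul_one,
      ab_of_mem_sp (not_mem_lk y) (ret_mem_sp _ _), add_zero, dd_mul_right_self]
  have h3 : dd ((PresentedGroup.of y : RAAG Δ) ^ (ab y E)) ((PresentedGroup.of y) ^ (ab y A)) ≤ C := by
    rw [dd, ← zpow_neg, ← zpow_add, len_of_zpow]
    have := abs_le.1 (abs_ab_sub_le y A E)
    omega
  have h4 := dd_triangle A E ((PresentedGroup.of y) ^ (ab y A))
  have h5 := dd_triangle E ((PresentedGroup.of y) ^ (ab y E)) ((PresentedGroup.of y) ^ (ab y A))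
  have h6 : dd a (p * (PresentedGroup.of y) ^ (ab y (p⁻¹ * a))) =
      dd A ((PresentedGroup.of y) ^ (ab y A)) := by
    rw [← hA, ← dd_mul_left p A, hA, mul_inv_cancel_left]
  rw [h6, ← hA]
  omega

theorem dd_periodic_le {θ : ℤ → RAAG Δ} {R S T : ℕ} (hR : 0 < R)
    (hS : ∀ k, dd (θ k) (θ (k + R)) ≤ S) (hT : ∀ k l : ℤ, (k - l).natAbs ≤ R → dd (θ k) (θ l) ≤ T)
    (k : ℤ) : dd (θ 0) (θ k) ≤ k.natAbs / R * S + T := by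
  have key : ∀ (j : ℕ) (k : ℤ), dd (θ k) (θ (k + j * R)) ≤ j * S := by
    intro j k
    induction j with
    | zero => simp [dd_self]
    | succ j ih =>
      have h1 := dd_triangle (θ k) (θ (k + j * R)) (θ (k + j * R + R))
      have h2 := hS (k + j * R)
      have h3 : k + ((j + 1 : ℕ) : ℤ) * R = k + j * R + R := by push_cast; ring
      rw [h3, Nat.succ_mul]
      omega
  have h1 := Nat.mod_lt k.natAbs hR
  have h2 := Nat.div_add_mod k.natAbs R
  obtain ⟨j, hj⟩ : ∃ j, j = k.natAbs / R := ⟨_, rfl⟩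
  rw [← hj] at h2 ⊢
  have h3 : (j : ℤ) * R = ((R * j : ℕ) : ℤ) := by push_cast; ring
  rcases le_total 0 k with hk | hk
  · have h4 := key j 0
    have h5 := hT (0 + j * R) k (by rw [h3]; omega)
    have h6 := dd_triangle (θ 0) (θ (0 + j * R)) (θ k)
    omega
  · have h4 := key j k
    have h5 := hT (k + j * R) 0 (by rw [h3]; omega)
    have h6 := dd_triangle (θ k) (θ (k + j * R)) (θ 0)
    rw [dd_comm] at h6
    omega

theorem exists_track [Fintype V] [Fintype W] (hX : Corners Γ) (hY : Corners Δ) {K : ℕ}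
    {f : RAAG Γ → RAAG Δ} (hf : QI K f) (g : RAAG Γ) (x : V) :
    ∃ p y, (∃ C, ∀ q, g⁻¹ * q ∈ sp Γ (st Γ x) → Near C (p, y) (f q)) ∧
      Track (fun k => f (g * (PresentedGroup.of x) ^ k)) p y := by
  obtain ⟨⟨p, y⟩, C, hC⟩ := exists_near_star hX hY hf g x
  refine ⟨p, y, ⟨C, hC⟩, fun M => ?_⟩
  obtain ⟨D, hD⟩ := exists_sameStar hX hY K ((M + 1) * (4 * K + 2)) (max (2 * K) C)
  obtain ⟨R, hR⟩ : ∃ R, R = (M + 1) * (4 * K + 2) * (D + 1) := ⟨_, rfl⟩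
  rw [← hR] at hD
  have hline : ∀ k : ℤ, g⁻¹ * (g * (PresentedGroup.of x) ^ k) ∈ sp Γ (st Γ x) := fun k => by
    rw [inv_mul_cancel_left]
    exact zpow_mem_sp (Set.mem_insert _ _) k
  obtain ⟨u, w, hc⟩ := hY y
  have hv : ∀ (v : W) (k : ℤ), v ≠ y →
      vcount v ((f (g * (PresentedGroup.of x) ^ k))⁻¹ *
        f (g * (PresentedGroup.of x) ^ (k + R))) ≤ 2 * (K * D + K) + 1 := by
    intro v k hvy
    by_contra! hcon
    rw [zpow_add, ← mul_assoc] at hcon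
    obtain ⟨g', hg'⟩ := nearL_of_vcount hf (D := D) (show _ ≤ _ from hcon)
    have h1 : NearL f x D R (max (2 * K) C) (p, y) (g * (PresentedGroup.of x) ^ k) := by
      intro t ht htD
      refine ⟨0, by simp, ?_⟩
      refine Near.mono (hC _ ?_) (le_max_right _ _)
      have h2 := mul_mem (hline k) (sp_mono (Set.subset_insert _ _) ht : t ∈ sp Γ (st Γ x))
      simpa [mul_assoc] using h2
    have h2 := hD f hf _ x _ _ h1 (hg'.mono le_rfl le_rfl (le_max_left _ _))
    exact hvy h2.1.symm
  obtain ⟨θ, hθ⟩ : ∃ θ : ℤ → RAAG Δ, ∀ k, θ k =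
      ret Δ (lk Δ y) (p⁻¹ * f (g * (PresentedGroup.of x) ^ k)) := ⟨_, fun k => rfl⟩
  have hu : u ≠ y := (hc.adj (Or.inl rfl)).ne
  have hw : w ≠ y := (hc.adj (Or.inr rfl)).ne
  have hS : ∀ k, dd (θ k) (θ (k + R)) ≤ (4 * K + 2) * (D + 1) := by
    intro k
    rw [hθ, hθ, dd, ← map_inv, ← map_mul, hc.lk_eq]
    refine (len_ret_pair_le _ _ _).trans ?_
    have h1 := hv u k hu
    have h2 := hv w k hw
    have h3 : (p⁻¹ * f (g * (PresentedGroup.of x) ^ k))⁻¹ *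
        (p⁻¹ * f (g * (PresentedGroup.of x) ^ (k + R))) =
        (f (g * (PresentedGroup.of x) ^ k))⁻¹ * f (g * (PresentedGroup.of x) ^ (k + R)) := by group
    rw [h3]
    nlinarith
  have hT : ∀ k l : ℤ, (k - l).natAbs ≤ R → dd (θ k) (θ l) ≤ K * R + K := by
    intro k l hkl
    rw [hθ, hθ]
    refine (dd_ret_le _ _ _ _).trans ((hf _ _).1.trans ?_)
    rw [dd_mul_left, dd, ← zpow_neg, ← zpow_add, len_of_zpow]
    have : (-k + l).natAbs ≤ R := by omega
    have := Nat.mul_le_mul_left K this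
    omega
  have hRpos : 0 < R := by rw [hR]; positivity
  have hfin := dd_periodic_le hRpos hS hT
  refine ⟨M * (3 * C + len (θ 0) + (K * R + K)), fun k => ?_⟩
  have h1 := dd_line_le (hC _ (hline k))
  rw [← hθ] at h1
  have h2 := hfin k
  have h3 := len_mul (θ 0) ((θ 0)⁻¹ * θ k)
  rw [mul_inv_cancel_left] at h3
  rw [dd] at h2
  have h4 : len (θ k) ≤ len (θ 0) + (k.natAbs / R * ((4 * K + 2) * (D + 1)) + (K * R + K)) := by
    omega
  have h5 : M * (k.natAbs / R * ((4 * K + 2) * (D + 1))) ≤ k.natAbs := by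
    calc _ ≤ (M + 1) * (k.natAbs / R * ((4 * K + 2) * (D + 1))) := Nat.mul_le_mul_right _ (by omega)
      _ = R * (k.natAbs / R) := by rw [hR]; ring
      _ ≤ _ := Nat.mul_div_le _ _
  calc M * dd (f (g * (PresentedGroup.of x) ^ k))
        (p * (PresentedGroup.of y) ^ (ab y (p⁻¹ * f (g * (PresentedGroup.of x) ^ k))))
      ≤ M * (3 * C + (len (θ 0) + (k.natAbs / R * ((4 * K + 2) * (D + 1)) + (K * R + K)))) :=
        Nat.mul_le_mul_left _ (by omega)
    _ = M * (k.natAbs / R * ((4 * K + 2) * (D + 1))) +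
        M * (3 * C + len (θ 0) + (K * R + K)) := by ring
    _ ≤ _ := by omega

end Rigidity

section Sublinear

/-- Sublinear growth. -/
def Sub (u : ℤ → ℕ) : Prop := ∀ M : ℕ, ∃ C, ∀ k, M * u k ≤ k.natAbs + C

theorem Sub.of_le {u w : ℤ → ℕ} (h : Sub w) {a b : ℕ} (hu : ∀ k, u k ≤ a * w k + b) : Sub u := by
  intro M
  obtain ⟨C, hC⟩ := h (M * a)
  refine ⟨C + M * b, fun k => ?_⟩
  calc M * u k ≤ M * (a * w k + b) := Nat.mul_le_mul_left _ (hu k)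
    _ = M * a * w k + M * b := by ring
    _ ≤ _ := by have := hC k; omega

theorem Sub.add {u w : ℤ → ℕ} (hu : Sub u) (hw : Sub w) : Sub fun k => u k + w k := by
  intro M
  obtain ⟨C, hC⟩ := hu (2 * M)
  obtain ⟨C', hC'⟩ := hw (2 * M)
  refine ⟨C + C', fun k => ?_⟩
  have h1 := hC k
  have h2 := hC' k
  rw [mul_assoc] at h1 h2
  rw [mul_add]
  omega

theorem Sub.comp {u : ℤ → ℕ} (hu : Sub u) {i : ℤ → ℤ} {a b : ℕ}
    (hi : ∀ k, (i k).natAbs ≤ a * k.natAbs + b) : Sub fun k => u (i k) := by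
  intro M
  obtain ⟨C, hC⟩ := hu ((a + 1) * M)
  refine ⟨b + C, fun k => ?_⟩
  have h1 := hC (i k)
  have h2 := hi k
  refine Nat.le_of_mul_le_mul_left (?_ : (a + 1) * _ ≤ (a + 1) * _) (Nat.succ_pos a)
  rw [← mul_assoc]
  refine h1.trans ?_
  rw [add_mul a 1, mul_add a, one_mul]
  omega

theorem not_sub_of_le {u : ℤ → ℕ} {a b : ℕ} (h : ∀ k, k.natAbs ≤ a * u k + b) : ¬ Sub u := by
  intro hu
  obtain ⟨C, hC⟩ := hu (2 * a)
  have h1 := h (2 * b + C + 1 : ℕ)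
  have h2 := hC (2 * b + C + 1 : ℕ)
  rw [mul_assoc] at h2
  simp only [Int.natAbs_natCast] at h1 h2
  omega

end Sublinear

section Directions

variable {V : Type*} {Γ : SimpleGraph V}

/-- Only the exponent sum of `y` grows linearly along `φ`. -/
def Dir (φ : ℤ → RAAG Γ) (y : V) : Prop := ∀ v, (Sub fun k => (ab v (φ k)).natAbs) ↔ v ≠ y

theorem Dir.unique {φ : ℤ → RAAG Γ} {y y' : V} (h : Dir φ y) (h' : Dir φ y') : y = y' := by
  have h1 := h y
  rw [h' y] at h1
  simpa using h1

theorem natAbs_ab_le (v : V) (g : RAAG Γ) : (ab v g).natAbs ≤ len g := by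
  have := abs_le.1 (abs_ab_le v g)
  omega

theorem natAbs_ab_le_add (v : V) (g h : RAAG Γ) : (ab v g).natAbs ≤ (ab v h).natAbs + dd g h := by
  have := abs_le.1 (abs_ab_sub_le v g h)
  omega

theorem Sub.ab_congr {φ φ' : ℤ → RAAG Γ} (h : Sub fun k => dd (φ k) (φ' k)) (v : V) :
    (Sub fun k => (ab v (φ k)).natAbs) ↔ Sub fun k => (ab v (φ' k)).natAbs := by
  constructor
  · intro h1
    refine (h1.add h).of_le (a := 1) (b := 0) fun k => ?_
    have := natAbs_ab_le_add v (φ' k) (φ k)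
    rw [dd_comm] at this
    omega
  · intro h1
    refine (h1.add h).of_le (a := 1) (b := 0) fun k => ?_
    have := natAbs_ab_le_add v (φ k) (φ' k)
    omega

theorem Dir.congr {φ φ' : ℤ → RAAG Γ} {y : V} (h : Dir φ y)
    (h' : Sub fun k => dd (φ k) (φ' k)) : Dir φ' y := fun v => (h'.ab_congr v).symm.trans (h v)

theorem sub_const (b : ℕ) : Sub fun _ => b :=
  fun M => ⟨M * b, fun _ => Nat.le_add_left _ _⟩

theorem sub_of_le {u : ℤ → ℕ} {b : ℕ} (h : ∀ k, u k ≤ b) : Sub u :=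
  (sub_const b).of_le (a := 1) (b := 0) fun k => by have := h k; omega

theorem Track.growth {φ : ℤ → RAAG Γ} {p : RAAG Γ} {y : V} (h : Track φ p y) {K : ℕ}
    (hφ : ∀ k, k.natAbs ≤ K * dd (φ 0) (φ k) + K) :
    ∃ C, ∀ k, k.natAbs ≤ 2 * K * (ab y (p⁻¹ * φ k)).natAbs + C := by
  obtain ⟨C, hC⟩ := h (2 * K)
  refine ⟨2 * (K * dd (φ 0) p) + 2 * K + C, fun k => ?_⟩
  have h1 := hC k
  have h2 := hφ k
  obtain ⟨q, hq⟩ : ∃ q : RAAG Γ, q = p * (PresentedGroup.of y) ^ (ab y (p⁻¹ * φ k)) := ⟨_, rfl⟩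
  rw [← hq] at h1
  have h3 := dd_triangle (φ 0) p (φ k)
  have h4 := dd_triangle p q (φ k)
  have h5 : dd p q = (ab y (p⁻¹ * φ k)).natAbs := by rw [hq, dd_mul_right_self, len_of_zpow]
  rw [dd_comm q] at h4
  rw [h5] at h4
  have h6 : K * dd (φ 0) (φ k) ≤
      K * (dd (φ 0) p + ((ab y (p⁻¹ * φ k)).natAbs + dd (φ k) q)) :=
    Nat.mul_le_mul_left _ (by omega)
  rw [mul_add, mul_add] at h6
  rw [mul_assoc] at h1 ⊢
  omega

theorem Track.dir {φ : ℤ → RAAG Γ} {p : RAAG Γ} {y : V} (h : Track φ p y) {K : ℕ}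
    (hφ : ∀ k, k.natAbs ≤ K * dd (φ 0) (φ k) + K) : Dir φ y := by
  intro v
  constructor
  · rintro h1 rfl
    obtain ⟨C, hC⟩ := h.growth hφ
    refine not_sub_of_le (a := 2 * K) (b := 2 * K * (ab v p).natAbs + C) (fun k => ?_) h1
    refine (hC k).trans ?_
    rw [← add_assoc, ← mul_add, ab_mul, ab_inv]
    exact Nat.add_le_add_right (Nat.mul_le_mul_left _ (by omega)) _
  · intro hv
    refine (Sub.ab_congr h v).2 ?_
    refine sub_of_le (b := (ab v p).natAbs) fun k => ?_
    rw [ab_mul, ab_zpow, ab_of_ne hv.symm]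
    simp

theorem Track.sameStar {φ : ℤ → RAAG Γ} {p p' : RAAG Γ} {y : V} (h : Track φ p y)
    (hp : p⁻¹ * p' ∈ sp Γ (st Γ y)) : Track φ p' y := by
  refine Sub.of_le (a := 1) (b := len (ret Γ (lk Γ y) (p⁻¹ * p'))) h fun k => ?_
  have h1 := dd_triangle (φ k) (p * (PresentedGroup.of y) ^ (ab y (p⁻¹ * φ k)))
    (p' * (PresentedGroup.of y) ^ (ab y (p'⁻¹ * φ k)))
  have h2 : p' * (PresentedGroup.of y) ^ (ab y (p'⁻¹ * φ k)) =
      p * (PresentedGroup.of y) ^ (ab y (p⁻¹ * φ k)) * ret Γ (lk Γ y) (p⁻¹ * p') := by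
    rw [mul_assoc, of_zpow_comm (ret_mem_sp _ _)]
    rw [show p' * (PresentedGroup.of y) ^ (ab y (p'⁻¹ * φ k)) =
      p * ((p⁻¹ * p') * (PresentedGroup.of y) ^ (ab y (p'⁻¹ * φ k))) by group]
    conv_lhs => rw [eq_ret_mul_zpow hp]
    rw [mul_assoc, ← zpow_add]
    congr 4
    simp only [ab_mul, ab_inv]
    ring
  have h3 : dd (p * (PresentedGroup.of y) ^ (ab y (p⁻¹ * φ k)))
      (p' * (PresentedGroup.of y) ^ (ab y (p'⁻¹ * φ k))) = len (ret Γ (lk Γ y) (p⁻¹ * p')) := by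
    rw [h2, dd_mul_right_self]
  omega

theorem tendsto_or_tendsto_neg {α : ℕ → ℤ} {J : ℕ} (hJ : ∀ k, |α (k + 1) - α k| ≤ J)
    {a C : ℕ} (hC : ∀ k, k ≤ a * (α k).natAbs + C) :
    Filter.Tendsto α .atTop .atTop ∨ Filter.Tendsto (fun k => -α k) .atTop .atTop := by
  have hbig : ∀ B : ℕ, ∀ k ≥ a * B + C + 1, B < (α k).natAbs := by
    intro B k hk
    by_contra! h
    have := hC k
    have := Nat.mul_le_mul_left a h
    omega
  obtain ⟨k₀, hk₀⟩ : ∃ k₀, k₀ = a * J + C + 1 := ⟨_, rfl⟩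
  rcases le_total 0 (α k₀) with h0 | h0
  · left
    have hpos : ∀ k ≥ k₀, 0 ≤ α k := by
      intro k hk
      induction k, hk using Nat.le_induction with
      | base => exact h0
      | succ k hk ih =>
        have h1 := hbig J k (by omega)
        have h2 := abs_le.1 (hJ k)
        omega
    rw [Filter.tendsto_atTop]
    intro b
    filter_upwards [Filter.eventually_ge_atTop (max k₀ (a * b.natAbs + C + 1))] with k hk
    have h1 := hpos k (le_of_max_le_left hk)
    have h2 := hbig b.natAbs k (le_of_max_le_right hk)
    omega
  · right
    have hpos : ∀ k ≥ k₀, α k ≤ 0 := by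
      intro k hk
      induction k, hk using Nat.le_induction with
      | base => exact h0
      | succ k hk ih =>
        have h1 := hbig J k (by omega)
        have h2 := abs_le.1 (hJ k)
        omega
    rw [Filter.tendsto_atTop]
    intro b
    filter_upwards [Filter.eventually_ge_atTop (max k₀ (a * b.natAbs + C + 1))] with k hk
    have h1 := hpos k (le_of_max_le_left hk)
    have h2 := hbig b.natAbs k (le_of_max_le_right hk)
    omega

theorem exists_near_value {α : ℕ → ℤ} {J : ℕ} (hJ : ∀ k, |α (k + 1) - α k| ≤ J)
    (h : Filter.Tendsto α .atTop .atTop) {t : ℤ} (ht : α 0 ≤ t) : ∃ k, |t - α k| ≤ J := by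
  obtain ⟨n, hn⟩ := (h.eventually_gt_atTop t).exists
  obtain ⟨i, hi1, -, hi, hlt⟩ := exists_first_exit (p := fun i => α i ≤ t) ht (not_le.2 hn)
  refine ⟨i - 1, ?_⟩
  have h1 := hlt (i - 1) (by omega)
  have h2 := abs_le.1 (hJ (i - 1))
  rw [Nat.sub_add_cancel hi1] at h2
  rw [abs_le]
  omega

/-- Two diverging rays do not follow the same direction of a line. -/
theorem not_both_tendsto {r r' : ℕ → RAAG Γ} {W : Type*} {Δ : SimpleGraph W} {K : ℕ}
    {f : RAAG Γ → RAAG Δ} (hf : QI K f) (hr : ∀ k l, k + l ≤ 2 * dd (r k) (r' l))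
    {p : RAAG Δ} {y : W} {α α' : ℕ → ℤ} {J : ℕ}
    (hJ : ∀ k, |α' (k + 1) - α' k| ≤ J)
    {C : ℕ} (h : ∀ k, 4 * K * dd (f (r k)) (p * (PresentedGroup.of y) ^ (α k)) ≤ k + C)
    (h' : ∀ k, 4 * K * dd (f (r' k)) (p * (PresentedGroup.of y) ^ (α' k)) ≤ k + C) {ε : ℤ}
    (hε : |ε| = 1)
    (hα : Filter.Tendsto (fun k => ε * α k) .atTop .atTop)
    (hα' : Filter.Tendsto (fun k => ε * α' k) .atTop .atTop) : False := by
  obtain ⟨k, hk1, hk2⟩ := ((hα.eventually_ge_atTop (ε * α' 0)).and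
    (Filter.eventually_gt_atTop (2 * C + 4 * (K * J) + 4 * K))).exists
  have hJ' : ∀ k, |ε * α' (k + 1) - ε * α' k| ≤ J := fun k => by
    rw [← mul_sub, abs_mul, hε, one_mul]; exact hJ k
  obtain ⟨l, hl⟩ := exists_near_value hJ' hα' hk1
  rw [← mul_sub, abs_mul, hε, one_mul] at hl
  have h1 := h k
  have h2 := h' l
  have h3 := hr k l
  have h4 := (hf (r k) (r' l)).2
  obtain ⟨a, ha⟩ : ∃ a : RAAG Δ, a = p * (PresentedGroup.of y) ^ (α k) := ⟨_, rfl⟩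
  obtain ⟨b, hb⟩ : ∃ b : RAAG Δ, b = p * (PresentedGroup.of y) ^ (α' l) := ⟨_, rfl⟩
  have h5 : dd a b ≤ J := by
    rw [ha, hb, dd_mul_left, dd, ← zpow_neg, ← zpow_add, len_of_zpow]
    have := abs_le.1 hl
    omega
  rw [← ha] at h1
  rw [← hb] at h2
  have h6 := dd_triangle (f (r k)) a (f (r' l))
  have h7 := dd_triangle a b (f (r' l))
  rw [dd_comm b] at h7
  have h8 : K * dd (f (r k)) (f (r' l)) ≤ K * (dd (f (r k)) a + (J + dd (f (r' l)) b)) :=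
    Nat.mul_le_mul_left _ (by omega)
  rw [mul_add, mul_add] at h8
  rw [mul_assoc] at h1 h2
  omega

theorem not_mem_halfspace {a e : RAAG Γ} {v : V} {B : ℕ} (h : dd a e ≤ B) :
    ¬ InH (v, true) ((a * (PresentedGroup.of v) ^ (B : ℤ))⁻¹ * e) := by
  intro hi
  have h0 : ¬ InH (v, true) ((a * (PresentedGroup.of v) ^ (B : ℤ))⁻¹ * a) := by
    intro h1
    have h2 := len_inv_lt_mul h1
    rw [lt_true, mul_inv_rev, mul_assoc, inv_mul_cancel, mul_one, ← zpow_neg, ← zpow_neg_one,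
      ← zpow_add, len_of_zpow, len_of_zpow] at h2
    omega
  obtain ⟨z, hz, hd⟩ := crossing h0 hi
  have h1 := ab_of_mem_sp (not_mem_lk _) hz
  simp only [mul_inv_rev, ab_mul, ab_inv, ab_zpow, ab_of_self, mul_one] at h1
  have h2 := abs_le.1 (abs_ab_sub_le v a z)
  omega

theorem mem_halfspace {a e : RAAG Γ} {v : V} {B B' N : ℕ}
    (h : dd (a * (PresentedGroup.of v) ^ (N : ℤ)) e ≤ B') (hN : B + B' < N) :
    InH (v, true) ((a * (PresentedGroup.of v) ^ (B : ℤ))⁻¹ * e) := by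
  by_contra hi
  have h0 : InH (v, true) ((a * (PresentedGroup.of v) ^ (B : ℤ))⁻¹ *
      (a * (PresentedGroup.of v) ^ (N : ℤ))) := by
    rw [inH_iff, lt_true, mul_inv_rev, mul_assoc, inv_mul_cancel_left, ← zpow_neg, ← zpow_neg_one,
      ← zpow_add, ← zpow_add, len_of_zpow, len_of_zpow]
    omega
  obtain ⟨z, hz, hd⟩ := crossing hi h0
  have h1 := ab_of_mem_sp (not_mem_lk _) hz
  simp only [mul_inv_rev, ab_mul, ab_inv, ab_zpow, ab_of_self, mul_one] at h1
  have h2 := abs_le.1 (abs_ab_sub_le v (z * lt Γ (v, true)) (a * (PresentedGroup.of v) ^ (N : ℤ)))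
  rw [lt_true] at h2 hd
  rw [dd_comm _ e] at h
  simp only [ab_mul, ab_zpow, ab_of_self, mul_one] at h2
  omega

theorem lt_mem_sp_iff {L : Set V} {s : V × Bool} : lt Γ s ∈ sp Γ L ↔ s.1 ∈ L := by
  refine ⟨fun h => ?_, lt_mem_sp⟩
  by_contra hs
  have := ab_of_mem_sp hs h
  rcases s with ⟨v, _ | _⟩ <;> simp [lt] at this

/-- A wall separating two points of a convex subset meets it. -/
theorem wall_in_sp {L : Set V} {s : V × Bool} {g a b : RAAG Γ} (hab : a⁻¹ * b ∈ sp Γ L)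
    (ha : ¬ InH s (g⁻¹ * a)) (hb : InH s (g⁻¹ * b)) :
    s.1 ∈ L ∧ ∃ z, a⁻¹ * z ∈ sp Γ L ∧ g⁻¹ * z ∈ sp Γ (lk Γ s.1) := by
  obtain ⟨z, hz, hd⟩ := crossing ha hb
  have h1 : a⁻¹ * b = (a⁻¹ * z * lt Γ s) * ((z * lt Γ s)⁻¹ * b) := by group
  have h2 := len_mul (a⁻¹ * z * lt Γ s) ((z * lt Γ s)⁻¹ * b)
  have h3 := len_mul (a⁻¹ * z) (lt Γ s)
  rw [← h1] at h2
  rw [len_lt] at h3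
  simp only [dd] at hd
  obtain ⟨h4, -⟩ := mem_sp_of_prefix (by rw [← h1]; omega) (h1 ▸ hab)
  obtain ⟨h5, h6⟩ := mem_sp_of_prefix (by rw [len_lt]; omega) h4
  exact ⟨lt_mem_sp_iff.1 h6, z, h5, hz⟩

theorem star_crossing {P : RAAG Γ × V} {a e e' : RAAG Γ} {v : V} {B B' N : ℕ} (he : OnStar P e)
    (he' : OnStar P e') (h : dd a e ≤ B)
    (h' : dd (a * (PresentedGroup.of v) ^ (N : ℤ)) e' ≤ B') (hN : B + B' < N) :
    v ∈ st Γ P.2 ∧ ∃ z, OnStar P z ∧ a⁻¹ * z ∈ sp Γ (st Γ v) := by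
  have h1 : e⁻¹ * e' ∈ sp Γ (st Γ P.2) := by
    have := mul_mem (inv_mem he) he'
    simpa [mul_assoc] using this
  obtain ⟨hv, z, hz, hz'⟩ := wall_in_sp h1 (not_mem_halfspace h) (mem_halfspace h' hN)
  refine ⟨hv, z, ?_, ?_⟩
  · have := mul_mem he hz
    rw [mul_assoc, mul_inv_cancel_left] at this
    exact this
  · have := mul_mem (zpow_mem_sp (Γ := Γ) (Set.mem_insert v _) (B : ℤ))
      (sp_mono (Set.subset_insert _ _) hz' : _ ∈ sp Γ (st Γ v))
    rw [mul_inv_rev, mul_assoc, mul_inv_cancel_left] at this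
    exact this

end Directions

section StarImages

variable {V W : Type*} {Γ : SimpleGraph V} {Δ : SimpleGraph W}

/-- The star coset `P` carries the image of the star coset of `x` at `g`. -/
structure StarImage (f : RAAG Γ → RAAG Δ) (g : RAAG Γ) (x : V) (P : RAAG Δ × W) : Prop where
  near : ∃ C, ∀ q, g⁻¹ * q ∈ sp Γ (st Γ x) → Near C P (f q)
  track : Track (fun k => f (g * (PresentedGroup.of x) ^ k)) P.1 P.2

theorem exists_starImage [Fintype V] [Fintype W] (hX : Corners Γ) (hY : Corners Δ) {K : ℕ}
    {f : RAAG Γ → RAAG Δ} (hf : QI K f) (g : RAAG Γ) (x : V) : ∃ P, StarImage f g x P := by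
  obtain ⟨p, y, h1, h2⟩ := exists_track hX hY hf g x
  exact ⟨(p, y), h1, h2⟩

variable {K : ℕ} {f : RAAG Γ → RAAG Δ}

theorem QI.line_growth (hf : QI K f) (g : RAAG Γ) (x : V) (k : ℤ) :
    k.natAbs ≤ K * dd (f (g * (PresentedGroup.of x) ^ (0 : ℤ)))
      (f (g * (PresentedGroup.of x) ^ k)) + K := by
  have h := (hf g (g * (PresentedGroup.of x) ^ k)).2
  rw [dd_mul_right_self, len_of_zpow] at h
  rwa [zpow_zero, mul_one]

theorem StarImage.dir {g : RAAG Γ} {x : V} {P : RAAG Δ × W} (hf : QI K f)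
    (h : StarImage f g x P) : Dir (fun k => f (g * (PresentedGroup.of x) ^ k)) P.2 :=
  h.track.dir (hf.line_growth g x)

theorem Track.ray (hf : QI K f) {g : RAAG Γ} {x : V} {p : RAAG Δ} {y : W}
    (h : Track (fun k => f (g * (PresentedGroup.of x) ^ k)) p y) {η : ℤ} (hη : |η| = 1) :
    ∃ (r : ℕ → RAAG Γ) (α : ℕ → ℤ) (C : ℕ), (∀ k, r k = g * (PresentedGroup.of x) ^ (η * k)) ∧
      (∀ k, |α (k + 1) - α k| ≤ (2 * K : ℕ)) ∧
      (∀ k, 4 * K * dd (f (r k)) (p * (PresentedGroup.of y) ^ (α k)) ≤ k + C) ∧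
      ∃ ε : ℤ, (ε = 1 ∨ ε = -1) ∧ Filter.Tendsto (fun k => ε * α k) .atTop .atTop := by
  obtain ⟨C, hC⟩ := h (4 * K)
  obtain ⟨C', hC'⟩ := h.growth (hf.line_growth g x)
  have hη' : η = 1 ∨ η = -1 := (abs_eq zero_le_one).1 hη
  have hnat : ∀ k : ℕ, (η * k).natAbs = k := by rcases hη' with rfl | rfl <;> simp
  obtain ⟨α, hα⟩ : ∃ α : ℕ → ℤ, ∀ k, α k =
    ab y (p⁻¹ * f (g * (PresentedGroup.of x) ^ (η * (k : ℤ)))) := ⟨_, fun k => rfl⟩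
  have hJ : ∀ k : ℕ, |α (k + 1) - α k| ≤ (2 * K : ℕ) := by
    intro k
    rw [hα, hα]
    have h1 := abs_ab_sub_le y (p⁻¹ * f (g * (PresentedGroup.of x) ^ (η * ((k + 1 : ℕ) : ℤ))))
      (p⁻¹ * f (g * (PresentedGroup.of x) ^ (η * (k : ℤ))))
    have h2 := (hf (g * (PresentedGroup.of x) ^ (η * ((k + 1 : ℕ) : ℤ)))
      (g * (PresentedGroup.of x) ^ (η * (k : ℤ)))).1
    rw [dd_mul_left] at h1
    have h3 : dd (g * (PresentedGroup.of x) ^ (η * ((k + 1 : ℕ) : ℤ)))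
        (g * (PresentedGroup.of x) ^ (η * (k : ℤ))) = 1 := by
      rw [dd_mul_left, dd, ← zpow_neg, ← zpow_add, len_of_zpow]
      rcases hη' with rfl | rfl <;> push_cast <;> omega
    rw [h3] at h2
    refine h1.trans ?_
    exact_mod_cast (by omega)
  refine ⟨fun k => g * (PresentedGroup.of x) ^ (η * k), α, C, fun k => rfl, hJ, fun k => ?_, ?_⟩
  · have := hC (η * k)
    rw [hnat] at this
    rw [hα]
    exact this
  · have hg : ∀ k : ℕ, k ≤ 2 * K * (α k).natAbs + C' := by
      intro k
      have := hC' (η * k)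
      rw [hnat] at this
      rw [hα]
      exact this
    rcases tendsto_or_tendsto_neg hJ hg with h1 | h1
    · exact ⟨1, Or.inl rfl, by simpa using h1⟩
    · exact ⟨-1, Or.inr rfl, by simpa using h1⟩

theorem dd_line_line {g : RAAG Γ} {x x' : V} (h : x ≠ x') (k l : ℤ) :
    k.natAbs + l.natAbs ≤
      2 * dd (g * (PresentedGroup.of x) ^ k) (g * (PresentedGroup.of x') ^ l) := by
  rw [dd_mul_left]
  have h1 := abs_le.1 (abs_ab_sub_le x ((PresentedGroup.of x : RAAG Γ) ^ k)
    ((PresentedGroup.of x') ^ l))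
  have h2 := abs_le.1 (abs_ab_sub_le x' ((PresentedGroup.of x : RAAG Γ) ^ k)
    ((PresentedGroup.of x') ^ l))
  simp only [ab_zpow, ab_of_self, ab_of_ne h, ab_of_ne h.symm] at h1 h2
  omega

/-- Distinct star cosets through `g` have distinct images. -/
theorem StarImage.not_sameStar (hf : QI K f) {g : RAAG Γ} {x x' : V} (hx : x ≠ x')
    {P P' : RAAG Δ × W} (h : StarImage f g x P) (h' : StarImage f g x' P') : ¬ SameStar P P' := by
  intro hs
  have ht : Track (fun k => f (g * (PresentedGroup.of x') ^ k)) P.1 P.2 := by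
    have h1 := h'.track
    have h2 := hs.symm.2
    rw [← hs.1] at h1 h2
    exact h1.sameStar h2
  obtain ⟨r₁, α₁, C₁, hr₁, hJ₁, hd₁, ε₁, hε₁, ht₁⟩ := h.track.ray hf (η := 1) (by norm_num)
  obtain ⟨r₂, α₂, C₂, hr₂, hJ₂, hd₂, ε₂, hε₂, ht₂⟩ := h.track.ray hf (η := -1) (by norm_num)
  obtain ⟨r₃, α₃, C₃, hr₃, hJ₃, hd₃, ε₃, hε₃, ht₃⟩ := ht.ray hf (η := 1) (by norm_num)
  have h12 : ε₁ ≠ ε₂ := by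
    rintro rfl
    refine not_both_tendsto hf (r := r₁) (r' := r₂) (fun k l => ?_) hJ₂ (C := C₁ + C₂)
      (fun k => (hd₁ k).trans (by omega)) (fun k => (hd₂ k).trans (by omega))
      (by rcases hε₁ with h | h <;> simp [h]) ht₁ ht₂
    rw [hr₁, hr₂, dd_mul_left, dd, ← zpow_neg, ← zpow_add, len_of_zpow]
    omega
  have h13 : ε₁ ≠ ε₃ := by
    rintro rfl
    refine not_both_tendsto hf (r := r₁) (r' := r₃) (fun k l => ?_) hJ₃ (C := C₁ + C₃)
      (fun k => (hd₁ k).trans (by omega)) (fun k => (hd₃ k).trans (by omega))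
      (by rcases hε₁ with h | h <;> simp [h]) ht₁ ht₃
    rw [hr₁, hr₃]
    have := dd_line_line (g := g) hx (1 * k) (1 * l)
    omega
  have h23 : ε₂ ≠ ε₃ := by
    rintro rfl
    refine not_both_tendsto hf (r := r₂) (r' := r₃) (fun k l => ?_) hJ₃ (C := C₂ + C₃)
      (fun k => (hd₂ k).trans (by omega)) (fun k => (hd₃ k).trans (by omega))
      (by rcases hε₂ with h | h <;> simp [h]) ht₂ ht₃
    rw [hr₂, hr₃]
    have := dd_line_line (g := g) hx (-1 * k) (1 * l)
    omega
  omega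

/-- Adjacent star cosets have intersecting images with adjacent labels. -/
theorem StarImage.adj (hf : QI K f) {g : RAAG Γ} {x x' : V} (hx : Γ.Adj x x')
    {P P' : RAAG Δ × W} (h : StarImage f g x P) (h' : StarImage f g x' P') :
    Δ.Adj P.2 P'.2 ∧ ∃ z, OnStar P z ∧ OnStar P' z := by
  obtain ⟨C, hC⟩ := h.near
  have hmem : ∀ k : ℤ, g⁻¹ * (g * (PresentedGroup.of x') ^ k) ∈ sp Γ (st Γ x) := fun k => by
    rw [inv_mul_cancel_left]
    exact zpow_mem_sp (Set.mem_insert_of_mem _ hx) k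
  obtain ⟨C₁, hC₁⟩ := h'.track.growth (hf.line_growth g x')
  obtain ⟨C₂, hC₂⟩ := h'.track (8 * K + 4)
  obtain ⟨⟨p, y⟩, hP'⟩ : ∃ P'', P'' = P' := ⟨_, rfl⟩
  subst hP'
  simp only at hC₁ hC₂ ⊢
  obtain ⟨e, he, hde⟩ := hC _ (hmem 0)
  rw [zpow_zero, mul_one] at hde
  obtain ⟨B, hB⟩ : ∃ B, B = dd p e := ⟨_, rfl⟩
  obtain ⟨k, hk⟩ : ∃ k : ℤ, k = ((2 * C₁ + C₂ + (8 * K + 4) * (C + B + 1) : ℕ) : ℤ) := ⟨_, rfl⟩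
  have h1 := hC₁ k
  have h2 := hC₂ k
  obtain ⟨e', he', hde'⟩ := hC _ (hmem k)
  obtain ⟨i, hi⟩ : ∃ i, i = ab y (p⁻¹ * f (g * (PresentedGroup.of x') ^ k)) := ⟨_, rfl⟩
  rw [← hi] at h1 h2
  have hk' : k.natAbs = 2 * C₁ + C₂ + (8 * K + 4) * (C + B + 1) := by rw [hk]; rfl
  obtain ⟨d, hd⟩ : ∃ d, d = dd (f (g * (PresentedGroup.of x') ^ k))
    (p * (PresentedGroup.of y) ^ i) := ⟨_, rfl⟩
  rw [← hd] at h2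
  have h3 : dd (p * (PresentedGroup.of y) ^ i) e' ≤ d + C := by
    have := dd_triangle (p * (PresentedGroup.of y) ^ i) (f (g * (PresentedGroup.of x') ^ k)) e'
    rw [dd_comm _ (f (g * (PresentedGroup.of x') ^ k)), ← hd] at this
    omega
  have h4 : B + (d + C) < i.natAbs := by
    by_contra! hcon
    have h5 : 2 * K * i.natAbs ≤ 2 * K * (B + (d + C)) := Nat.mul_le_mul_left _ hcon
    have h6 : 2 * K * (B + (d + C)) = 2 * (K * (C + B)) + 2 * (K * d) := by ring
    have h7 : (8 * K + 4) * d = 8 * (K * d) + 4 * d := by ring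
    have h8 : (8 * K + 4) * (C + B + 1) = 8 * (K * (C + B)) + 8 * K + 4 * (C + B) + 4 := by ring
    omega
  have hfin : y ∈ st Δ P.2 ∧ ∃ z, OnStar P z ∧ p⁻¹ * z ∈ sp Δ (st Δ y) := by
    rcases Int.natAbs_eq i with hi' | hi'
    · refine star_crossing he he' hB.ge (N := i.natAbs) ?_ h4
      rwa [← hi']
    · obtain ⟨hv, z, hz, hz'⟩ := star_crossing (a := p * (PresentedGroup.of y) ^ i) he' he h3
        (v := y) (B' := B) (N := i.natAbs) (by
          rw [mul_assoc, ← zpow_add, hi', Int.natAbs_neg, Int.natAbs_natCast, neg_add_cancel,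
            zpow_zero, mul_one, hB]) (by omega)
      refine ⟨hv, z, hz, ?_⟩
      have := mul_mem (zpow_mem_sp (Γ := Δ) (Set.mem_insert y _) i) hz'
      rw [mul_inv_rev, mul_assoc, mul_inv_cancel_left] at this
      exact this
  obtain ⟨hv, z, hz, hz'⟩ := hfin
  refine ⟨?_, z, hz, hz'⟩
  rcases hv with hv | hv
  · refine absurd ?_ (h.not_sameStar hf hx.ne h')
    refine ⟨hv.symm, ?_⟩
    rw [hv] at hz'
    have := mul_mem hz (inv_mem hz')
    rw [mul_inv_rev, mul_assoc, mul_inv_cancel_left, inv_inv] at this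
    exact this
  · exact hv

end StarImages

section Cycle

variable {n : ℕ}

theorem natCast_ne_zero {c : ℕ} (h0 : 0 < c) (hc : c < n) : (c : ZMod n) ≠ 0 := by
  rw [Ne, ZMod.natCast_eq_zero_iff]
  exact fun h => absurd (Nat.le_of_dvd h0 h) (by omega)

theorem intCast_ne_zero {c : ℤ} (h0 : 0 < c) (hc : c < n) : (c : ZMod n) ≠ 0 := by
  rw [Ne, ZMod.intCast_zmod_eq_zero_iff_dvd]
  exact fun h => absurd (Int.le_of_dvd h0 h) (by omega)

theorem cycle_adj (hn : 2 ≤ n) {v w : ZMod n} :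
    (cycleGraph n).Adj v w ↔ w = v + 1 ∨ w = v - 1 := by
  have h1 := natCast_ne_zero (n := n) (c := 1) (by omega) (by omega)
  rw [cycleGraph, SimpleGraph.fromRel_adj]
  constructor
  · rintro ⟨-, h | h⟩
    · exact Or.inl h
    · exact Or.inr (by rw [h]; ring)
  · rintro (h | h)
    · refine ⟨fun h' => h1 ?_, Or.inl h⟩
      push_cast
      linear_combination -h - h'
    · refine ⟨fun h' => h1 ?_, Or.inr (by rw [h]; ring)⟩
      push_cast
      linear_combination h + h'

theorem mem_cycle_lk (hn : 2 ≤ n) {v w : ZMod n} :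
    w ∈ lk (cycleGraph n) v ↔ w = v + 1 ∨ w = v - 1 := cycle_adj hn

theorem mem_cycle_st (hn : 2 ≤ n) {v w : ZMod n} :
    w ∈ st (cycleGraph n) v ↔ w = v ∨ w = v + 1 ∨ w = v - 1 := by
  rw [st, Set.mem_insert_iff, mem_cycle_lk hn]

theorem corners_cycle (hn : 5 ≤ n) : Corners (cycleGraph n) := by
  intro y
  have h1 := natCast_ne_zero (n := n) (c := 1) (by omega) (by omega)
  have h2 := natCast_ne_zero (n := n) (c := 2) (by omega) (by omega)
  have h3 := natCast_ne_zero (n := n) (c := 3) (by omega) (by omega)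
  have h4 := natCast_ne_zero (n := n) (c := 4) (by omega) (by omega)
  push_cast at h1 h2 h3 h4
  refine ⟨y - 1, y + 1, ?_, fun h => h2 ?_, fun h => ?_, ?_⟩
  · ext w
    rw [mem_cycle_lk (by omega), Set.mem_insert_iff, Set.mem_singleton_iff, or_comm]
  · linear_combination -h
  · rw [cycle_adj (by omega)] at h
    rcases h with h | h
    · exact h1 (by linear_combination h)
    · exact h3 (by linear_combination h)
  · ext w
    rw [Set.mem_inter_iff, mem_cycle_lk (by omega), mem_cycle_lk (by omega),
      Set.mem_singleton_iff]
    constructor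
    · rintro ⟨h | h, h' | h'⟩
      · rw [h]; ring
      · rw [h]; ring
      · exact absurd (show (4 : ZMod n) = 0 by linear_combination h - h') h4
      · rw [h']; ring
    · rintro rfl
      exact ⟨Or.inl (by ring), Or.inr (by ring)⟩

theorem exists_wall_of_not_mem {V : Type*} {Γ : SimpleGraph V} {L : Set V} {u : V} {a b : RAAG Γ}
    (hab : a⁻¹ * b ∈ sp Γ L) (h : a⁻¹ * b ∉ sp Γ {u}ᶜ) :
    ∃ e s, s.1 = u ∧ a⁻¹ * e ∈ sp Γ L ∧ ¬ InH s (e⁻¹ * a) ∧ InH s (e⁻¹ * b) := by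
  obtain ⟨w, hw, hlen, hws⟩ := exists_word_sp hab
  have h1 : ∃ s ∈ w, s.1 = u := by
    by_contra! hc
    exact h (hw ▸ ev_mem_sp fun s hs => hc s hs)
  obtain ⟨s, hs, hsu⟩ := h1
  obtain ⟨w₁, w₂, rfl⟩ := List.append_of_mem hs
  rw [ev_append, ev_cons] at hw
  have h2 := len_ev_le (Γ := Γ) w₁
  have h3 := len_ev_le (Γ := Γ) w₂
  have h4 := len_mul (ev Γ w₁) (lt Γ s * ev Γ w₂)
  have h5 := len_mul (ev Γ w₁ * lt Γ s) (ev Γ w₂)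
  have h6 := len_mul (lt Γ s) (ev Γ w₂)
  rw [mul_assoc, hw] at h5
  rw [hw] at h4
  rw [len_lt] at h6
  simp only [List.length_append, List.length_cons] at hlen
  refine ⟨a * ev Γ w₁, s, hsu, ?_, fun hi => ?_, ?_⟩
  · rw [inv_mul_cancel_left]
    exact ev_mem_sp fun t ht => hws t (by simp [ht])
  · have h7 := len_inv_lt_mul hi
    rw [mul_inv_rev, mul_assoc, inv_mul_cancel, mul_one, ← mul_inv_rev, len_inv, len_inv] at h7
    omega
  · rw [mul_inv_rev, mul_assoc, ← hw, inv_mul_cancel_left, inH_iff, inv_mul_cancel_left]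
    omega

/-- A closed walk of star cosets with distinct entries makes no excursion to one side. -/
theorem no_excursion (hn : 7 ≤ n) {Q : ℕ → RAAG (cycleGraph n) × ZMod n} {Y : ℕ → ℤ}
    (hQn : Q n = Q 0) (hlab : ∀ t ≤ n, (Q t).2 = (Q 0).2 + (Y t : ZMod n))
    (hY : ∀ t ≤ n, Y t ≤ 0 ∧ -(n : ℤ) ≤ 2 * Y t) (h1 : Y 1 = -1) (h2 : Y (n - 1) = -1)
    (hD : ∀ s t, s < t → t < n → ¬ SameStar (Q s) (Q t))
    (hz : ∀ t < n, ∃ z, OnStar (Q t) z ∧ OnStar (Q (t + 1)) z) : False := by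
  obtain ⟨v, hv⟩ : ∃ v, v = (Q 0).2 := ⟨_, rfl⟩
  rw [← hv] at hlab
  choose! z hz1 hz2 using hz
  have hv1 : ∀ t ≤ n, v + 1 ∈ st (cycleGraph n) (Q t).2 → (Q t).2 = v := by
    intro t ht h
    have h3 := hY t ht
    rw [mem_cycle_st (by omega), hlab t ht] at h
    rcases h with h | h | h
    · refine absurd ?_ (intCast_ne_zero (n := n) (c := 1 - Y t) (by omega) (by omega))
      push_cast
      linear_combination h
    · rw [hlab t ht]
      linear_combination -h
    · refine absurd ?_ (intCast_ne_zero (n := n) (c := 2 - Y t) (by omega) (by omega))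
      push_cast
      linear_combination h
  have hv2 : ∀ t ≤ n, v + 2 ∉ st (cycleGraph n) (Q t).2 := by
    intro t ht h
    have h3 := hY t ht
    rw [mem_cycle_st (by omega), hlab t ht] at h
    rcases h with h | h | h
    · refine absurd ?_ (intCast_ne_zero (n := n) (c := 2 - Y t) (by omega) (by omega))
      push_cast
      linear_combination h
    · refine absurd ?_ (intCast_ne_zero (n := n) (c := 1 - Y t) (by omega) (by omega))
      push_cast
      linear_combination h
    · refine absurd ?_ (intCast_ne_zero (n := n) (c := 3 - Y t) (by omega) (by omega))
      push_cast
      linear_combination h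
  have hin : ∀ {P : RAAG (cycleGraph n) × ZMod n} {x y}, OnStar P x → OnStar P y →
      x⁻¹ * y ∈ sp (cycleGraph n) (st (cycleGraph n) P.2) := by
    intro P x y hx hy
    have := mul_mem (inv_mem hx) hy
    rw [mul_inv_rev, inv_inv, mul_assoc, mul_inv_cancel_left] at this
    exact this
  have hadd : ∀ {P : RAAG (cycleGraph n) × ZMod n} {x y}, OnStar P x →
      x⁻¹ * y ∈ sp (cycleGraph n) (st (cycleGraph n) P.2) → OnStar P y := by
    intro P x y hx hy
    have := mul_mem hx hy
    rw [mul_assoc, mul_inv_cancel_left] at this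
    exact this
  have hsame : ∀ {P P' : RAAG (cycleGraph n) × ZMod n} {x y}, P.2 = P'.2 → OnStar P x →
      OnStar P' y → x⁻¹ * y ∈ sp (cycleGraph n) (st (cycleGraph n) P.2) → SameStar P P' := by
    intro P P' x y hP hx hy hxy
    refine ⟨hP, hadd (hadd hx hxy) ?_⟩
    rw [hP]
    exact hin hy (onStar_self P')
  have ha1 := hz1 (n - 1) (by omega)
  have ha2 := hz2 (n - 1) (by omega)
  have hb1 := hz1 0 (by omega)
  have hb2 := hz2 0 (by omega)
  rw [Nat.sub_add_cancel (by omega), hQn] at ha2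
  have hab := hin ha2 hb1
  rw [← hv] at hab
  have hnot : (z (n - 1))⁻¹ * z 0 ∉ sp (cycleGraph n) {v + 1}ᶜ := by
    intro h
    have hlab1 : (Q (n - 1)).2 = v - 1 := by
      rw [hlab _ (by omega), h2]; push_cast; ring
    have hlab2 : (Q (0 + 1)).2 = v - 1 := by
      rw [hlab _ (by omega), h1]; push_cast; ring
    have h3 : SameStar (Q (n - 1)) (Q (0 + 1)) := by
      refine hsame (hlab1.trans hlab2.symm) ha1 hb2 (sp_mono ?_ (sp_inter hab h))
      rw [hlab1]
      rintro w ⟨hw, hw'⟩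
      rw [mem_cycle_st (by omega)] at hw ⊢
      rcases hw with hw | hw | hw
      · exact Or.inr (Or.inl (by rw [hw]; ring))
      · exact absurd hw hw'
      · exact Or.inl hw
    exact hD _ _ (by omega) (by omega) h3.symm
  obtain ⟨e, s, hs, he, hea, heb⟩ := exists_wall_of_not_mem hab hnot
  have heQ : OnStar (Q 0) e := hadd ha2 (hv ▸ he)
  obtain ⟨t, ht1, htn, ht, hlt⟩ := exists_first_exit
    (p := fun j => ¬ InH s (e⁻¹ * z (n - 1 - j))) (n := n - 1) hea (by simpa using heb)
  have h3 := hlt (t - 1) (by omega)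
  obtain ⟨k, hk⟩ : ∃ k, k = n - t := ⟨_, rfl⟩
  rw [show n - 1 - (t - 1) = k by omega] at h3
  rw [show n - 1 - t = k - 1 by omega, not_not] at ht
  have hk1 := hz1 k (by omega)
  have hk2 := hz2 (k - 1) (by omega)
  rw [Nat.sub_add_cancel (by omega)] at hk2
  obtain ⟨hsk, z', hz', hez'⟩ := wall_in_sp (hin hk1 hk2) h3 ht
  rw [hs] at hsk hez'
  have hkv := hv1 k (by omega) hsk
  have hz'Q : OnStar (Q k) z' := hadd hk1 hz'
  have hconn : ∀ k ≤ n, ∀ y, OnStar (Q k) y → e⁻¹ * y ∈ sp (cycleGraph n) {v + 2}ᶜ := by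
    have hsub : ∀ k ≤ n, st (cycleGraph n) (Q k).2 ⊆ {v + 2}ᶜ := by
      intro k hk w hw hw'
      rw [Set.mem_singleton_iff] at hw'
      exact hv2 k hk (hw' ▸ hw)
    intro k
    induction k with
    | zero => exact fun hk y hy => sp_mono (hsub 0 hk) (hin heQ hy)
    | succ k ih =>
      intro hk y hy
      have h4 := ih (by omega) (z k) (hz1 k (by omega))
      have h5 := mul_mem h4 (sp_mono (hsub _ hk) (hin (hz2 k (by omega)) hy))
      rwa [mul_assoc, mul_inv_cancel_left] at h5
  refine hD 0 k (by omega) (by omega) (hsame (by rw [hkv, hv]) heQ hz'Q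
    (sp_mono ?_ (sp_inter hez' (hconn k (by omega) z' hz'Q))))
  rintro w ⟨hw, hw'⟩
  rw [mem_cycle_lk (by omega)] at hw
  rcases hw with hw | hw
  · exact absurd (show w = v + 2 by rw [hw]; ring) hw'
  · rw [← hv, show w = v by rw [hw]; ring]
    exact Set.mem_insert _ _

end Cycle

section Labels

variable {n : ℕ}

theorem closed_walk (hn : 7 ≤ n) {P : ZMod n → RAAG (cycleGraph n) × ZMod n}
    (hD : ∀ i j, i ≠ j → ¬ SameStar (P i) (P j))
    (hA : ∀ i, (cycleGraph n).Adj (P i).2 (P (i + 1)).2 ∧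
      ∃ z, OnStar (P i) z ∧ OnStar (P (i + 1)) z) :
    (∀ i, (P (i + 1)).2 = (P i).2 + 1) ∨ ∀ i, (P (i + 1)).2 = (P i).2 - 1 := by
  have hstep : ∀ i, ∃ e : ℤ, (e = 1 ∨ e = -1) ∧ (P (i + 1)).2 = (P i).2 + (e : ZMod n) := by
    intro i
    rcases (cycle_adj (by omega)).1 (hA i).1 with h | h
    · exact ⟨1, Or.inl rfl, by rw [h]; simp⟩
    · exact ⟨-1, Or.inr rfl, by rw [h]; push_cast; ring⟩
  choose ε hε hP using hstep
  obtain ⟨S, hS⟩ : ∃ S : ℕ → ℤ, ∀ t, S t = ∑ j ∈ Finset.range t, ε (j : ZMod n) :=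
    ⟨_, fun t => rfl⟩
  have hSs : ∀ t, S (t + 1) = S t + ε (t : ZMod n) := fun t => by
    rw [hS, hS, Finset.sum_range_succ]
  have hS0 : S 0 = 0 := by rw [hS]; simp
  have hlab : ∀ t : ℕ, (P (t : ZMod n)).2 = (P 0).2 + (S t : ZMod n) := by
    intro t
    induction t with
    | zero => simp [hS0]
    | succ t ih => rw [Nat.cast_succ, hP, ih, hSs]; push_cast; ring
  have hlip : ∀ u t : ℕ, |S (u + t) - S u| ≤ t := by
    intro u t
    induction t with
    | zero => simp
    | succ t ih =>
      rw [← add_assoc, hSs, abs_le]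
      have := abs_le.1 ih
      have := hε ((u + t : ℕ) : ZMod n)
      omega
  have hper : ∀ t, S (t + n) = S t + S n := by
    intro t
    induction t with
    | zero => simp [hS0]
    | succ t ih =>
      rw [show t + 1 + n = t + n + 1 by omega, hSs, ih, hSs]
      push_cast
      rw [ZMod.natCast_self]
      simp only [add_zero]
      ring
  have hdvd : (n : ℤ) ∣ S n := by
    rw [← ZMod.intCast_zmod_eq_zero_iff_dvd]
    have := hlab n
    rw [ZMod.natCast_self] at this
    simpa using this.symm
  have hbd := abs_le.1 (hlip 0 n)
  rw [zero_add, hS0, sub_zero] at hbd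
  have : NeZero n := ⟨by omega⟩
  have hmem : ∀ i : ZMod n, i.val ∈ Finset.range n := fun i =>
    Finset.mem_range.2 (ZMod.val_lt i)
  have hcases : S n = n ∨ S n = -n ∨ S n = 0 := by
    obtain ⟨c, hc⟩ := hdvd
    have h1 : c ≤ 1 := by by_contra! h; nlinarith
    have h2 : -1 ≤ c := by by_contra! h; nlinarith
    obtain rfl | rfl | rfl : c = 1 ∨ c = 0 ∨ c = -1 := by omega
    · left; rw [hc]; ring
    · right; right; rw [hc]; ring
    · right; left; rw [hc]; ring
  rcases hcases with h | h | h
  · left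
    have h1 : ∑ j ∈ Finset.range n, (1 - ε (j : ZMod n)) = 0 := by
      rw [Finset.sum_sub_distrib, ← hS, h]; simp
    rw [Finset.sum_eq_zero_iff_of_nonneg
      (fun j _ => by have := hε (j : ZMod n); omega)] at h1
    intro i
    have h2 := h1 _ (hmem i)
    rw [ZMod.natCast_zmod_val] at h2
    rw [hP, show ε i = 1 by omega]
    simp
  · right
    have h1 : ∑ j ∈ Finset.range n, (1 + ε (j : ZMod n)) = 0 := by
      rw [Finset.sum_add_distrib, ← hS, h]; simp
    rw [Finset.sum_eq_zero_iff_of_nonneg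
      (fun j _ => by have := hε (j : ZMod n); omega)] at h1
    intro i
    have h2 := h1 _ (hmem i)
    rw [ZMod.natCast_zmod_val] at h2
    rw [hP, show ε i = -1 by omega]
    push_cast
    ring
  · exfalso
    simp only [h, add_zero] at hper
    obtain ⟨t₀, ht₀, hmax⟩ := Finset.exists_max_image (Finset.range n) S ⟨0, by simp; omega⟩
    rw [Finset.mem_range] at ht₀
    have hle : ∀ t ≤ n, S (t₀ + t) ≤ S t₀ := by
      intro t ht
      by_cases h1 : t₀ + t < n
      · exact hmax _ (Finset.mem_range.2 h1)
      · have h2 := hper (t₀ + t - n)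
        rw [Nat.sub_add_cancel (by omega)] at h2
        rw [h2]
        exact hmax _ (Finset.mem_range.2 (by omega))
    have hcast : ∀ t : ℕ, ((t + n : ℕ) : ZMod n) = t := fun t => by
      push_cast; rw [ZMod.natCast_self, add_zero]
    refine no_excursion hn (Q := fun t => P ((t₀ + t : ℕ) : ZMod n))
      (Y := fun t => S (t₀ + t) - S t₀) (by simp only [hcast, add_zero]) (fun t _ => ?_)
      (fun t ht => ⟨by have := hle t ht; omega, ?_⟩) ?_ ?_ (fun s t hst ht => ?_) (fun t _ => ?_)
    · simp only [hlab, add_zero]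
      push_cast
      ring
    · have h1 := abs_le.1 (hlip t₀ t)
      have h2 := abs_le.1 (hlip (t₀ + t) (n - t))
      rw [add_assoc, Nat.add_sub_cancel' ht, hper] at h2
      omega
    · have h1 := hle 1 (by omega)
      have h2 := hε (t₀ : ZMod n)
      simp only [hSs] at h1 ⊢
      omega
    · have h1 := hle (n - 1) (by omega)
      have h2 := hSs (t₀ + (n - 1))
      rw [add_assoc, Nat.sub_add_cancel (by omega), hper] at h2
      have h3 := hε ((t₀ + (n - 1) : ℕ) : ZMod n)
      omega
    · refine hD _ _ fun heq => ?_
      refine natCast_ne_zero (n := n) (c := t - s) (by omega) (by omega) ?_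
      rw [Nat.cast_sub hst.le]
      push_cast at heq
      linear_combination -heq
    · have h1 := (hA ((t₀ + t : ℕ) : ZMod n)).2
      rwa [← Nat.cast_succ] at h1

theorem progression_eq (hn : 3 ≤ n) {A B : ZMod n → ZMod n}
    (hA : (∀ i, A (i + 1) = A i + 1) ∨ ∀ i, A (i + 1) = A i - 1)
    (hB : (∀ i, B (i + 1) = B i + 1) ∨ ∀ i, B (i + 1) = B i - 1) {j : ZMod n}
    (h0 : A j = B j) (h1 : A (j + 1) = B (j + 1)) : A = B := by
  have h2 := natCast_ne_zero (n := n) (c := 2) (by omega) (by omega)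
  have : NeZero n := ⟨by omega⟩
  push_cast at h2
  have hs : ∀ i, A (i + 1) - A i = B (i + 1) - B i := by
    rcases hA with hA | hA <;> rcases hB with hB | hB
    · intro i; rw [hA, hB]; ring
    · rw [hA, hB, h0] at h1
      exact absurd (by linear_combination h1) h2
    · rw [hA, hB, h0] at h1
      exact absurd (by linear_combination -h1) h2
    · intro i; rw [hA, hB]; ring
  have hk : ∀ k : ℕ, A (j + k) = B (j + k) := by
    intro k
    induction k with
    | zero => simpa using h0
    | succ k ih =>
      have := hs (j + k)
      rw [ih, sub_left_inj] at this
      rw [Nat.cast_succ, ← add_assoc, this]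
  funext x
  have := hk (x - j).val
  rwa [ZMod.natCast_zmod_val, add_sub_cancel] at this

theorem lt_zpow_comm {V : Type*} {Γ : SimpleGraph V} {s : V × Bool} {x : V} (h : s.1 ∈ st Γ x)
    (k : ℤ) : lt Γ s * (PresentedGroup.of x) ^ k = (PresentedGroup.of x) ^ k * lt Γ s := by
  rcases h with h | h
  · obtain ⟨v, b⟩ := s
    simp only at h
    subst h
    rcases b with _ | _
    · rw [lt_false, ← zpow_neg_one, ← zpow_add, ← zpow_add, add_comm]
    · rw [lt_true, ← zpow_one_add, ← zpow_add_one, add_comm]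
  · exact (of_zpow_comm (lt_mem_sp h) k).symm

/-- A quasiisometric embedding of the group of a cycle into itself acts on labels of
standard lines independently of the base point. -/
theorem exists_label (hn : 7 ≤ n) {K : ℕ} {f : RAAG (cycleGraph n) → RAAG (cycleGraph n)}
    (hf : QI K f) : ∃ ℓ : ZMod n → ZMod n, ∀ g x, ∃ P, StarImage f g x P ∧ P.2 = ℓ x := by
  have : NeZero n := ⟨by omega⟩
  have hc := corners_cycle (n := n) (by omega)
  choose P hP using fun g x => exists_starImage hc hc hf g x
  have hprog : ∀ g, (∀ i, (P g (i + 1)).2 = (P g i).2 + 1) ∨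
      ∀ i, (P g (i + 1)).2 = (P g i).2 - 1 := fun g =>
    closed_walk hn (fun i j hij => (hP g i).not_sameStar hf hij (hP g j))
      (fun i => (hP g i).adj hf ((cycle_adj (by omega)).2 (Or.inl rfl)) (hP g (i + 1)))
  have hloc : ∀ g s x, s.1 ∈ st (cycleGraph n) x → (P g x).2 = (P (g * lt _ s) x).2 := by
    intro g s x hs
    refine (((hP g x).dir hf).congr (sub_of_le (b := 2 * K) fun k => ?_)).unique
      ((hP (g * lt _ s) x).dir hf)
    refine (hf _ _).1.trans ?_
    rw [mul_assoc, lt_zpow_comm hs, ← mul_assoc, dd_mul_right_self, len_lt]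
    omega
  have hstep : ∀ g s, (fun x => (P g x).2) = fun x => (P (g * lt _ s) x).2 := by
    intro g s
    refine progression_eq (by omega) (hprog g) (hprog _) (j := s.1) (hloc _ _ _ ?_)
      (hloc _ _ _ ?_)
    · exact Set.mem_insert _ _
    · rw [mem_cycle_st (by omega)]
      exact Or.inr (Or.inr (by ring))
  have hall : ∀ w g, (fun x => (P g x).2) = fun x => (P (g * ev _ w) x).2 := by
    intro w
    induction w with
    | nil => intro g; rw [ev_nil, mul_one]
    | cons s w ih => intro g; rw [ev_cons, ← mul_assoc, hstep g s]; exact ih _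
  refine ⟨fun x => (P 1 x).2, fun g x => ⟨P g x, hP g x, ?_⟩⟩
  obtain ⟨w, hw⟩ := exists_ev (Γ := cycleGraph n) g
  have := congrFun (hall w 1) x
  rw [one_mul, hw] at this
  exact this.symm

end Labels

section Composition

theorem exists_lipschitz {V W : Type*} [Fintype V] {Γ : SimpleGraph V} {Δ : SimpleGraph W}
    (h : RAAG Γ →* RAAG Δ) : ∃ L : ℕ, ∀ a b, dd (h a) (h b) ≤ L * dd a b := by
  refine ⟨∑ v, len (h (PresentedGroup.of v)), fun a b => ?_⟩
  rw [dd, dd, ← map_inv, ← map_mul]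
  obtain ⟨w, hw, hw'⟩ := exists_geodesic (a⁻¹ * b)
  rw [← hw, ← hw']
  clear hw hw'
  induction w with
  | nil => simp [len_one]
  | cons s w ih =>
    rw [ev_cons, map_mul, List.length_cons, mul_add, mul_one, add_comm]
    refine (len_mul _ _).trans (Nat.add_le_add ?_ ih)
    have h1 : len (h (lt Γ s)) = len (h (PresentedGroup.of s.1)) := by
      rcases s with ⟨v, _ | _⟩
      · rw [lt_false, map_inv, len_inv]
      · rw [lt_true]
    rw [h1]
    exact Finset.single_le_sum (f := fun v => len (h (PresentedGroup.of v)))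
      (fun _ _ => Nat.zero_le _) (Finset.mem_univ s.1)

variable {m n : ℕ}

/-- The exponents seen along the image of a line under a homomorphism. -/
theorem label_iff {V W : Type*} [Fintype V] {Γ : SimpleGraph V} {Δ : SimpleGraph W}
    (h : RAAG Γ →* RAAG Δ) {φ : ℤ → RAAG Γ} {p : RAAG Γ} {y : V} (ht : Track φ p y) {K : ℕ}
    (hφ : ∀ k, k.natAbs ≤ K * dd (φ 0) (φ k) + K) {z : W} (hz : Dir (fun k => h (φ k)) z) (v : W) :
    v ≠ z ↔ ab v (h (PresentedGroup.of y)) = 0 := by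
  obtain ⟨L, hL⟩ := exists_lipschitz h
  obtain ⟨j, hj⟩ : ∃ j : ℤ → ℤ, ∀ k, j k = ab y (p⁻¹ * φ k) := ⟨_, fun k => rfl⟩
  have h1 : Sub fun k => dd (h (φ k)) (h p * h (PresentedGroup.of y) ^ j k) := by
    refine Sub.of_le (a := L) (b := 0) ht fun k => ?_
    rw [← map_zpow, ← map_mul, hj]
    exact hL _ _
  rw [← hz.congr h1 v]
  simp only [ab_mul, ab_zpow]
  constructor
  · intro h2
    by_contra h3
    obtain ⟨C, hC⟩ := ht.growth hφ
    refine not_sub_of_le (a := 2 * K) (b := C) (u := fun k => (j k).natAbs)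
      (fun k => by rw [hj]; exact hC k) ?_
    refine h2.of_le (a := 1) (b := (ab v (h p)).natAbs) fun k => ?_
    have h4 : (j k).natAbs ≤ (j k * ab v (h (PresentedGroup.of y))).natAbs := by
      rw [Int.natAbs_mul]
      exact Nat.le_mul_of_pos_right _ (Int.natAbs_pos.2 h3)
    omega
  · intro h2
    rw [h2]
    simpa using sub_const _

/-- A map close to `ψ' ∘ h ∘ ψ` sends all lines of a given label to lines of a common label. -/
theorem exists_common_label (hm : 7 ≤ m) (hn : 7 ≤ n)
    {Φ : RAAG (cycleGraph m) → RAAG (cycleGraph n)}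
    {ψ : RAAG (cycleGraph m) → RAAG (cycleGraph m)}
    {ψ' : RAAG (cycleGraph n) → RAAG (cycleGraph n)}
    (h : RAAG (cycleGraph m) →* RAAG (cycleGraph n)) {K₁ K₂ K₃ C : ℕ}
    (hψ : QI K₁ ψ) (hψ' : QI K₂ ψ') (hΦ : QI K₃ Φ) (hC : ∀ g, dd (Φ g) (ψ' (h (ψ g))) ≤ C)
    (x : ZMod m) : ∃ v, ∀ g w, w ≠ v →
      Sub fun k => (ab w (Φ (g * (PresentedGroup.of x) ^ k))).natAbs := by
  have hm0 : NeZero m := ⟨by omega⟩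
  have hn0 : NeZero n := ⟨by omega⟩
  obtain ⟨L, hL⟩ := exists_lipschitz h
  obtain ⟨K, hK⟩ : ∃ K, K = L * K₁ + K₃ * K₂ + K₃ * (K₂ + 2 * C) + K₃ := ⟨_, rfl⟩
  have hH : QI K fun g => h (ψ g) := by
    intro a b
    change dd (h (ψ a)) (h (ψ b)) ≤ K * dd a b + K ∧ dd a b ≤ K * dd (h (ψ a)) (h (ψ b)) + K
    constructor
    · have h1 := (hL (ψ a) (ψ b)).trans (Nat.mul_le_mul_left L (hψ a b).1)
      have h2 : L * K₁ ≤ K := by rw [hK]; omega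
      have h3 := Nat.mul_le_mul_right (dd a b) h2
      rw [mul_add, ← mul_assoc] at h1
      omega
    · have h1 := (hΦ a b).2
      have h2 := (hψ' (h (ψ a)) (h (ψ b))).1
      have h3 := hC a
      have h4 := hC b
      have h5 := dd_triangle (Φ a) (ψ' (h (ψ a))) (Φ b)
      have h6 := dd_triangle (ψ' (h (ψ a))) (ψ' (h (ψ b))) (Φ b)
      rw [dd_comm (ψ' (h (ψ b))) (Φ b)] at h6
      have h7 : K₃ * dd (Φ a) (Φ b) ≤ K₃ * (K₂ * dd (h (ψ a)) (h (ψ b)) + (K₂ + 2 * C)) :=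
        Nat.mul_le_mul_left _ (by omega)
      rw [mul_add, ← mul_assoc] at h7
      have h8 : K₃ * K₂ ≤ K := by rw [hK]; omega
      have h9 := Nat.mul_le_mul_right (dd (h (ψ a)) (h (ψ b))) h8
      omega
  obtain ⟨ℓ, hℓ⟩ := exists_label hm hψ
  obtain ⟨ℓ', hℓ'⟩ := exists_label hn hψ'
  choose Q hQ using fun g => exists_starImage (corners_cycle (by omega))
    (corners_cycle (by omega)) hH g x
  have hQ2 : ∀ g v, v ≠ (Q g).2 ↔ ab v (h (PresentedGroup.of (ℓ x))) = 0 := by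
    intro g v
    obtain ⟨P, hP, hPx⟩ := hℓ g x
    rw [← hPx]
    exact label_iff h hP.track (hψ.line_growth g x) ((hQ g).dir hH) v
  refine ⟨ℓ' (Q 1).2, fun g w hw => ?_⟩
  have hz : (Q g).2 = (Q 1).2 := by
    have h1 := hQ2 g (Q g).2
    rw [← hQ2 1] at h1
    simpa using h1
  rw [← hz] at hw
  obtain ⟨P, hP, hPx⟩ := hℓ' (Q g).1 (Q g).2
  have h1 := (hP.dir hψ' w).2 (hPx ▸ hw)
  have h2 := h1.comp (i := fun k => ab (Q g).2 ((Q g).1⁻¹ * h (ψ (g * (PresentedGroup.of x) ^ k))))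
    (a := K) (b := dd (Q g).1 (h (ψ g)) + K) (fun k => by
      have h3 := natAbs_ab_le (Q g).2 ((Q g).1⁻¹ * h (ψ (g * (PresentedGroup.of x) ^ k)))
      have h4 := dd_triangle (Q g).1 (h (ψ g)) (h (ψ (g * (PresentedGroup.of x) ^ k)))
      have h5 := (hH g (g * (PresentedGroup.of x) ^ k)).1
      rw [dd_mul_right_self, len_of_zpow] at h5
      rw [← dd] at h3
      simp only at h5 ⊢
      omega)
  refine (Sub.ab_congr ?_ w).2 h2
  refine Sub.of_le (a := K₂) (b := K₂ + C) (hQ g).track fun k => ?_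
  have h3 := hC (g * (PresentedGroup.of x) ^ k)
  have h4 := (hψ' (h (ψ (g * (PresentedGroup.of x) ^ k))) ((Q g).1 *
    (PresentedGroup.of (Q g).2) ^ ab (Q g).2 ((Q g).1⁻¹ * h (ψ (g * (PresentedGroup.of x) ^ k))))).1
  have h5 := dd_triangle (Φ (g * (PresentedGroup.of x) ^ k))
    (ψ' (h (ψ (g * (PresentedGroup.of x) ^ k)))) (ψ' ((Q g).1 * (PresentedGroup.of (Q g).2) ^
      ab (Q g).2 ((Q g).1⁻¹ * h (ψ (g * (PresentedGroup.of x) ^ k)))))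
  refine h5.trans ?_
  beta_reduce
  omega

theorem eq_of_sub {W : Type*} {Δ : SimpleGraph W} {φ : ℤ → RAAG Δ} {v w : W} {c d : RAAG Δ}
    (hφ : ∀ k, φ k = c * (PresentedGroup.of v) ^ k * d)
    (h : ∀ u, u ≠ w → Sub fun k => (ab u (φ k)).natAbs) : v = w := by
  by_contra hv
  refine not_sub_of_le (a := 1) (b := (ab v c).natAbs + (ab v d).natAbs) (fun k => ?_) (h v hv)
  rw [hφ, ab_mul, ab_mul, ab_zpow, ab_of_self]
  omega

end Composition

section Metric

variable {V W : Type*} {Γ : SimpleGraph V} {Δ : SimpleGraph W}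

theorem wordDist_eq (a b : RAAG Γ) : wordDist (raagGen Γ) a b = dd a b := rfl

theorem exists_qi {f : RAAG Γ → RAAG Δ}
    (hf : IsQIEWith (wordDist (raagGen Γ)) (wordDist (raagGen Δ)) f) : ∃ K, QI K f := by
  obtain ⟨K, A, hK, hA, h⟩ := hf
  obtain ⟨N, hN⟩ := exists_nat_ge (K * (A + 1) + A)
  have h1 : K ≤ N := by nlinarith
  have h2 : A ≤ N := by nlinarith
  have h3 : K * A ≤ N := by nlinarith
  refine ⟨N, fun a b => ?_⟩
  obtain ⟨h4, h5⟩ := h a b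
  rw [wordDist_eq, wordDist_eq] at h4 h5
  have h6 : (0 : ℝ) ≤ dd a b := Nat.cast_nonneg _
  have h7 : (0 : ℝ) ≤ dd (f a) (f b) := Nat.cast_nonneg _
  constructor
  · have : (dd (f a) (f b) : ℝ) ≤ N * dd a b + N := by nlinarith
    exact_mod_cast this
  · have h8 : (dd a b : ℝ) ≤ K * (dd (f a) (f b) + A) := by
      rw [sub_le_iff_le_add, one_div, inv_mul_le_iff₀ (by linarith)] at h4
      exact h4
    have : (dd a b : ℝ) ≤ N * dd (f a) (f b) + N := by nlinarith
    exact_mod_cast this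

theorem QI.isQIEWith {K : ℕ} {f : RAAG Γ → RAAG Δ} (hf : QI K f) :
    IsQIEWith (wordDist (raagGen Γ)) (wordDist (raagGen Δ)) f := by
  refine ⟨K + 1, K + 1, by simp, by positivity, fun a b => ?_⟩
  have h1 : (dd (f a) (f b) : ℝ) ≤ K * dd a b + K := by exact_mod_cast (hf a b).1
  have h2 : (dd a b : ℝ) ≤ K * dd (f a) (f b) + K := by exact_mod_cast (hf a b).2
  have h6 : (0 : ℝ) ≤ dd a b := Nat.cast_nonneg _
  have h7 : (0 : ℝ) ≤ dd (f a) (f b) := Nat.cast_nonneg _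
  have h8 : (0 : ℝ) ≤ K := Nat.cast_nonneg _
  rw [wordDist_eq, wordDist_eq]
  constructor
  · rw [sub_le_iff_le_add, one_div, inv_mul_le_iff₀ (by positivity)]
    nlinarith
  · nlinarith

end Metric

section PingPong

variable {V W : Type*} {Γ : SimpleGraph V} {Δ : SimpleGraph W}

/-- Conjugates of generators of `RAAG Δ`, indexed by the vertices of `Γ`, whose half-spaces are
arranged in the same way as the half-spaces at the identity of `RAAG Γ`. -/
structure PingPong (Γ : SimpleGraph V) (Δ : SimpleGraph W) (γ : V → RAAG Δ) (ℓ : V → W) :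
    Prop where
  base : ∀ x ε, ¬ InH (ℓ x, ε) (γ x)⁻¹
  adj : ∀ x z, Γ.Adj x z → Δ.Adj (ℓ x) (ℓ z) ∧
    ∃ δ, (γ x)⁻¹ * δ ∈ sp Δ (lk Δ (ℓ x)) ∧ (γ z)⁻¹ * δ ∈ sp Δ (lk Δ (ℓ z))
  disjoint : ∀ x z, x ≠ z → ¬ Γ.Adj x z → ∀ ε ε' y, InH (ℓ x, ε) ((γ x)⁻¹ * y) →
    ¬ InH (ℓ z, ε') ((γ z)⁻¹ * y)

variable {γ : V → RAAG Δ} {ℓ : V → W}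

theorem PingPong.conj_mem (H : PingPong Γ Δ γ ℓ) {x z : V} (h : Γ.Adj x z) (ε : Bool) :
    (γ z)⁻¹ * (γ x * lt Δ (ℓ x, ε) * (γ x)⁻¹) * γ z ∈ sp Δ (lk Δ (ℓ z)) := by
  obtain ⟨hadj, δ, h1, h2⟩ := H.adj x z h
  have h3 := (sp_lk_commute (s := (ℓ x, ε)) h1).eq
  have h4 : (γ z)⁻¹ * (γ x * lt Δ (ℓ x, ε) * (γ x)⁻¹) * γ z =
      ((γ z)⁻¹ * δ) * lt Δ (ℓ x, ε) * ((γ z)⁻¹ * δ)⁻¹ := by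
    have h5 : γ x * lt Δ (ℓ x, ε) * (γ x)⁻¹ = δ * lt Δ (ℓ x, ε) * δ⁻¹ := by
      calc γ x * lt Δ (ℓ x, ε) * (γ x)⁻¹
          = γ x * (lt Δ (ℓ x, ε) * ((γ x)⁻¹ * δ)) * δ⁻¹ := by group
        _ = δ * lt Δ (ℓ x, ε) * δ⁻¹ := by rw [h3]; group
    rw [h5]
    group
  rw [h4]
  exact mul_mem (mul_mem h2 (lt_mem_sp (s := (ℓ x, ε)) hadj.symm)) (inv_mem h2)

theorem PingPong.commute (H : PingPong Γ Δ γ ℓ) {x z : V} (h : Γ.Adj x z) (ε ε' : Bool) :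
    Commute (γ x * lt Δ (ℓ x, ε) * (γ x)⁻¹) (γ z * lt Δ (ℓ z, ε') * (γ z)⁻¹) := by
  have h1 := (sp_lk_commute (s := (ℓ z, ε')) (H.conj_mem h ε)).eq
  change _ * _ = _ * _
  calc _ = γ z * (((γ z)⁻¹ * (γ x * lt Δ (ℓ x, ε) * (γ x)⁻¹) * γ z) * lt Δ (ℓ z, ε')) *
        (γ z)⁻¹ := by group
    _ = _ := by rw [← h1]; group

theorem PingPong.exists_hom (H : PingPong Γ Δ γ ℓ) : ∃ h : RAAG Γ →* RAAG Δ,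
    ∀ s : V × Bool, h (lt Γ s) = γ s.1 * lt Δ (ℓ s.1, s.2) * (γ s.1)⁻¹ := by
  refine ⟨PresentedGroup.toGroup (f := fun x => γ x * lt Δ (ℓ x, true) * (γ x)⁻¹) ?_, ?_⟩
  · rintro _ ⟨v, w, hvw, rfl⟩
    have := (H.commute hvw true true).eq
    simp only [map_mul, map_inv, FreeGroup.lift_apply_of]
    rw [this]
    group
  · rintro ⟨x, _ | _⟩
    · rw [lt_false, lt_false, map_inv, PresentedGroup.toGroup.of, lt_true]
      group
    · rw [lt_true, PresentedGroup.toGroup.of]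

variable {h : RAAG Γ →* RAAG Δ}

theorem PingPong.inH_iff (H : PingPong Γ Δ γ ℓ)
    (hh : ∀ s : V × Bool, h (lt Γ s) = γ s.1 * lt Δ (ℓ s.1, s.2) * (γ s.1)⁻¹)
    (s : V × Bool) (g : RAAG Γ) : InH s g ↔ InH (ℓ s.1, s.2) ((γ s.1)⁻¹ * h g) := by
  obtain ⟨N, hN⟩ : ∃ N, len g = N := ⟨_, rfl⟩
  induction N using Nat.strong_induction_on generalizing g s with
  | _ N ih =>
  by_cases hg : g = 1
  · subst hg
    rw [map_one, mul_one]
    exact iff_of_false (one_not_inH s) (H.base _ _)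
  obtain ⟨t, k, rfl, hlen, ht⟩ := exists_first hg
  have key : InH (ℓ t.1, t.2) ((γ t.1)⁻¹ * h (lt Γ t * k)) := by
    have h1 : (γ t.1)⁻¹ * h (lt Γ t * k) = lt Δ (ℓ t.1, t.2) * ((γ t.1)⁻¹ * h k) := by
      rw [map_mul, hh]
      group
    rw [h1, inH_lt_mul]
    exact fun h2 => (inH_lt_mul t k).1 ht ((ih (len k) (by omega) (flip t) k rfl).2 h2)
  by_cases hst : s = t
  · subst hst
    exact iff_of_true ht key
  by_cases hadj : Γ.Adj t.1 s.1
  · rw [inH_lt_mul_adj hadj, ih (len k) (by omega) s k rfl, map_mul, hh]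
    have h1 := inH_sp_mul (s := (ℓ s.1, s.2)) (H.conj_mem hadj t.2) ((γ s.1)⁻¹ * h k)
    rw [← h1]
    refine iff_of_eq (congrArg _ ?_)
    group
  · refine iff_of_false (fun hs => ?_) (fun hs => ?_)
    · rcases hs.adj_or_eq ht with h1 | h1
      · exact hst h1
      · exact hadj h1.symm
    · by_cases hx : s.1 = t.1
      · have hf : s = flip t := by
          refine Prod.ext hx ?_
          have : s.2 ≠ t.2 := fun h2 => hst (Prod.ext hx h2)
          rw [flip_snd]
          cases h3 : s.2 <;> cases h4 : t.2 <;> simp_all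
        rw [hf] at hs
        exact key.not_flip hs
      · exact H.disjoint _ _ hx (fun h2 => hadj h2.symm) _ _ _ hs key

theorem PingPong.len_le (H : PingPong Γ Δ γ ℓ)
    (hh : ∀ s : V × Bool, h (lt Γ s) = γ s.1 * lt Δ (ℓ s.1, s.2) * (γ s.1)⁻¹)
    (g : RAAG Γ) : len g ≤ len (h g) := by
  obtain ⟨N, hN⟩ : ∃ N, len g = N := ⟨_, rfl⟩
  induction N generalizing g with
  | zero => omega
  | succ N ih =>
  have hg : g ≠ 1 := by
    rintro rfl
    rw [len_one] at hN
    omega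
  obtain ⟨t, k, rfl, hlen, ht⟩ := exists_first hg
  have h0 := ih k (by omega)
  have h1 := (H.inH_iff hh t _).1 ht
  obtain ⟨e, he, hd⟩ := crossing (g := γ t.1) (a := 1) (by rw [mul_one]; exact H.base _ _) h1
  have h2 : h (lt Γ t * k) = (γ t.1 * lt Δ (ℓ t.1, t.2) * (γ t.1)⁻¹) * h k := by
    rw [map_mul, hh]
  have h3 : e * lt Δ (ℓ t.1, t.2) = (γ t.1 * lt Δ (ℓ t.1, t.2) * (γ t.1)⁻¹) * e := by
    have h4 := (sp_lk_commute (s := (ℓ t.1, t.2)) he).eq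
    calc _ = γ t.1 * (((γ t.1)⁻¹ * e) * lt Δ (ℓ t.1, t.2)) := by group
      _ = _ := by rw [← h4]; group
  rw [h3] at hd
  nth_rewrite 1 [h2] at hd
  rw [dd_mul_left, dd_one_left, dd_one_left] at hd
  have h5 := dd_triangle 1 e (h k)
  rw [dd_one_left, dd_one_left] at h5
  omega

theorem PingPong.dd_le (H : PingPong Γ Δ γ ℓ)
    (hh : ∀ s : V × Bool, h (lt Γ s) = γ s.1 * lt Δ (ℓ s.1, s.2) * (γ s.1)⁻¹)
    (a b : RAAG Γ) : dd a b ≤ dd (h a) (h b) := by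
  have := H.len_le hh (a⁻¹ * b)
  rwa [map_mul, map_inv] at this

open Classical in
/-- The map that agrees with `h₂` on the half-space of `s` at the identity and with `h₁` on the
complement of that half-space. -/
noncomputable def glue (s : V × Bool) (h₁ h₂ : RAAG Γ →* RAAG Δ) (g : RAAG Γ) : RAAG Δ :=
  if InH s g then h₂ g else h₁ g

theorem agree_of_mem_sp {h₁ h₂ : RAAG Γ →* RAAG Δ} {L : Set V}
    (hv : ∀ v ∈ L, h₁ (PresentedGroup.of v : RAAG Γ) = h₂ (PresentedGroup.of v))
    {g : RAAG Γ} (hg : g ∈ sp Γ L) : h₁ g = h₂ g := by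
  have h1 := hom_ext (f := h₁.comp (ret Γ L)) (f' := h₂.comp (ret Γ L)) (fun v => by
    rw [MonoidHom.comp_apply, MonoidHom.comp_apply]
    by_cases h : v ∈ L
    · rw [ret_lt_mem (s := (v, true)) h]
      exact hv v h
    · rw [ret_lt_not_mem (s := (v, true)) h, map_one, map_one]) g
  rwa [MonoidHom.comp_apply, MonoidHom.comp_apply, mem_sp.1 hg] at h1

theorem exists_of_mem_sp {h : RAAG Γ →* RAAG Δ} {L : Set V} {M : Set W}
    (hM : ∀ w ∈ M, ∃ v ∈ L, h (PresentedGroup.of v) = PresentedGroup.of w)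
    {y : RAAG Δ} (hy : y ∈ sp Δ M) : ∃ g ∈ sp Γ L, h g = y := by
  obtain ⟨w, rfl, -, hw⟩ := exists_word_sp hy
  induction w with
  | nil => exact ⟨1, one_mem _, by rw [map_one, ev_nil]⟩
  | cons x w ih =>
    have hx : x.1 ∈ M := hw x (by simp)
    have hw' : ∀ y ∈ w, y.1 ∈ M := fun y hy => hw y (by simp [hy])
    obtain ⟨g, hg, hgw⟩ := ih (ev_mem_sp hw') hw'
    obtain ⟨v, hv, hvx⟩ := hM x.1 hx
    refine ⟨lt Γ (v, x.2) * g, mul_mem (lt_mem_sp (s := (v, x.2)) hv) hg, ?_⟩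
    rw [map_mul, hgw, ev_cons]
    congr 1
    obtain ⟨a, _ | _⟩ := x
    · rw [lt_false, lt_false, map_inv, hvx]
    · exact hvx

theorem glue_qi {γ₁ γ₂ : V → RAAG Δ} {ℓ₁ ℓ₂ : V → W} {h₁ h₂ : RAAG Γ →* RAAG Δ}
    [Fintype V]
    (H₁ : PingPong Γ Δ γ₁ ℓ₁) (H₂ : PingPong Γ Δ γ₂ ℓ₂)
    (hh₁ : ∀ s : V × Bool, h₁ (lt Γ s) = γ₁ s.1 * lt Δ (ℓ₁ s.1, s.2) * (γ₁ s.1)⁻¹)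
    (hh₂ : ∀ s : V × Bool, h₂ (lt Γ s) = γ₂ s.1 * lt Δ (ℓ₂ s.1, s.2) * (γ₂ s.1)⁻¹)
    {x : V} {y : W} (ε : Bool) (hx₁ : γ₁ x = 1) (hx₂ : γ₂ x = 1) (hy₁ : ℓ₁ x = y)
    (hy₂ : ℓ₂ x = y)
    (hagree : ∀ v ∈ lk Γ x, h₁ (PresentedGroup.of v : RAAG Γ) = h₂ (PresentedGroup.of v))
    (hsurj : ∀ w ∈ lk Δ y, ∃ v ∈ lk Γ x, h₁ (PresentedGroup.of v) = PresentedGroup.of w) :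
    ∃ K, QI K (glue (x, ε) h₁ h₂) := by
  obtain ⟨L₁, hL₁⟩ := exists_lipschitz h₁
  obtain ⟨L₂, hL₂⟩ := exists_lipschitz h₂
  have hin₁ : ∀ g, InH (x, ε) g ↔ InH (y, ε) (h₁ g) := fun g => by
    have := H₁.inH_iff hh₁ (x, ε) g
    rwa [hx₁, hy₁, inv_one, one_mul] at this
  have hin₂ : ∀ g, InH (x, ε) g ↔ InH (y, ε) (h₂ g) := fun g => by
    have := H₂.inH_iff hh₂ (x, ε) g
    rwa [hx₂, hy₂, inv_one, one_mul] at this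
  have mixed : ∀ a b, ¬ InH (x, ε) a → InH (x, ε) b →
      dd (h₁ a) (h₂ b) ≤ (L₁ + L₂ + 1) * dd a b ∧ dd a b ≤ dd (h₁ a) (h₂ b) := by
    intro a b ha hb
    constructor
    · obtain ⟨e, he, hd⟩ := crossing_le (s := (x, ε)) (g := 1) (a := a) (b := b)
        (by simpa using ha) (by simpa using hb)
      rw [inv_one, one_mul] at he
      have h1 := dd_triangle (h₁ a) (h₁ e) (h₂ b)
      have h2 := hL₁ a e
      have h3 := hL₂ e b
      rw [← agree_of_mem_sp hagree he] at h3
      rw [← hd]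
      nlinarith [Nat.zero_le (L₂ * dd a e), Nat.zero_le (L₁ * dd e b)]
    · obtain ⟨e, he, hd⟩ := crossing_le (s := (y, ε)) (g := 1) (a := h₁ a) (b := h₂ b)
        (by simpa using (hin₁ a).not.1 ha) (by simpa using (hin₂ b).1 hb)
      rw [inv_one, one_mul] at he
      obtain ⟨e', he', rfl⟩ := exists_of_mem_sp hsurj he
      have h1 := H₁.dd_le hh₁ a e'
      have h2 := H₂.dd_le hh₂ e' b
      rw [← agree_of_mem_sp hagree he'] at h2
      have h3 := dd_triangle a e' b
      omega
  have bound : ∀ a b, dd (glue (x, ε) h₁ h₂ a) (glue (x, ε) h₁ h₂ b) ≤ (L₁ + L₂ + 1) * dd a b ∧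
      dd a b ≤ dd (glue (x, ε) h₁ h₂ a) (glue (x, ε) h₁ h₂ b) := by
    intro a b
    by_cases ha : InH (x, ε) a <;> by_cases hb : InH (x, ε) b <;>
      simp only [glue, ha, hb, if_true, if_false]
    · exact ⟨(hL₂ a b).trans (Nat.mul_le_mul_right _ (by omega)), H₂.dd_le hh₂ a b⟩
    · rw [dd_comm, dd_comm a b]
      exact mixed b a hb ha
    · exact mixed a b ha hb
    · exact ⟨(hL₁ a b).trans (Nat.mul_le_mul_right _ (by omega)), H₁.dd_le hh₁ a b⟩
  refine ⟨L₁ + L₂ + 1, fun a b => ⟨(bound a b).1.trans (by omega), ?_⟩⟩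
  have h1 := (bound a b).2
  have h2 := Nat.le_mul_of_pos_left (dd (glue (x, ε) h₁ h₂ a) (glue (x, ε) h₁ h₂ b))
    (show 0 < L₁ + L₂ + 1 by omega)
  omega

end PingPong

section Folding

variable {n : ℕ}

/-- The labels of the `q`-th copy of the cycle: consecutive copies are traversed in opposite
directions. -/
def lab (c : ZMod n) (q o : ℕ) : ZMod n := if Even q then c + o else c - 2 - o

/-- The base point of the `q`-th copy of the cycle. -/
def off (c : ZMod n) : ℕ → RAAG (cycleGraph n)
  | 0 => 1
  | q + 1 => off c q * lt (cycleGraph n) (lab c (q + 1) 0, true)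

theorem lab_zero (c : ZMod n) (o : ℕ) : lab c 0 o = c + o := by simp [lab]

theorem lab_one (c : ZMod n) (o : ℕ) : lab c 1 o = c - 2 - o := by simp [lab]

theorem lab_succ (c : ZMod n) (q : ℕ) {o o' : ℕ} (h : o + o' + 2 = n) :
    lab c (q + 1) o = lab c q o' := by
  have h1 : (o : ZMod n) + o' + 2 = 0 := by
    have := ZMod.natCast_self n
    rw [← h] at this ⊢
    push_cast at this
    exact this
  by_cases hq : Even q
  · rw [lab, lab, if_neg (by simpa [Nat.even_add_one] using hq), if_pos hq]
    linear_combination -h1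
  · rw [lab, lab, if_pos (by simpa [Nat.even_add_one] using hq), if_neg hq]
    linear_combination h1

theorem lab_last (c : ZMod n) (hn : 1 ≤ n) (q : ℕ) : lab c q (n - 1) = c - 1 := by
  rw [lab, Nat.cast_sub hn, ZMod.natCast_self]
  split_ifs <;> push_cast <;> ring

theorem lab_sub (c : ZMod n) (q : ℕ) {o o' : ℕ} (h : o ≤ o') :
    lab c q o' - lab c q o = ((o' - o : ℕ) : ZMod n) ∨
      lab c q o' - lab c q o = -((o' - o : ℕ) : ZMod n) := by
  rw [lab, lab, Nat.cast_sub h]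
  split_ifs
  · left; ring
  · right; ring

theorem lab_ne (c : ZMod n) (q : ℕ) {o o' : ℕ} (h : o < o') (h' : o' < n) :
    lab c q o ≠ lab c q o' := by
  intro h1
  have h2 := natCast_ne_zero (n := n) (c := o' - o) (by omega) (by omega)
  rcases lab_sub c q h.le with h3 | h3
  · exact h2 (by linear_combination -h3 - h1)
  · exact h2 (by linear_combination h3 + h1)

theorem lab_adj_succ (c : ZMod n) (hn : 2 ≤ n) (q o : ℕ) :
    (cycleGraph n).Adj (lab c q o) (lab c q (o + 1)) := by
  rw [cycle_adj hn, lab, lab]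
  split_ifs
  · left; push_cast; ring
  · right; push_cast; ring

theorem lab_adj_last (c : ZMod n) (hn : 2 ≤ n) (q : ℕ) :
    (cycleGraph n).Adj (lab c q 0) (lab c q (n - 1)) := by
  rw [cycle_adj hn, lab_last c (by omega), lab]
  split_ifs
  · right; push_cast; ring
  · left; push_cast; ring

theorem eq_of_lab_adj (c : ZMod n) (hn : 2 ≤ n) (q : ℕ) {o o' : ℕ} (h : o < o') (h' : o' < n)
    (hadj : (cycleGraph n).Adj (lab c q o) (lab c q o')) : o' = o + 1 ∨ o' = o + (n - 1) := by
  by_contra hne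
  have h1 := natCast_ne_zero (n := n) (c := o' - o - 1) (by omega) (by omega)
  have h2 := natCast_ne_zero (n := n) (c := o' - o + 1) (by omega) (by omega)
  rw [Nat.cast_sub (by omega)] at h1
  push_cast at h1 h2
  rw [cycle_adj hn] at hadj
  rcases lab_sub c q h.le with h3 | h3 <;> rcases hadj with h4 | h4
  · exact h1 (by linear_combination h4 - h3)
  · exact h2 (by linear_combination h4 - h3)
  · exact h2 (by linear_combination h3 - h4)
  · exact h1 (by linear_combination h3 - h4)

/-- The half-spaces of the `q`-th copy of the cycle. -/
def InCopy (c : ZMod n) (q o : ℕ) (ε : Bool) (y : RAAG (cycleGraph n)) : Prop :=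
  InH (lab c q o, ε) ((off c q)⁻¹ * y)

theorem inCopy_succ (c : ZMod n) (q o : ℕ) (ε : Bool) (y : RAAG (cycleGraph n)) :
    InCopy c (q + 1) o ε y ↔
      InH (lab c (q + 1) o, ε) (lt (cycleGraph n) (lab c (q + 1) 0, false) * ((off c q)⁻¹ * y)) := by
  rw [InCopy, off, mul_inv_rev, mul_assoc, lt_false, lt_true]

theorem InCopy.disjoint {c : ZMod n} (hn : 2 ≤ n) {q o o' : ℕ} {ε ε' : Bool}
    {y : RAAG (cycleGraph n)} (h : InCopy c q o ε y) (hlt : o < o') (h' : o' < n)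
    (h1 : o' ≠ o + 1) (h2 : o' ≠ o + (n - 1)) : ¬ InCopy c q o' ε' y := by
  refine InH.not_of_nonadj h (lab_ne c q hlt h') fun hadj => ?_
  rcases eq_of_lab_adj c hn q hlt h' hadj with h3 | h3
  · exact h1 h3
  · exact h2 h3

theorem InCopy.step {c : ZMod n} (hn : 4 ≤ n) {q o : ℕ} {ε : Bool}
    {y : RAAG (cycleGraph n)} (h : InCopy c (q + 1) o ε y) (h2 : 2 ≤ o) (ho : o + 2 ≤ n) :
    InCopy c q (n - 2) true y := by
  have h1 : ¬ InH (lab c (q + 1) 0, false) ((off c (q + 1))⁻¹ * y) := fun h3 =>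
    InCopy.disjoint (c := c) (by omega) h3 (by omega) (by omega) (by omega) (by omega) h
  change ¬ InCopy c (q + 1) 0 false y at h1
  rw [inCopy_succ, inH_lt_mul, not_not] at h1
  rw [InCopy, ← lab_succ c q (o := 0) (by omega)]
  exact h1

theorem InCopy.steps {c : ZMod n} (hn : 4 ≤ n) {q o : ℕ} (j : ℕ) {ε : Bool}
    {y : RAAG (cycleGraph n)} (h : InCopy c (q + j + 1) o ε y) (h2 : 2 ≤ o) (ho : o + 2 ≤ n) :
    InCopy c q (n - 2) true y := by
  induction j generalizing o ε with
  | zero => exact h.step hn h2 ho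
  | succ j ih => exact ih (h.step hn h2 ho) (by omega) (by omega)

theorem inCopy_one {c : ZMod n} (hn : 4 ≤ n) {q : ℕ} {ε : Bool} {y : RAAG (cycleGraph n)} :
    InCopy c (q + 1) 1 ε y ↔ InCopy c q (n - 3) ε y := by
  rw [inCopy_succ, inH_lt_mul_adj (lab_adj_succ c (by omega) (q + 1) 0),
    lab_succ c q (o' := n - 3) (by omega), InCopy]

theorem InCopy.disjoint_of_lt {c : ZMod n} (hn : 5 ≤ n) {q j o o' : ℕ} {ε ε' : Bool}
    {y : RAAG (cycleGraph n)} (h : InCopy c q o ε y) (ho : o + 3 ≤ n) (h2 : 2 ≤ o')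
    (ho' : o' + 2 ≤ n) (hne : ¬ (j = 0 ∧ o = n - 3 ∧ o' = 2)) :
    ¬ InCopy c (q + j + 1) o' ε' y := by
  intro h'
  have h1 := h'.steps (by omega) j h2 ho'
  by_cases h3 : o = n - 3
  · subst h3
    rw [← inCopy_one (by omega)] at h
    obtain _ | j := j
    · exact h.disjoint (by omega) (by omega) (by omega) (by omega) (by omega) h'
    · rw [show q + (j + 1) + 1 = (q + 1) + j + 1 by omega] at h'
      exact h.disjoint (by omega) (by omega) (by omega) (by omega) (by omega)
        (h'.steps (by omega) j h2 ho')
  · exact h.disjoint (by omega) (by omega) (by omega) (by omega) (by omega) h1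

theorem not_inCopy_one (c : ZMod n) (hn : 5 ≤ n) {q o : ℕ} (ε : Bool) (h1 : 1 ≤ o)
    (ho : o + 2 ≤ n) : ¬ InCopy c q o ε 1 := by
  induction q generalizing o ε with
  | zero =>
    rw [InCopy, off, inv_one, one_mul]
    exact one_not_inH _
  | succ q ih =>
    by_cases h : o = 1
    · rw [h, inCopy_one (by omega)]
      exact ih ε (by omega) (by omega)
    · exact fun h' => ih true (by omega) (by omega) (h'.step (by omega) (by omega) ho)

theorem off_mem_sp (c : ZMod n) (hn : 4 ≤ n) (q : ℕ) :
    off c q ∈ sp (cycleGraph n) (lk (cycleGraph n) (c - 1)) := by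
  induction q with
  | zero => exact one_mem _
  | succ q ih =>
    refine mul_mem ih (lt_mem_sp ?_)
    rw [← lab_last c (by omega) (q + 1)]
    exact (lab_adj_last c (by omega) (q + 1)).symm

end Folding

section Position

/-- The copy containing the `k`-th vertex of the long cycle, and its coordinate in that copy. -/
def pos (n p k : ℕ) : ℕ × ℕ :=
  if k + 1 = n + p * (n - 4) then (0, n - 1) else
    (min p ((k - 2) / (n - 4)), k - min p ((k - 2) / (n - 4)) * (n - 4))

theorem pos_last {n p k : ℕ} (h : k + 1 = n + p * (n - 4)) : pos n p k = (0, n - 1) := by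
  rw [pos, if_pos h]

theorem pos_spec {n p k : ℕ} (hn : 6 < n) (hk : k + 1 < n + p * (n - 4)) :
    k = (pos n p k).1 * (n - 4) + (pos n p k).2 ∧ (pos n p k).1 ≤ p ∧
      ((pos n p k).2 + 3 ≤ n ∨ (pos n p k).1 = p ∧ (pos n p k).2 + 2 = n) ∧
      (2 ≤ (pos n p k).2 ∨ (pos n p k).1 = 0) := by
  obtain ⟨N, rfl⟩ : ∃ N, n = N + 4 := ⟨n - 4, by omega⟩
  rw [pos, if_neg (by omega)]
  simp only [Nat.add_sub_cancel] at hk ⊢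
  obtain ⟨d, hd⟩ : ∃ d, d = (k - 2) / N := ⟨_, rfl⟩
  have h1 : d * N ≤ k - 2 := by rw [hd]; exact Nat.div_mul_le_self _ _
  have h2 : k - 2 < d * N + N := by
    have h3 := Nat.div_add_mod' (k - 2) N
    have h4 := Nat.mod_lt (k - 2) (show 0 < N by omega)
    rw [← hd] at h3
    omega
  rw [← hd]
  rcases le_total p d with h | h
  · rw [min_eq_left h]
    have h3 := Nat.mul_le_mul_right N h
    refine ⟨by omega, le_rfl, by omega, ?_⟩
    obtain rfl | hp := Nat.eq_zero_or_pos p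
    · right; rfl
    · have := Nat.le_mul_of_pos_left N hp
      left; omega
  · rw [min_eq_right h]
    refine ⟨by omega, h, ?_, ?_⟩
    · have h3 := Nat.mul_le_mul_right N h
      by_cases hp : d = p
      · subst hp; omega
      · left; omega
    · obtain rfl | hp := Nat.eq_zero_or_pos d
      · right; rfl
      · have := Nat.le_mul_of_pos_left N hp
        left; omega

theorem pos_lt {n p k k' : ℕ} (hn : 6 < n) (hk : k' + 1 < n + p * (n - 4)) (h : k < k') :
    (pos n p k).1 = (pos n p k').1 ∧ (pos n p k).2 < (pos n p k').2 ∧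
        (pos n p k').2 - (pos n p k).2 = k' - k ∨
      ∃ j, (pos n p k').1 = (pos n p k).1 + j + 1 ∧ (pos n p k).2 + 3 ≤ n ∧
        2 ≤ (pos n p k').2 ∧ (j = 0 ∧ (pos n p k).2 = n - 3 ∧ (pos n p k').2 = 2 ↔
          k' = k + 1) := by
  obtain ⟨h1, h2, h3, h4⟩ := pos_spec hn (lt_of_le_of_lt (by omega) hk : k + 1 < n + p * (n - 4))
  obtain ⟨h1', h2', h3', h4'⟩ := pos_spec hn hk
  generalize pos n p k = a at *
  generalize pos n p k' = b at *
  obtain ⟨q, o⟩ := a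
  obtain ⟨q', o'⟩ := b
  simp only at *
  obtain ⟨N, rfl⟩ : ∃ N, n = N + 4 := ⟨n - 4, by omega⟩
  simp only [Nat.add_sub_cancel] at *
  rcases lt_trichotomy q q' with h5 | h5 | h5
  · right
    obtain ⟨j, rfl⟩ : ∃ j, q' = q + j + 1 := ⟨q' - q - 1, by omega⟩
    refine ⟨j, rfl, by omega, by omega, ?_⟩
    rw [add_mul, add_mul, one_mul] at h1'
    obtain rfl | hj := Nat.eq_zero_or_pos j
    · omega
    · have := Nat.le_mul_of_pos_left N hj
      omega
  · left
    subst h5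
    omega
  · exfalso
    obtain ⟨j, rfl⟩ : ∃ j, q = q' + j + 1 := ⟨q - q' - 1, by omega⟩
    rw [add_mul, add_mul, one_mul] at h1
    have : 2 ≤ o := by omega
    have : o' + 3 ≤ N + 4 := by omega
    have := Nat.zero_le (j * N)
    omega

theorem pos_of_small {n p k : ℕ} (hn : 6 < n) (hp : 1 ≤ p) (hk : k + 3 ≤ n) :
    pos n p k = (0, k) := by
  have h0 := Nat.le_mul_of_pos_left (n - 4) hp
  obtain ⟨h1, h2, h3, h4⟩ := pos_spec (p := p) hn (by omega : k + 1 < n + p * (n - 4))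
  rcases Nat.eq_zero_or_pos (pos n p k).1 with h | h
  · rw [h] at h1
    exact Prod.ext h (by simpa using h1.symm)
  · have := Nat.le_mul_of_pos_left (n - 4) h
    omega

theorem pos_turn {n p : ℕ} (hn : 6 < n) (hp : 1 ≤ p) : pos n p (n - 2) = (1, 2) := by
  have h0 := Nat.le_mul_of_pos_left (n - 4) hp
  obtain ⟨h1, h2, h3, h4⟩ := pos_spec (p := p) hn (by omega : n - 2 + 1 < n + p * (n - 4))
  generalize pos n p (n - 2) = a at *
  obtain ⟨q, o⟩ := a
  simp only at *
  obtain _ | _ | q := q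
  · omega
  · exact Prod.ext rfl (by simp only; omega)
  · rw [add_mul, add_mul] at h1
    have := Nat.zero_le (q * (n - 4))
    omega

end Position

section Cycles

variable {n p m : ℕ}

/-- The base point attached to a vertex of the long cycle. -/
def vertexOff (n p : ℕ) {m : ℕ} (c : ZMod n) (b x : ZMod m) : RAAG (cycleGraph n) :=
  off c (pos n p (x - b).val).1

/-- The label attached to a vertex of the long cycle. -/
def vertexLab (n p : ℕ) {m : ℕ} (c : ZMod n) (b x : ZMod m) : ZMod n :=
  lab c (pos n p (x - b).val).1 (pos n p (x - b).val).2

/-- The base points and labels attached to two cyclically consecutive positions are compatible. -/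
theorem pos_adj (hn : 6 < n) (hp : 1 ≤ p) (c : ZMod n) {k k' : ℕ} (hk : k' < n + p * (n - 4))
    (h : k' = k + 1 ∨ k = 0 ∧ k' + 1 = n + p * (n - 4)) :
    (cycleGraph n).Adj (lab c (pos n p k).1 (pos n p k).2)
        (lab c (pos n p k').1 (pos n p k').2) ∧
      ∃ δ, (off c (pos n p k).1)⁻¹ * δ ∈ sp (cycleGraph n)
          (lk (cycleGraph n) (lab c (pos n p k).1 (pos n p k).2)) ∧
        (off c (pos n p k').1)⁻¹ * δ ∈ sp (cycleGraph n)
          (lk (cycleGraph n) (lab c (pos n p k').1 (pos n p k').2)) := by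
  have h0 := Nat.le_mul_of_pos_left (n - 4) hp
  have hone : ∀ (g : RAAG (cycleGraph n)) L, g⁻¹ * g ∈ sp (cycleGraph n) L := fun g L => by
    rw [inv_mul_cancel]; exact one_mem _
  rcases h with rfl | ⟨rfl, hk'⟩
  · by_cases hlast : k + 1 + 1 = n + p * (n - 4)
    · obtain ⟨h1, h2, h3, h4⟩ := pos_spec (p := p) hn (by omega : k + 1 < n + p * (n - 4))
      rw [pos_last hlast]
      generalize pos n p k = a at *
      obtain ⟨q, o⟩ := a
      simp only at *
      obtain ⟨rfl, ho⟩ : q = p ∧ o = n - 2 := by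
        have := Nat.mul_le_mul_right (n - 4) h2
        rcases h3 with h3 | h3
        · omega
        · omega
      subst ho
      have hadj := lab_adj_succ c (by omega) q (n - 2)
      rw [show n - 2 + 1 = n - 1 by omega] at hadj
      rw [lab_last c (by omega), ← lab_last c (by omega) q]
      refine ⟨hadj, off c q, hone _ _, ?_⟩
      rw [lab_last c (by omega), off, inv_one, one_mul]
      exact off_mem_sp c (by omega) q
    · rcases pos_lt hn (by omega : k + 1 + 1 < n + p * (n - 4)) (Nat.lt_succ_self k) with h1 | h1
      · obtain ⟨h1, h2, h3⟩ := h1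
        rw [← h1]
        have h4 : (pos n p (k + 1)).2 = (pos n p k).2 + 1 := by omega
        rw [h4]
        exact ⟨lab_adj_succ c (by omega) _ _, off c (pos n p k).1, hone _ _, hone _ _⟩
      · obtain ⟨j, h1, h2, h3, h4⟩ := h1
        obtain ⟨rfl, h5, h6⟩ := h4.2 rfl
        rw [h1, h5, h6, Nat.add_zero, ← lab_succ c _ (o := 1) (by omega)]
        refine ⟨lab_adj_succ c (by omega) _ 1, off c ((pos n p k).1 + 1), ?_, hone _ _⟩
        rw [off, inv_mul_cancel_left]
        exact lt_mem_sp (lab_adj_succ c (by omega) _ 0).symm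
  · rw [pos_last hk', pos_of_small hn hp (by omega)]
    exact ⟨lab_adj_last c (by omega) 0, off c 0, hone _ _, hone _ _⟩

theorem pos_disjoint (hn : 6 < n) (hp : 1 ≤ p) (c : ZMod n) {k k' : ℕ}
    (hk : k' < n + p * (n - 4)) (hlt : k < k') (h1 : k' ≠ k + 1)
    (h2 : ¬ (k = 0 ∧ k' + 1 = n + p * (n - 4))) {ε ε' : Bool} {y : RAAG (cycleGraph n)}
    (h : InCopy c (pos n p k).1 (pos n p k).2 ε y) :
    ¬ InCopy c (pos n p k').1 (pos n p k').2 ε' y := by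
  have h0 := Nat.le_mul_of_pos_left (n - 4) hp
  by_cases hlast : k' + 1 = n + p * (n - 4)
  · obtain ⟨h3, h4, h5, h6⟩ := pos_spec (p := p) hn (by omega : k + 1 < n + p * (n - 4))
    rw [pos_last hlast]
    generalize pos n p k = a at *
    obtain ⟨q, o⟩ := a
    simp only at *
    have h7 : InCopy c 0 (n - 1) ε' y ↔ InCopy c q (n - 1) ε' y := by
      have h8 : (off c q)⁻¹ ∈ sp (cycleGraph n) (lk (cycleGraph n) (lab c q (n - 1))) := by
        rw [lab_last c (by omega)]
        exact inv_mem (off_mem_sp c (by omega) q)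
      have h9 := inH_sp_mul (s := (lab c q (n - 1), ε')) h8 y
      rw [InCopy, InCopy, h9, lab_last c (by omega), lab_last c (by omega), off, inv_one, one_mul]
    rw [h7]
    have h8 : o ≠ 0 := by
      rintro rfl
      rcases h6 with h6 | rfl
      · omega
      · omega
    have h9 : o + 2 ≠ n := by
      intro h9
      rcases h5 with h5 | h5
      · omega
      · rw [h5.1] at h3
        omega
    have h10 : o + 3 ≤ n := by omega
    exact h.disjoint (by omega) (by omega) (by omega) (by omega) (by omega)
  · obtain ⟨h3, h4, h5, h6⟩ := pos_spec (p := p) hn (by omega : k' + 1 < n + p * (n - 4))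
    rcases pos_lt hn (by omega : k' + 1 < n + p * (n - 4)) hlt with h7 | h7
    · obtain ⟨h7, h8, h9⟩ := h7
      rw [← h7]
      exact h.disjoint (by omega) h8 (by omega) (by omega) (by omega)
    · obtain ⟨j, h7, h8, h9, h10⟩ := h7
      rw [h7]
      exact h.disjoint_of_lt (by omega) h8 h9 (by omega) fun h11 => h1 (h10.1 h11)

theorem pos_base (hn : 6 < n) (c : ZMod n) {k : ℕ} (hk : k < n + p * (n - 4))
    (ε : Bool) : ¬ InCopy c (pos n p k).1 (pos n p k).2 ε 1 := by
  have hzero : ∀ o, ¬ InCopy c 0 o ε 1 := fun o => by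
    rw [InCopy, off, inv_one, one_mul]
    exact one_not_inH _
  by_cases hlast : k + 1 = n + p * (n - 4)
  · rw [pos_last hlast]
    exact hzero _
  · obtain ⟨h1, h2, h3, h4⟩ := pos_spec (p := p) hn (by omega : k + 1 < n + p * (n - 4))
    rcases h4 with h4 | h4
    · exact not_inCopy_one c (by omega) ε (by omega) (by omega)
    · rw [h4]
      exact hzero _

theorem val_add_one_cases [NeZero m] (hm : 2 ≤ m) (a : ZMod m) :
    (a + 1).val = a.val + 1 ∨ (a + 1).val = 0 ∧ a.val + 1 = m := by
  have h1 : (1 : ZMod m).val = 1 := ZMod.val_one'' (by omega)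
  have h2 := ZMod.val_lt a
  rw [ZMod.val_add, h1]
  by_cases h : a.val + 1 = m
  · right
    rw [h, Nat.mod_self]
    exact ⟨rfl, rfl⟩
  · left
    exact Nat.mod_eq_of_lt (by omega)

theorem pingPong (hn : 6 < n) (hp : 1 ≤ p) (hm : m = n + p * (n - 4)) (c : ZMod n)
    (b : ZMod m) : PingPong (cycleGraph m) (cycleGraph n) (vertexOff n p c b)
      (vertexLab n p c b) := by
  have hm0 : NeZero m := ⟨by omega⟩
  have hval : ∀ a : ZMod m, a.val < n + p * (n - 4) := fun a => hm ▸ ZMod.val_lt a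
  have hadj_of : ∀ a : ZMod m, (cycleGraph m).Adj a (a + 1) := fun a =>
    (cycle_adj (by omega)).2 (Or.inl rfl)
  refine ⟨fun x ε => ?_, ?_, ?_⟩
  · have := pos_base hn c (hval (x - b)) ε
    rwa [InCopy, mul_one] at this
  · have key : ∀ x : ZMod m, (cycleGraph n).Adj (vertexLab n p c b x) (vertexLab n p c b (x + 1)) ∧
        ∃ δ, (vertexOff n p c b x)⁻¹ * δ ∈ sp (cycleGraph n)
            (lk (cycleGraph n) (vertexLab n p c b x)) ∧
          (vertexOff n p c b (x + 1))⁻¹ * δ ∈ sp (cycleGraph n)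
            (lk (cycleGraph n) (vertexLab n p c b (x + 1))) := by
      intro x
      have h1 := val_add_one_cases (by omega) (x - b)
      rw [show x - b + 1 = x + 1 - b by ring] at h1
      rcases h1 with h1 | ⟨h1, h2⟩
      · exact pos_adj hn hp c (hval _) (Or.inl h1)
      · obtain ⟨h3, δ, h4, h5⟩ := pos_adj hn hp c (hval (x - b)) (Or.inr ⟨h1, hm ▸ h2⟩)
        exact ⟨h3.symm, δ, h5, h4⟩
    intro x z hxz
    rw [cycle_adj (by omega)] at hxz
    rcases hxz with rfl | h
    · exact key x
    · obtain rfl : x = z + 1 := by rw [h]; ring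
      obtain ⟨h3, δ, h4, h5⟩ := key z
      exact ⟨h3.symm, δ, h5, h4⟩
  · have key : ∀ x z : ZMod m, (x - b).val < (z - b).val → ¬ (cycleGraph m).Adj x z →
        ∀ ε ε' y, InCopy c (pos n p (x - b).val).1 (pos n p (x - b).val).2 ε y →
          ¬ InCopy c (pos n p (z - b).val).1 (pos n p (z - b).val).2 ε' y := by
      intro x z hlt hadj ε ε' y h
      refine pos_disjoint hn hp c (hval _) hlt (fun h1 => hadj ?_) (fun h1 => hadj ?_) h
      · have h2 : z - b = x - b + 1 := by
          rw [← ZMod.natCast_zmod_val (z - b), h1]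
          push_cast
          rw [ZMod.natCast_zmod_val]
        rw [show z = x + 1 by linear_combination h2]
        exact hadj_of x
      · have h2 : x - b = z - b + 1 := by
          have h3 : (((z - b).val + 1 : ℕ) : ZMod m) = 0 := by rw [h1.2, ← hm, ZMod.natCast_self]
          push_cast at h3
          rw [ZMod.natCast_zmod_val] at h3
          rw [h3]
          exact (ZMod.val_eq_zero _).1 h1.1
        rw [show x = z + 1 by linear_combination h2]
        exact (hadj_of z).symm
    intro x z hxz hadj ε ε' y h h'
    rcases lt_trichotomy (x - b).val (z - b).val with h1 | h1 | h1
    · exact key x z h1 hadj ε ε' y h h'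
    · exact hxz (by linear_combination ZMod.val_injective m h1)
    · exact key z x h1 (fun h2 => hadj h2.symm) ε' ε y h' h

theorem vertex_of_small (hn : 6 < n) (hp : 1 ≤ p) (c : ZMod n) {b x : ZMod m} {k : ℕ}
    (hm : m = n + p * (n - 4)) (hk : k + 3 ≤ n) (hx : x = b + k) :
    vertexOff n p c b x = 1 ∧ vertexLab n p c b x = c + k := by
  have h0 := Nat.le_mul_of_pos_left (n - 4) hp
  have h1 : (x - b).val = k := by
    rw [hx, add_sub_cancel_left]
    exact ZMod.val_cast_of_lt (by omega)
  rw [vertexOff, vertexLab, h1, pos_of_small hn hp hk]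
  exact ⟨rfl, lab_zero c k⟩

theorem vertex_turn (hn : 6 < n) (hp : 1 ≤ p) (c : ZMod n) {b x : ZMod m}
    (hm : m = n + p * (n - 4)) (hx : x = b + (n - 2 : ℕ)) :
    vertexLab n p c b x = c - 4 := by
  have h0 := Nat.le_mul_of_pos_left (n - 4) hp
  have h1 : (x - b).val = n - 2 := by
    rw [hx, add_sub_cancel_left]
    exact ZMod.val_cast_of_lt (by omega)
  rw [vertexLab, h1, pos_turn hn hp, lab_one]
  push_cast
  ring

theorem exists_glued_map (hn : 6 < n) (hp : 1 ≤ p) (hm : m = n + p * (n - 4)) :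
    ∃ (K : ℕ) (Φ : RAAG (cycleGraph m) → RAAG (cycleGraph n)) (x : ZMod m) (u v : ZMod n)
      (g a b a' b' : _), QI K Φ ∧ u ≠ v ∧
      (∀ k : ℤ, Φ (1 * (PresentedGroup.of x) ^ k) = a * (PresentedGroup.of u) ^ k * b) ∧
      ∀ k : ℤ, Φ (g * (PresentedGroup.of x) ^ k) = a' * (PresentedGroup.of v) ^ k * b' := by
  have h0 := Nat.le_mul_of_pos_left (n - 4) hp
  have hm0 : NeZero m := ⟨by omega⟩
  have H₁ := pingPong hn hp hm 0 0
  have H₂ := pingPong hn hp hm 1 1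
  obtain ⟨h₁, hh₁⟩ := H₁.exists_hom
  obtain ⟨h₂, hh₂⟩ := H₂.exists_hom
  have small₁ : ∀ k : ℕ, k + 3 ≤ n → vertexOff n p 0 (0 : ZMod m) (k : ZMod m) = 1 ∧
      vertexLab n p 0 (0 : ZMod m) (k : ZMod m) = k := fun k hk => by
    have := vertex_of_small hn hp 0 hm hk (b := 0) (zero_add _).symm
    rwa [zero_add] at this
  have small₂ : ∀ k : ℕ, 1 ≤ k → k + 2 ≤ n → vertexOff n p 1 (1 : ZMod m) (k : ZMod m) = 1 ∧
      vertexLab n p 1 (1 : ZMod m) (k : ZMod m) = k := fun k h1 hk => by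
    obtain ⟨k, rfl⟩ : ∃ i, k = i + 1 := ⟨k - 1, by omega⟩
    have := vertex_of_small hn hp 1 hm (by omega : k + 3 ≤ n) (b := 1)
      (x := ((k + 1 : ℕ) : ZMod m)) (by push_cast; ring)
    rw [this.1, this.2]
    exact ⟨rfl, by push_cast; ring⟩
  have gen₁ : ∀ k : ℕ, k + 3 ≤ n → h₁ (PresentedGroup.of (k : ZMod m)) =
      PresentedGroup.of (k : ZMod n) := fun k hk => by
    have h1 := hh₁ ((k : ZMod m), true)
    rw [(small₁ k hk).1, (small₁ k hk).2, inv_one, mul_one, one_mul] at h1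
    exact h1
  have gen₂ : ∀ k : ℕ, 1 ≤ k → k + 2 ≤ n → h₂ (PresentedGroup.of (k : ZMod m)) =
      PresentedGroup.of (k : ZMod n) := fun k h1 hk => by
    have h2 := hh₂ ((k : ZMod m), true)
    rw [(small₂ k h1 hk).1, (small₂ k h1 hk).2, inv_one, mul_one, one_mul] at h2
    exact h2
  have lk_two : ∀ {r : ℕ}, 2 ≤ r → ∀ v : ZMod r, v ∈ lk (cycleGraph r) ((2 : ℕ) : ZMod r) ↔
      v = ((3 : ℕ) : ZMod r) ∨ v = ((1 : ℕ) : ZMod r) := fun hr v => by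
    rw [mem_cycle_lk hr]
    push_cast
    norm_num
  obtain ⟨K, hK⟩ := glue_qi H₁ H₂ hh₁ hh₂ (x := ((2 : ℕ) : ZMod m)) (y := ((2 : ℕ) : ZMod n)) true
    (small₁ 2 (by omega)).1 (small₂ 2 (by omega) (by omega)).1 (small₁ 2 (by omega)).2
    (small₂ 2 (by omega) (by omega)).2
    (fun v hv => by
      rcases (lk_two (by omega) v).1 hv with rfl | rfl
      · rw [gen₁ 3 (by omega), gen₂ 3 (by omega) (by omega)]
      · rw [gen₁ 1 (by omega), gen₂ 1 (by omega) (by omega)])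
    (fun w hw => by
      rcases (lk_two (by omega) w).1 hw with rfl | rfl
      · exact ⟨_, (lk_two (by omega) _).2 (Or.inl rfl), gen₁ 3 (by omega)⟩
      · exact ⟨_, (lk_two (by omega) _).2 (Or.inr rfl), gen₁ 1 (by omega)⟩)
  have hne : ((2 : ℕ) : ZMod m) ≠ ((n - 2 : ℕ) : ZMod m) := fun h => by
    have h1 := congrArg ZMod.val h
    rw [ZMod.val_cast_of_lt (by omega), ZMod.val_cast_of_lt (by omega)] at h1
    omega
  have hout : ∀ (ε : Bool) (k : ℤ), ¬ InH (((2 : ℕ) : ZMod m), ε)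
      ((PresentedGroup.of ((n - 2 : ℕ) : ZMod m) : RAAG (cycleGraph m)) ^ k) := fun ε k =>
    not_inH_of_mem_sp (zpow_mem_sp (Set.mem_singleton _) k) (fun h => hne h)
  have hturn : vertexLab n p 0 (0 : ZMod m) ((n - 2 : ℕ) : ZMod m) = -4 := by
    rw [vertex_turn hn hp 0 hm (zero_add _).symm]
    ring
  refine ⟨K, glue (((2 : ℕ) : ZMod m), true) h₁ h₂, ((n - 2 : ℕ) : ZMod m), -4,
    ((n - 2 : ℕ) : ZMod n), lt (cycleGraph m) (((2 : ℕ) : ZMod m), true),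
    vertexOff n p 0 (0 : ZMod m) ((n - 2 : ℕ) : ZMod m),
    (vertexOff n p 0 (0 : ZMod m) ((n - 2 : ℕ) : ZMod m))⁻¹,
    h₂ (lt (cycleGraph m) (((2 : ℕ) : ZMod m), true)), 1, hK, fun h => ?_, fun k => ?_,
    fun k => ?_⟩
  · have h1 := natCast_ne_zero (n := n) (c := 2) (by omega) (by omega)
    rw [Nat.cast_sub (by omega), ZMod.natCast_self] at h
    exact h1 (by push_cast at h ⊢; linear_combination -h)
  · rw [one_mul, glue, if_neg (hout true k), map_zpow]
    have h1 := hh₁ (((n - 2 : ℕ) : ZMod m), true)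
    rw [hturn] at h1
    rw [← conj_zpow]
    exact congrArg (· ^ k) h1
  · have h1 : InH (((2 : ℕ) : ZMod m), true) (lt (cycleGraph m) (((2 : ℕ) : ZMod m), true) *
        (PresentedGroup.of ((n - 2 : ℕ) : ZMod m)) ^ k) := by
      rw [inH_lt_mul]
      exact hout false k
    rw [glue, if_pos h1, map_mul, map_zpow, gen₂ (n - 2) (by omega) (by omega), mul_one]

end Cycles

end RaagProof

/-- For `n > 6` and `m = n + p(n-4)` with `p ≥ 1`, there is a
quasiisometric embedding `Φ : A_{C_m} → A_{C_n}` not at finite distance from any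
composition `ψ' ∘ h ∘ ψ` of self-quasiisometric-embeddings with a homomorphism. -/
theorem qie_not_quasiconjugate_to_homomorphism (n p m : ℕ) (hn : 6 < n) (hp : 1 ≤ p)
    (hm : m = n + p * (n - 4)) :
    ∃ Φ : RAAG (cycleGraph m) → RAAG (cycleGraph n),
      IsQIEWith (wordDist (raagGen (cycleGraph m))) (wordDist (raagGen (cycleGraph n))) Φ ∧
      ∀ (ψ : RAAG (cycleGraph m) → RAAG (cycleGraph m))
        (ψ' : RAAG (cycleGraph n) → RAAG (cycleGraph n))
        (h : RAAG (cycleGraph m) →* RAAG (cycleGraph n)),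
        IsQIEWith (wordDist (raagGen (cycleGraph m))) (wordDist (raagGen (cycleGraph m))) ψ →
        IsQIEWith (wordDist (raagGen (cycleGraph n))) (wordDist (raagGen (cycleGraph n))) ψ' →
        ¬ AtFiniteDist (raagGen (cycleGraph n)) Φ (fun g => ψ' (h (ψ g))) := by
  have hpn := Nat.le_mul_of_pos_left (n - 4) hp
  obtain ⟨K₃, Φ, x, u, v, g, a, b, a', b', hΦ, huv, h1, h2⟩ := RaagProof.exists_glued_map hn hp hm
  refine ⟨Φ, hΦ.isQIEWith, fun ψ ψ' h hψ hψ' hfin => huv ?_⟩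
  obtain ⟨K₁, hK₁⟩ := RaagProof.exists_qi hψ
  obtain ⟨K₂, hK₂⟩ := RaagProof.exists_qi hψ'
  obtain ⟨C, hC⟩ := hfin
  obtain ⟨C', hC'⟩ := exists_nat_ge C
  obtain ⟨w, hw⟩ := RaagProof.exists_common_label (by omega) (by omega) h hK₁ hK₂ hΦ (C := C')
    (fun z => by
      have h3 := (hC z).trans hC'
      rw [RaagProof.wordDist_eq] at h3
      exact_mod_cast h3) x
  rw [RaagProof.eq_of_sub h1 (hw 1), RaagProof.eq_of_sub h2 (hw g)]
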